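/- arXiv:2302.12230 — 3 statements merged into one kernel-verified Lean document; each statement's English description precedes it below -/
import Mathlib

section
/- Let u ≥ 10^5 be an integer. There exists an integer d ≤ 5u/2 such that for some infinite strictly increasing sequence of positive integers n₀ < n₁ < n₂ < ⋯ satisfying n_{i+1} ≤ 4·n_i^9 for every i, for each i ≥ 1 there exists a connected d-regular graph on n_i vertices whose adjacency matrix has second largest eigenvalue exactly 2√(u²+1) − 1, occurring with eigenvalue multiplicity at least i. -/
/-- The adjacency matrix of a finite simple graph, with real entries. -/
noncomputable def adjMat {V : Type*} [Fintype V] (G : SimpleGraph V) : Matrix V V ℝ :=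
  letI := Classical.decRel G.Adj
  G.adjMatrix ℝ

noncomputable def deg {V : Type*} [Fintype V] (G : SimpleGraph V) (v : V) : ℕ :=
  letI := Classical.decRel G.Adj
  G.degree v

/-- `G` is `d`-regular. -/
def IsRegularGraph {V : Type*} [Fintype V] (G : SimpleGraph V) (d : ℕ) : Prop :=
  ∀ v, deg G v = d

/-- The eigenvalues of a real (symmetric) matrix, i.e. the real roots of its characteristic
polynomial with multiplicity, listed in decreasing order. -/
noncomputable def eigList {V : Type*} [Fintype V] [DecidableEq V] (A : Matrix V V ℝ) : List ℝ :=
  (A.charpoly.roots.sort (· ≤ ·)).reverse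

/-- `lam A i` is `λ_i(A)`, the `i`-th largest eigenvalue (counted with multiplicity, 1-indexed)
of a real symmetric matrix `A`. -/
noncomputable def lam {V : Type*} [Fintype V] [DecidableEq V] (A : Matrix V V ℝ) (i : ℕ) : ℝ :=
  (eigList A).getD (i - 1) 0

/-- The multiplicity of `μ` as an eigenvalue of `A`: the dimension of the `μ`-eigenspace. -/
noncomputable def eigMult {V : Type*} [Fintype V] [DecidableEq V] (A : Matrix V V ℝ) (μ : ℝ) : ℕ :=
  Module.finrank ℝ (Module.End.eigenspace (Matrix.mulVecLin A) μ)


section PartA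
open Matrix

theorem adjMat_symm {V : Type*} [Fintype V] (G : SimpleGraph V) : (adjMat G).IsSymm := by
  classical
  unfold adjMat
  exact SimpleGraph.isSymm_adjMatrix _

theorem adjMat_apply {V : Type*} [Fintype V] (G : SimpleGraph V) (x y : V) [Decidable (G.Adj x y)] :
    adjMat G x y = if G.Adj x y then 1 else 0 := by
  classical
  unfold adjMat
  simp [SimpleGraph.adjMatrix_apply]

theorem adjMat_herm {V : Type*} [Fintype V] (G : SimpleGraph V) : (adjMat G).IsHermitian := by
  have h := adjMat_symm G
  unfold Matrix.IsHermitian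
  rw [Matrix.conjTranspose_eq_transpose_of_trivial]
  exact h

theorem adjMat_one {V : Type*} [Fintype V] (G : SimpleGraph V) (d : ℕ)
    (hreg : IsRegularGraph G d) (x : V) : ∑ y, adjMat G x y = d := by
  classical
  have h := hreg x
  unfold deg at h
  unfold adjMat
  rw [← h]
  have := @SimpleGraph.adjMatrix_mulVec_const_apply ℝ V G (Classical.decRel G.Adj) _ _ 1 x
  simp only [Matrix.mulVec, dotProduct, Function.const_apply, mul_one] at this
  exact this

theorem lam_two {V : Type*} [Fintype V] [DecidableEq V] (A : Matrix V V ℝ) (hA : A.IsHermitian)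
    (d μ : ℝ) (hd : A.charpoly.IsRoot d) (hm : A.charpoly.IsRoot μ) (hlt : μ < d)
    (hq : ∀ a b : V, a ≠ b → μ < hA.eigenvalues a → μ < hA.eigenvalues b → False) :
    lam A 2 = μ := by
  have hroots : A.charpoly.roots = Multiset.map hA.eigenvalues Finset.univ.val := by
    rw [hA.roots_charpoly_eq_eigenvalues]; rfl
  have hne : A.charpoly ≠ 0 := (Matrix.charpoly_monic A).ne_zero
  unfold lam
  set l := eigList A with hl
  have hcoe : (l : Multiset ℝ) = A.charpoly.roots := by
    rw [hl]; unfold eigList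
    rw [Multiset.coe_reverse, Multiset.sort_eq]
  have hsort : l.Pairwise (fun a b => b ≤ a) := by
    rw [hl]; unfold eigList
    rw [List.pairwise_reverse]
    exact Multiset.pairwise_sort _ _
  have hdm : d ∈ l := by
    rw [← Multiset.mem_coe, hcoe, Polynomial.mem_roots hne]; exact hd
  have hmm : μ ∈ l := by
    rw [← Multiset.mem_coe, hcoe, Polynomial.mem_roots hne]; exact hm
  have hcount : (l.filter (fun x => μ < x)).length ≤ 1 := by
    have h1 : (l.filter (fun x => μ < x)).length = Multiset.card (Multiset.filter (fun x => μ < x) (l : Multiset ℝ)) := by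
      simp
    rw [h1, hcoe, hroots, Multiset.filter_map, Multiset.card_map]
    change (Finset.univ.filter (fun a => μ < hA.eigenvalues a)).card ≤ 1
    rw [Finset.card_le_one]
    intro a ha b hb
    by_contra hab
    simp at ha hb
    exact hq a b hab ha hb
  clear_value l
  match l, hsort, hdm, hmm, hcount with
  | [], _, hdm, _, _ => simp at hdm
  | [a], _, hdm, hmm, _ =>
    simp at hdm hmm; linarith
  | a :: b :: t, hsort, hdm, hmm, hcount =>
    simp only [List.pairwise_cons, List.mem_cons] at hsort hdm hmm
    obtain ⟨h1, h2, h3⟩ := hsort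
    have hb : ∀ x ∈ t, x ≤ b := h2
    have hab : b ≤ a := h1 b (Or.inl rfl)
    have hbm : b ≤ μ := by
      by_contra hcon
      push Not at hcon
      have : μ < a := lt_of_lt_of_le hcon hab
      simp [List.filter_cons, this, hcon] at hcount
    have hda : d = a := by
      rcases hdm with h | h | h
      · exact h
      · linarith
      · have := hb d h; linarith
    have : μ ≤ b := by
      rcases hmm with h | h | h
      · linarith
      · exact h.le
      · exact hb _ h
    simp
    linarith

theorem root_of_vec {V : Type*} [Fintype V] [DecidableEq V] (A : Matrix V V ℝ) (μ : ℝ)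
    (v : V → ℝ) (hv : v ≠ 0) (h : A *ᵥ v = μ • v) : A.charpoly.IsRoot μ := by
  have h1 : Module.End.HasEigenvalue (Matrix.mulVecLin A) μ := by
    apply Module.End.hasEigenvalue_of_hasEigenvector (x := v)
    rw [Module.End.hasEigenvector_iff, Module.End.mem_eigenspace_iff]
    exact ⟨by simpa using h, hv⟩
  have h2 := (Module.End.hasEigenvalue_iff_isRoot_charpoly (Matrix.mulVecLin A) μ).1 h1
  have h3 : (Matrix.mulVecLin A).charpoly = A.charpoly := by
    rw [← Matrix.toLin'_apply']
    exact Matrix.charpoly_toLin' A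
  rwa [h3] at h2

theorem spectral {V : Type*} [Fintype V] [DecidableEq V] [Nonempty V] (G : SimpleGraph V)
    (d : ℕ) (μ : ℝ) (i : ℕ) (hi : 1 ≤ i) (hreg : IsRegularGraph G d) (hlt : μ < d)
    (hq : ∀ v : V → ℝ, ∑ x, v x = 0 → ∑ x, v x * (adjMat G *ᵥ v) x ≤ μ * ∑ x, v x ^ 2)
    (F : Fin i → V → ℝ) (hF : LinearIndependent ℝ F) (hE : ∀ j, adjMat G *ᵥ F j = μ • F j) :
    G.Connected ∧ lam (adjMat G) 2 = μ ∧ i ≤ eigMult (adjMat G) μ := by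
  classical
  have hone : adjMat G *ᵥ (fun _ => (1:ℝ)) = (d:ℝ) • (fun _ => (1:ℝ)) := by
    ext x
    simp [Matrix.mulVec, dotProduct, adjMat_one G d hreg x]
  refine ⟨?_, ?_, ?_⟩
  · rw [SimpleGraph.connected_iff]
    refine ⟨?_, inferInstance⟩
    intro a b
    by_contra hab
    let C : V → ℝ := fun x => if G.Reachable a x then 1 else 0
    have hC : ∀ x, (adjMat G *ᵥ C) x = d * C x := by
      intro x
      have : ∀ y, adjMat G x y * C y = adjMat G x y * C x := by
        intro y
        rw [adjMat_apply]
        by_cases hxy : G.Adj x y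
        · have : G.Reachable a y ↔ G.Reachable a x :=
            ⟨fun h => h.trans hxy.symm.reachable, fun h => h.trans hxy.reachable⟩
          simp only [C, this]
        · simp [hxy]
      simp only [Matrix.mulVec, dotProduct]
      rw [Finset.sum_congr rfl (fun y _ => this y), ← Finset.sum_mul, adjMat_one G d hreg x]
    set c : ℝ := (∑ x, C x) / Fintype.card V with hc
    have hcard : (Fintype.card V : ℝ) ≠ 0 := by
      exact_mod_cast Fintype.card_ne_zero
    have h1 := hq (C - c • (fun _ => (1:ℝ))) (by
      simp [Finset.sum_sub_distrib, hc]; field_simp; simp)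
    have h2 : adjMat G *ᵥ (C - c • (fun _ => (1:ℝ))) = (d:ℝ) • (C - c • (fun _ => (1:ℝ))) := by
      rw [Matrix.mulVec_sub, Matrix.mulVec_smul, hone]
      ext x
      simp [hC x]; ring
    rw [h2] at h1
    set w := C - c • (fun _ => (1:ℝ)) with hw
    have h3 : ∑ x, w x * ((d:ℝ) • w) x = d * ∑ x, w x ^ 2 := by
      rw [Finset.mul_sum]; apply Finset.sum_congr rfl; intro x _; simp; ring
    rw [h3] at h1
    have hnn : 0 ≤ ∑ x, w x ^ 2 := Finset.sum_nonneg (fun x _ => sq_nonneg _)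
    have h0 : ∑ x, w x ^ 2 = 0 := by nlinarith
    rw [Finset.sum_eq_zero_iff_of_nonneg (fun x _ => sq_nonneg _)] at h0
    have ha := h0 a (Finset.mem_univ _)
    have hb := h0 b (Finset.mem_univ _)
    have ha' : w a = 0 := by simpa using ha
    have hb' : w b = 0 := by simpa using hb
    have e1 : C a = 1 := by simp [C]
    have e2 : C b = 0 := by simp [C, hab]
    simp [hw, e1, e2] at ha' hb'
    linarith
  · have hA := adjMat_herm G
    have hF0 : F ⟨0, hi⟩ ≠ 0 := hF.ne_zero _
    apply lam_two (adjMat G) hA d μ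
    · apply root_of_vec _ _ (fun _ => (1:ℝ)) _ hone
      intro h
      have := congrFun h (Classical.arbitrary V)
      simp at this
    · exact root_of_vec _ _ _ hF0 (hE _)
    · exact hlt
    · intro a b hab ha hb
      let x : V → ℝ := hA.eigenvectorBasis a
      let y : V → ℝ := hA.eigenvectorBasis b
      have hx : adjMat G *ᵥ x = hA.eigenvalues a • x := hA.mulVec_eigenvectorBasis a
      have hy : adjMat G *ᵥ y = hA.eigenvalues b • y := hA.mulVec_eigenvectorBasis b
      have ho := hA.eigenvectorBasis.orthonormal
      have hxx : ∑ k, x k * x k = 1 := by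
        have := ho.1 a
        have h2 : inner ℝ (hA.eigenvectorBasis a) (hA.eigenvectorBasis a) = (1:ℝ) := by
          rw [real_inner_self_eq_norm_sq, this]; norm_num
        simp only [PiLp.inner_apply] at h2
        rw [← h2]; apply Finset.sum_congr rfl; intro k _; simp [x]; ring
      have hyy : ∑ k, y k * y k = 1 := by
        have := ho.1 b
        have h2 : inner ℝ (hA.eigenvectorBasis b) (hA.eigenvectorBasis b) = (1:ℝ) := by
          rw [real_inner_self_eq_norm_sq, this]; norm_num
        simp only [PiLp.inner_apply] at h2
        rw [← h2]; apply Finset.sum_congr rfl; intro k _; simp [y]; ring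
      have hxy : ∑ k, x k * y k = 0 := by
        have h2 := ho.2 hab
        simp only [PiLp.inner_apply] at h2
        rw [← h2]; apply Finset.sum_congr rfl; intro k _; simp [x, y]; ring
      obtain ⟨α, β, hne, hz⟩ : ∃ α β : ℝ, 0 < α ^ 2 + β ^ 2 ∧ α * ∑ k, x k + β * ∑ k, y k = 0 := by
        by_cases h : ∑ k, x k = 0
        · exact ⟨1, 0, by norm_num, by simp [h]⟩
        · refine ⟨-∑ k, y k, ∑ k, x k, ?_, by ring⟩
          have := sq_nonneg (-∑ k, y k)
          have : 0 < (∑ k, x k) ^ 2 := by positivity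
          linarith
      have h1 := hq (α • x + β • y) (by
        simp [Finset.sum_add_distrib, ← Finset.mul_sum, hz])
      rw [Matrix.mulVec_add, Matrix.mulVec_smul, Matrix.mulVec_smul, hx, hy] at h1
      have e1 : ∑ k, (α • x + β • y) k * (α • hA.eigenvalues a • x + β • hA.eigenvalues b • y) k
          = hA.eigenvalues a * α ^ 2 * ∑ k, x k * x k
          + (hA.eigenvalues a + hA.eigenvalues b) * α * β * ∑ k, x k * y k
          + hA.eigenvalues b * β ^ 2 * ∑ k, y k * y k := by
        simp only [Finset.mul_sum, ← Finset.sum_add_distrib]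
        apply Finset.sum_congr rfl; intro k _
        simp; ring
      have e2 : ∑ k, (α • x + β • y) k ^ 2
          = α ^ 2 * ∑ k, x k * x k + 2 * α * β * ∑ k, x k * y k + β ^ 2 * ∑ k, y k * y k := by
        simp only [Finset.mul_sum, ← Finset.sum_add_distrib]
        apply Finset.sum_congr rfl; intro k _
        simp; ring
      rw [e1, e2, hxx, hyy, hxy] at h1
      have p1 := sq_nonneg α
      have p2 := sq_nonneg β
      rcases p1.lt_or_eq with h | h
      · nlinarith
      · nlinarith
  · unfold eigMult
    have hmem : ∀ j, F j ∈ Module.End.eigenspace (Matrix.mulVecLin (adjMat G)) μ := by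
      intro j
      rw [Module.End.mem_eigenspace_iff]
      simpa using hE j
    let F' : Fin i → Module.End.eigenspace (Matrix.mulVecLin (adjMat G)) μ := fun j => ⟨F j, hmem j⟩
    have hF' : LinearIndependent ℝ F' := by
      apply LinearIndependent.of_comp (Submodule.subtype _)
      exact hF
    have := hF'.fintype_card_le_finrank
    simpa using this

theorem transfer {V : Type*} [Fintype V] [DecidableEq V] [Nonempty V] (G : SimpleGraph V)
    (n : ℕ) (hn : Fintype.card V = n)
    (d : ℕ) (μ : ℝ) (i : ℕ) (hi : 1 ≤ i) (hlt : μ < d)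
    (hreg : ∀ x, ∑ y, adjMat G x y = d)
    (hq : ∀ v : V → ℝ, ∑ x, v x = 0 → ∑ x, v x * (adjMat G *ᵥ v) x ≤ μ * ∑ x, v x ^ 2)
    (F : Fin i → V → ℝ) (hF : LinearIndependent ℝ F) (hE : ∀ j, adjMat G *ᵥ F j = μ • F j) :
    ∃ G' : SimpleGraph (Fin n), G'.Connected ∧ IsRegularGraph G' d ∧
      lam (adjMat G') 2 = μ ∧ i ≤ eigMult (adjMat G') μ := by
  classical
  let e : Fin n ≃ V := (Fintype.equivFinOfCardEq hn).symm
  let G' : SimpleGraph (Fin n) := G.comap e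
  have hA : ∀ a b, adjMat G' a b = adjMat G (e a) (e b) := by
    intro a b
    rw [adjMat_apply, adjMat_apply]
    simp [G']
  have hmv : ∀ (v : V → ℝ) a, (adjMat G' *ᵥ (v ∘ e)) a = (adjMat G *ᵥ v) (e a) := by
    intro v a
    simp only [Matrix.mulVec, dotProduct, hA, Function.comp]
    exact Equiv.sum_comp e (fun y => adjMat G (e a) y * v y)
  have hreg' : IsRegularGraph G' d := by
    intro a
    have h1 := adjMat_one G' (deg G' a)
    have h2 : ∑ y, adjMat G' a y = (deg G' a : ℝ) := by
      unfold deg adjMat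
      have := @SimpleGraph.adjMatrix_mulVec_const_apply ℝ _ G' (Classical.decRel G'.Adj) _ _ 1 a
      simp only [Matrix.mulVec, dotProduct, Function.const_apply, mul_one] at this
      exact this
    have h3 : ∑ y, adjMat G' a y = (d : ℝ) := by
      rw [← hreg (e a)]
      simp only [hA]
      exact Equiv.sum_comp e (fun y => adjMat G (e a) y)
    have : (deg G' a : ℝ) = d := by rw [← h2, h3]
    exact_mod_cast this
  have : Nonempty (Fin n) := ⟨e.symm (Classical.arbitrary V)⟩
  have := spectral G' d μ i hi hreg' hlt (by
      intro v hv
      have h1 := hq (v ∘ e.symm) (by rw [← hv]; exact Equiv.sum_comp e.symm v)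
      have h2 : v = (v ∘ e.symm) ∘ e := by ext; simp
      rw [h2]
      simp only [hmv]
      have e1 := Equiv.sum_comp e (fun x => (v ∘ e.symm) x * (adjMat G *ᵥ (v ∘ e.symm)) x)
      have e2 := Equiv.sum_comp e (fun x => (v ∘ e.symm) x ^ 2)
      rw [← e1, ← e2] at h1
      exact h1)
    (fun j => F j ∘ e) (by
      rw [Fintype.linearIndependent_iff] at hF ⊢
      intro g hg j
      apply hF g
      ext x
      have := congrFun hg (e.symm x)
      simpa using this) (by
      intro j
      ext a
      rw [hmv, hE]; simp)
  exact ⟨G', this.1, hreg', this.2⟩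

end PartA

section PartB
open Matrix

theorem parseval2 {A B : Type*} [Fintype A] [Fintype B] [DecidableEq A] (e : A → B → ℝ) (N : ℝ)
    (h : ∀ a a', ∑ b, e a b * e a' b = if a = a' then N else 0) (f g : A → ℝ) :
    ∑ b, (∑ a, f a * e a b) * (∑ a, g a * e a b) = N * ∑ a, f a * g a := by
  have : ∀ b, (∑ a, f a * e a b) * (∑ a, g a * e a b) =
      ∑ a, ∑ a', f a * g a' * (e a b * e a' b) := by
    intro b
    rw [Finset.sum_mul_sum]
    refine Finset.sum_congr rfl fun a _ => Finset.sum_congr rfl fun a' _ => by ring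
  simp only [this]
  rw [Finset.sum_comm]
  simp only [Finset.mul_sum]
  refine Finset.sum_congr rfl fun a _ => ?_
  rw [Finset.sum_comm]
  simp only [← Finset.mul_sum, h]
  simp
  ring

theorem parseval1 {A B : Type*} [Fintype A] [Fintype B] [DecidableEq A] (e : A → B → ℝ) (N : ℝ)
    (h : ∀ a a', ∑ b, e a b * e a' b = if a = a' then N else 0) (f : A → ℝ) :
    ∑ b, (∑ a, f a * e a b) ^ 2 = N * ∑ a, f a ^ 2 := by
  have := parseval2 e N h f f
  simpa only [← sq] using this

/-- sign character on `ZMod 2` -/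
noncomputable def chi (x : ZMod 2) : ℝ := if x = 0 then 1 else -1

theorem chi_add (x y : ZMod 2) : chi (x + y) = chi x * chi y := by
  have h : ∀ x : ZMod 2, x = 0 ∨ x = 1 := by decide
  have h11 : (1 + 1 : ZMod 2) = 0 := by decide
  unfold chi
  rcases h x with rfl | rfl <;> rcases h y with rfl | rfl <;> simp [h11]

theorem chi_sq (x : ZMod 2) : chi x * chi x = 1 := by
  unfold chi
  split_ifs <;> norm_num

theorem chi_zero : chi 0 = 1 := by simp [chi]
theorem chi_one : chi 1 = -1 := by simp [chi]

theorem chi_cases (x : ZMod 2) : chi x = 1 ∨ chi x = -1 := by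
  unfold chi; split_ifs <;> simp

noncomputable def ee {i : ℕ} (s : Fin i → ZMod 2) (S : Finset (Fin i)) : ℝ := ∏ j ∈ S, chi (s j)

theorem ee_add {i : ℕ} (s t : Fin i → ZMod 2) (S : Finset (Fin i)) :
    ee (s + t) S = ee s S * ee t S := by
  unfold ee
  rw [← Finset.prod_mul_distrib]
  exact Finset.prod_congr rfl fun j _ => chi_add _ _

theorem ee_cases {i : ℕ} (s : Fin i → ZMod 2) (S : Finset (Fin i)) : ee s S = 1 ∨ ee s S = -1 := by
  unfold ee
  induction S using Finset.induction_on with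
  | empty => simp
  | insert a S ha ih =>
    rw [Finset.prod_insert ha]
    rcases ih with h | h <;> rcases chi_cases (s a) with h' | h' <;> simp [h, h']

theorem ee_le {i : ℕ} (s : Fin i → ZMod 2) (S : Finset (Fin i)) : ee s S ≤ 1 := by
  rcases ee_cases s S with h | h <;> rw [h]; norm_num

theorem ee_orth {i : ℕ} (s t : Fin i → ZMod 2) :
    ∑ S, ee s S * ee t S = if s = t then (2:ℝ) ^ i else 0 := by
  have h1 : ∀ S, ee s S * ee t S = ∏ j ∈ S, chi (s j + t j) := by
    intro S; rw [← ee_add]; rfl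
  simp only [h1]
  have := Finset.prod_one_add (f := fun j => chi (s j + t j)) (Finset.univ : Finset (Fin i))
  rw [Finset.powerset_univ] at this
  rw [← this]
  split_ifs with h
  · subst h
    have : ∀ j, chi (s j + s j) = 1 := by intro j; rw [chi_add, chi_sq]
    simp [this]; norm_num
  · obtain ⟨j, hj⟩ := Function.ne_iff.1 h
    apply Finset.prod_eq_zero (Finset.mem_univ j)
    have : s j + t j ≠ 0 := by
      intro h0
      apply hj
      generalize s j = a at *
      generalize t j = b at *
      revert a b; decide
    simp [chi, this]

theorem add_self2 {i : ℕ} (s : Fin i → ZMod 2) : s + s = 0 := by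
  ext j; simp; exact CharTwo.add_self_eq_zero _

theorem eq_add2 {i : ℕ} (s t v : Fin i → ZMod 2) : s = t + v ↔ t = s + v := by
  constructor
  · rintro rfl; rw [add_assoc, add_self2, add_zero]
  · rintro rfl; rw [add_assoc, add_self2, add_zero]

theorem ee_corr {i : ℕ} (f g : (Fin i → ZMod 2) → ℝ) (t : Fin i → ZMod 2) :
    (2:ℝ) ^ i * ∑ s, f s * g (s + t) = ∑ S, ee t S * ((∑ s, f s * ee s S) * (∑ s, g s * ee s S)) := by
  rw [← parseval2 ee _ ee_orth f (fun s => g (s + t))]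
  refine Finset.sum_congr rfl fun S _ => ?_
  have : ∑ s, g (s + t) * ee s S = ee t S * ∑ s, g s * ee s S := by
    rw [← Equiv.sum_comp (Equiv.addRight t) (fun s => g s * ee s S), Finset.mul_sum]
    refine Finset.sum_congr rfl fun s _ => ?_
    simp only [Equiv.coe_addRight, ee_add]
    rcases ee_cases t S with h | h <;> rw [h] <;> ring
  rw [this]; ring

end PartB

section PartC
open Matrix

theorem bil_le {V W : Type*} [Fintype V] [Fintype W] (M : V → W → ℝ) (τ : ℝ) (hτ : 0 < τ)
    (g : V → ℝ) (h : W → ℝ) (hM : ∑ r, (∑ l, M l r * g l) ^ 2 ≤ τ ^ 2 * ∑ l, g l ^ 2) :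
    2 * ∑ l, ∑ r, M l r * (g l * h r) ≤ τ * (∑ l, g l ^ 2 + ∑ r, h r ^ 2) := by
  have e1 : 2 * ∑ l, ∑ r, M l r * (g l * h r) = ∑ r, 2 * (∑ l, M l r * g l) * h r := by
    rw [Finset.sum_comm, Finset.mul_sum]
    refine Finset.sum_congr rfl fun r _ => ?_
    rw [mul_assoc, Finset.sum_mul]
    congr 1
    exact Finset.sum_congr rfl fun l _ => by ring
  have e2 : ∀ r, 2 * (∑ l, M l r * g l) * h r ≤ (∑ l, M l r * g l) ^ 2 / τ + τ * h r ^ 2 := by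
    intro r
    generalize (∑ l, M l r * g l) = a
    have : a ^ 2 / τ + τ * h r ^ 2 - 2 * a * h r = (a - τ * h r) ^ 2 / τ := by
      field_simp; ring
    have h2 : 0 ≤ (a - τ * h r) ^ 2 / τ := by positivity
    linarith
  rw [e1]
  calc _ ≤ ∑ r, ((∑ l, M l r * g l) ^ 2 / τ + τ * h r ^ 2) := Finset.sum_le_sum fun r _ => e2 r
    _ = (∑ r, (∑ l, M l r * g l) ^ 2) / τ + τ * ∑ r, h r ^ 2 := by
      rw [Finset.sum_add_distrib, Finset.sum_div, Finset.mul_sum]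
    _ ≤ (τ ^ 2 * ∑ l, g l ^ 2) / τ + τ * ∑ r, h r ^ 2 := by gcongr
    _ = _ := by field_simp

theorem bil_const {V : Type*} [Fintype V] (M : V → V → ℝ) (D τ : ℝ) (hD : 0 ≤ D) (hτ : 0 < τ)
    (hrow : ∀ l, ∑ r, M l r = D) (hcol : ∀ r, ∑ l, M l r = D)
    (hM : ∀ g : V → ℝ, ∑ l, g l = 0 → ∑ r, (∑ l, M l r * g l) ^ 2 ≤ τ ^ 2 * ∑ l, g l ^ 2)
    (g h : V → ℝ) (hgh : ∑ l, g l + ∑ r, h r = 0) :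
    2 * ∑ l, ∑ r, M l r * (g l * h r) ≤ τ * (∑ l, g l ^ 2 + ∑ r, h r ^ 2) := by
  rcases isEmpty_or_nonempty V with hV | hV
  · simp
  have hN : (0:ℝ) < Fintype.card V := by exact_mod_cast Fintype.card_pos
  set a : ℝ := (∑ l, g l) / Fintype.card V with ha
  have hga : ∑ l, g l = a * Fintype.card V := by rw [ha]; field_simp
  have hha : ∑ l, h l = - (a * Fintype.card V) := by linarith
  have s1 : ∑ l, (g l - a) = 0 := by
    rw [Finset.sum_sub_distrib, hga]; simp; ring
  have s2 : ∑ l, (h l + a) = 0 := by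
    rw [Finset.sum_add_distrib, hha]; simp; ring
  have key := bil_le M τ hτ (fun l => g l - a) (fun r => h r + a) (hM _ s1)
  have q1 : ∑ l, (g l - a) ^ 2 = ∑ l, g l ^ 2 - a ^ 2 * Fintype.card V := by
    have : ∀ l, (g l - a) ^ 2 = g l ^ 2 - 2 * a * g l + a ^ 2 := fun l => by ring
    simp only [this, Finset.sum_add_distrib, Finset.sum_sub_distrib, ← Finset.mul_sum, hga]
    simp; ring
  have q2 : ∑ l, (h l + a) ^ 2 = ∑ l, h l ^ 2 - a ^ 2 * Fintype.card V := by
    have : ∀ l, (h l + a) ^ 2 = h l ^ 2 + 2 * a * h l + a ^ 2 := fun l => by ring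
    simp only [this, Finset.sum_add_distrib, ← Finset.mul_sum, hha]
    simp; ring
  have q3 : ∑ l, ∑ r, M l r * ((g l - a) * (h r + a)) =
      ∑ l, ∑ r, M l r * (g l * h r) + a ^ 2 * D * Fintype.card V := by
    have : ∀ l r, M l r * ((g l - a) * (h r + a)) =
        M l r * (g l * h r) + a * (M l r * g l) - a * (M l r * h r) - a ^ 2 * M l r := by
      intro l r; ring
    simp only [this, Finset.sum_add_distrib, Finset.sum_sub_distrib, ← Finset.mul_sum, hrow]
    rw [Finset.sum_comm (f := fun l r => M l r * h r)]
    simp only [← Finset.sum_mul, hrow, hcol, ← Finset.mul_sum, hga, hha]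
    simp; ring
  rw [q1, q2, q3] at key
  have : 0 ≤ a ^ 2 * D * Fintype.card V := by positivity
  have : 0 ≤ τ * (a ^ 2 * Fintype.card V) := by positivity
  nlinarith

theorem bil_top {V : Type*} [Fintype V] (M : V → V → ℝ) (σ τ : ℝ) (hτ : 0 < τ) (hs : τ ≤ σ)
    (htop : ∀ l, ∑ r, M l r * (∑ l', M l' r) = σ ^ 2)
    (hM : ∀ g : V → ℝ, ∑ l, g l = 0 → ∑ r, (∑ l, M l r * g l) ^ 2 ≤ τ ^ 2 * ∑ l, g l ^ 2)
    (g : V → ℝ) :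
    ∑ r, (∑ l, M l r * g l) ^ 2 ≤ σ ^ 2 * ∑ l, g l ^ 2 := by
  rcases isEmpty_or_nonempty V with hV | hV
  · simp
  have hN : (0:ℝ) < Fintype.card V := by exact_mod_cast Fintype.card_pos
  set a : ℝ := (∑ l, g l) / Fintype.card V with ha
  have hga : ∑ l, g l = a * Fintype.card V := by rw [ha]; field_simp
  have s1 : ∑ l, (g l - a) = 0 := by
    rw [Finset.sum_sub_distrib, hga]; simp; ring
  have q1 : ∑ l, (g l - a) ^ 2 = ∑ l, g l ^ 2 - a ^ 2 * Fintype.card V := by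
    have : ∀ l, (g l - a) ^ 2 = g l ^ 2 - 2 * a * g l + a ^ 2 := fun l => by ring
    simp only [this, Finset.sum_add_distrib, Finset.sum_sub_distrib, ← Finset.mul_sum, hga]
    simp; ring
  have hk := hM _ s1
  have hcross : ∀ k : V → ℝ, ∑ r, (∑ l, M l r) * (∑ l, M l r * k l) = σ ^ 2 * ∑ l, k l := by
    intro k
    simp only [Finset.mul_sum]
    rw [Finset.sum_comm]
    refine Finset.sum_congr rfl fun l _ => ?_
    rw [← htop l, Finset.sum_mul]
    refine Finset.sum_congr rfl fun r _ => ?_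
    ring
  have e1 : ∀ r, (∑ l, M l r * g l) = a * (∑ l, M l r) + ∑ l, M l r * (g l - a) := by
    intro r
    rw [Finset.mul_sum, ← Finset.sum_add_distrib]
    exact Finset.sum_congr rfl fun l _ => by ring
  have e2 : ∑ r, (∑ l, M l r * g l) ^ 2 = a ^ 2 * ∑ r, (∑ l, M l r) ^ 2 +
      2 * a * ∑ r, (∑ l, M l r) * (∑ l, M l r * (g l - a)) + ∑ r, (∑ l, M l r * (g l - a)) ^ 2 := by
    simp only [e1, Finset.mul_sum (s := (Finset.univ : Finset V)) (a := a ^ 2),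
      Finset.mul_sum (s := (Finset.univ : Finset V)) (a := 2 * a)]
    rw [← Finset.sum_add_distrib, ← Finset.sum_add_distrib]
    exact Finset.sum_congr rfl fun l _ => by ring
  have e3 : ∑ r, (∑ l, M l r) ^ 2 = σ ^ 2 * Fintype.card V := by
    have := hcross (fun _ => 1)
    simp only [mul_one, ← sq] at this
    rw [this]; simp
  rw [e2, hcross, s1, e3]
  have : τ ^ 2 ≤ σ ^ 2 := by gcongr
  have h0 : 0 ≤ ∑ l, (g l - a) ^ 2 := Finset.sum_nonneg fun _ _ => sq_nonneg _
  have : τ ^ 2 * ∑ l, (g l - a) ^ 2 ≤ σ ^ 2 * ∑ l, (g l - a) ^ 2 := by gcongr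
  rw [q1] at this hk
  linarith

variable {V : Type*} [Fintype V] [DecidableEq V] {i : ℕ}

abbrev Vx (V : Type*) (i : ℕ) := (V × (Fin i → ZMod 2)) ⊕ (V × (Fin i → ZMod 2))

def adjR (base : V → V → Prop) (volt : V → V → Fin i → ZMod 2) : Vx V i → Vx V i → Prop
  | Sum.inl (l, s), Sum.inl (l', s') => l = l' ∧ s' = s + 1
  | Sum.inr (l, s), Sum.inr (l', s') => l = l' ∧ s' = s + 1
  | Sum.inl (l, s), Sum.inr (r, s') => base l r ∧ s' = s + volt l r
  | Sum.inr (r, s'), Sum.inl (l, s) => base l r ∧ s = s' + volt l r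

def gr (hi : 1 ≤ i) (base : V → V → Prop) (volt : V → V → Fin i → ZMod 2) :
    SimpleGraph (Vx V i) where
  Adj := adjR base volt
  symm := ⟨by
    rintro (⟨l, s⟩ | ⟨l, s⟩) (⟨r, t⟩ | ⟨r, t⟩) h
    · exact ⟨h.1.symm, (eq_add2 _ _ _).1 h.2⟩
    · exact ⟨h.1, (eq_add2 _ _ _).1 h.2⟩
    · exact ⟨h.1, (eq_add2 _ _ _).1 h.2⟩
    · exact ⟨h.1.symm, (eq_add2 _ _ _).1 h.2⟩⟩
  loopless := ⟨by
    rintro (⟨l, s⟩ | ⟨l, s⟩) h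
    · have := congrFun h.2 ⟨0, hi⟩
      simp at this
    · have := congrFun h.2 ⟨0, hi⟩
      simp at this⟩

theorem gr_inl (hi : 1 ≤ i) (base : V → V → Prop) [∀ l r, Decidable (base l r)]
    (volt : V → V → Fin i → ZMod 2) (v : Vx V i → ℝ) (l : V) (s : Fin i → ZMod 2) :
    (adjMat (gr hi base volt) *ᵥ v) (Sum.inl (l, s)) = v (Sum.inl (l, s + 1)) +
      ∑ r, (if base l r then 1 else 0) * v (Sum.inr (r, s + volt l r)) := by
  classical
  simp only [Matrix.mulVec, dotProduct]
  rw [Fintype.sum_sum_type]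
  simp only [Fintype.sum_prod_type, adjMat_apply]
  congr 1
  · rw [Finset.sum_eq_single l, Finset.sum_eq_single (s + 1)]
    · simp [gr, adjR]
    · intro b _ hb; simp [gr, adjR, hb]
    · simp
    · intro b _ hb; simp [gr, adjR, hb.symm]
    · simp
  · refine Finset.sum_congr rfl fun r _ => ?_
    rw [Finset.sum_eq_single (s + volt l r)]
    · simp [gr, adjR]
    · intro b _ hb; simp [gr, adjR, hb]
    · simp

theorem gr_inr (hi : 1 ≤ i) (base : V → V → Prop) [∀ l r, Decidable (base l r)]
    (volt : V → V → Fin i → ZMod 2) (v : Vx V i → ℝ) (r : V) (s : Fin i → ZMod 2) :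
    (adjMat (gr hi base volt) *ᵥ v) (Sum.inr (r, s)) = v (Sum.inr (r, s + 1)) +
      ∑ l, (if base l r then 1 else 0) * v (Sum.inl (l, s + volt l r)) := by
  classical
  simp only [Matrix.mulVec, dotProduct]
  rw [Fintype.sum_sum_type]
  simp only [Fintype.sum_prod_type, adjMat_apply]
  rw [add_comm]
  congr 1
  · rw [Finset.sum_eq_single r, Finset.sum_eq_single (s + 1)]
    · simp [gr, adjR]
    · intro b _ hb; simp [gr, adjR, hb]
    · simp
    · intro b _ hb; simp [gr, adjR, hb.symm]
    · simp
  · refine Finset.sum_congr rfl fun l _ => ?_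
    rw [Finset.sum_eq_single (s + volt l r)]
    · simp [gr, adjR]
    · intro b _ hb; simp [gr, adjR, hb]
    · simp

theorem voltage [Nonempty V] (hi : 1 ≤ i) (base : V → V → Prop) [∀ l r, Decidable (base l r)]
    (volt : V → V → Fin i → ZMod 2) (M : Finset (Fin i) → V → V → ℝ)
    (hMdef : ∀ S l r, M S l r = (if base l r then 1 else 0) * ee (volt l r) S)
    (D n : ℕ) (σ τ : ℝ) (hτ : 0 < τ) (hτσ : τ ≤ σ - 2) (hσD : σ < D + 2)
    (hn : n = 2 * (Fintype.card V * 2 ^ i))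
    (hrow : ∀ l, ∑ r, M ∅ l r = D) (hcol : ∀ r, ∑ l, M ∅ l r = D)
    (h0 : ∀ g : V → ℝ, ∑ l, g l = 0 → ∑ r, (∑ l, M ∅ l r * g l) ^ 2 ≤ τ ^ 2 * ∑ l, g l ^ 2)
    (htop : ∀ j l, ∑ r, M {j} l r * (∑ l', M {j} l' r) = σ ^ 2)
    (h1 : ∀ j, ∀ g : V → ℝ, ∑ l, g l = 0 →
      ∑ r, (∑ l, M {j} l r * g l) ^ 2 ≤ τ ^ 2 * ∑ l, g l ^ 2)
    (h2 : ∀ S, 2 ≤ S.card → ∀ g : V → ℝ,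
      ∑ r, (∑ l, M S l r * g l) ^ 2 ≤ τ ^ 2 * ∑ l, g l ^ 2) :
    ∃ G' : SimpleGraph (Fin n), G'.Connected ∧ IsRegularGraph G' (D + 1) ∧
      lam (adjMat G') 2 = σ - 1 ∧ i ≤ eigMult (adjMat G') (σ - 1) := by
  classical
  have he1 : ∀ j : Fin i, ee (1 : Fin i → ZMod 2) {j} = -1 := by
    intro j; simp [ee, chi_one]
  have he0 : ∀ s : Fin i → ZMod 2, ee s ∅ = 1 := by intro s; simp [ee]
  have hσ : 2 < σ := by linarith
  let c : Fin i → V → ℝ := fun j r => ∑ l, M {j} l r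
  let F : Fin i → Vx V i → ℝ := fun j x => match x with
    | Sum.inl (_, s) => σ * ee s {j}
    | Sum.inr (r, s) => ee s {j} * c j r
  refine transfer (gr hi base volt) n ?_ (D + 1) (σ - 1) i hi ?_ ?_ ?_ F ?_ ?_
  · rw [hn]
    simp [Fintype.card_sum, Fintype.card_prod, ZMod.card]; ring
  · push_cast; linarith
  · intro x
    have hx : ∑ y, adjMat (gr hi base volt) x y = (adjMat (gr hi base volt) *ᵥ fun _ => 1) x := by
      simp [Matrix.mulVec, dotProduct]
    rw [hx]
    rcases x with ⟨l, s⟩ | ⟨r, s⟩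
    · rw [gr_inl, add_comm]; push_cast; rw [← hrow l]; simp [hMdef, he0]
    · rw [gr_inr, add_comm]; push_cast; rw [← hcol r]; simp [hMdef, he0]
  · intro v hv
    let L : V → (Fin i → ZMod 2) → ℝ := fun l s => v (Sum.inl (l, s))
    let R : V → (Fin i → ZMod 2) → ℝ := fun l s => v (Sum.inr (l, s))
    let Lh : Finset (Fin i) → V → ℝ := fun S l => ∑ s, L l s * ee s S
    let Rh : Finset (Fin i) → V → ℝ := fun S l => ∑ s, R l s * ee s S
    have hP : (0:ℝ) < 2 ^ i := by positivity
    have nL : (2:ℝ) ^ i * ∑ l, ∑ s, L l s ^ 2 = ∑ S, ∑ l, Lh S l ^ 2 := by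
      symm
      rw [Finset.sum_comm, Finset.mul_sum]
      exact Finset.sum_congr rfl fun l _ => parseval1 ee _ ee_orth _
    have nR : (2:ℝ) ^ i * ∑ l, ∑ s, R l s ^ 2 = ∑ S, ∑ l, Rh S l ^ 2 := by
      symm
      rw [Finset.sum_comm, Finset.mul_sum]
      exact Finset.sum_congr rfl fun l _ => parseval1 ee _ ee_orth _
    have qL : (2:ℝ) ^ i * ∑ l, ∑ s, L l s * L l (s + 1) = ∑ S, ee 1 S * ∑ l, Lh S l ^ 2 := by
      have : ∀ (S : Finset (Fin i)) (f : V → ℝ), ee 1 S * ∑ l, f l = ∑ l, ee 1 S * f l :=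
        fun S f => Finset.mul_sum _ _ _
      simp only [this]
      symm
      rw [Finset.sum_comm, Finset.mul_sum]
      refine Finset.sum_congr rfl fun l _ => ?_
      rw [ee_corr]
      exact Finset.sum_congr rfl fun S _ => by simp only [Lh]; ring
    have qR : (2:ℝ) ^ i * ∑ l, ∑ s, R l s * R l (s + 1) = ∑ S, ee 1 S * ∑ l, Rh S l ^ 2 := by
      have : ∀ (S : Finset (Fin i)) (f : V → ℝ), ee 1 S * ∑ l, f l = ∑ l, ee 1 S * f l :=
        fun S f => Finset.mul_sum _ _ _
      simp only [this]
      symm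
      rw [Finset.sum_comm, Finset.mul_sum]
      refine Finset.sum_congr rfl fun l _ => ?_
      rw [ee_corr]
      exact Finset.sum_congr rfl fun S _ => by simp only [Rh]; ring
    have qX : (2:ℝ) ^ i * ∑ l, ∑ r, (if base l r then 1 else 0) * ∑ s, L l s * R r (s + volt l r) =
        ∑ S, ∑ l, ∑ r, M S l r * (Lh S l * Rh S r) := by
      symm
      rw [Finset.sum_comm, Finset.mul_sum]
      refine Finset.sum_congr rfl fun l _ => ?_
      rw [Finset.sum_comm, Finset.mul_sum]
      refine Finset.sum_congr rfl fun r _ => ?_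
      rw [mul_left_comm, ee_corr, Finset.mul_sum]
      exact Finset.sum_congr rfl fun S _ => by simp only [Lh, Rh, hMdef]; ring
    have hsq : ∑ x, v x ^ 2 = ∑ l, ∑ s, L l s ^ 2 + ∑ l, ∑ s, R l s ^ 2 := by
      rw [Fintype.sum_sum_type]; simp only [Fintype.sum_prod_type, L, R]
    have hquad : ∑ x, v x * (adjMat (gr hi base volt) *ᵥ v) x =
        ∑ l, ∑ s, L l s * L l (s + 1) + ∑ l, ∑ s, R l s * R l (s + 1) +
        2 * ∑ l, ∑ r, (if base l r then 1 else 0) * ∑ s, L l s * R r (s + volt l r) := by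
      rw [Fintype.sum_sum_type]; simp only [Fintype.sum_prod_type, gr_inl, gr_inr]
      simp only [mul_add, Finset.sum_add_distrib]
      have x1 : ∑ l, ∑ s, v (Sum.inl (l, s)) * ∑ r, (if base l r then 1 else 0) *
          v (Sum.inr (r, s + volt l r)) =
          ∑ l, ∑ r, (if base l r then 1 else 0) * ∑ s, L l s * R r (s + volt l r) := by
        refine Finset.sum_congr rfl fun l _ => ?_
        simp only [Finset.mul_sum]
        rw [Finset.sum_comm]
        exact Finset.sum_congr rfl fun r _ => Finset.sum_congr rfl fun s _ => by
          simp only [L, R]; ring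
      have x2 : ∑ r, ∑ s, v (Sum.inr (r, s)) * ∑ l, (if base l r then 1 else 0) *
          v (Sum.inl (l, s + volt l r)) =
          ∑ l, ∑ r, (if base l r then 1 else 0) * ∑ s, L l s * R r (s + volt l r) := by
        rw [Finset.sum_comm (f := fun l r => (if base l r then (1:ℝ) else 0) *
          ∑ s, L l s * R r (s + volt l r))]
        refine Finset.sum_congr rfl fun r _ => ?_
        simp only [Finset.mul_sum]
        rw [Finset.sum_comm]
        refine Finset.sum_congr rfl fun l _ => ?_
        rw [← Equiv.sum_comp (Equiv.addRight (volt l r))]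
        refine Finset.sum_congr rfl fun s _ => ?_
        simp only [L, R, Equiv.coe_addRight]
        rw [add_assoc, add_self2, add_zero]; ring
      rw [x1, x2]
      simp only [L, R]
      ring
    have hsum : ∑ l, Lh ∅ l + ∑ r, Rh ∅ r = 0 := by
      rw [← hv, Fintype.sum_sum_type]; simp only [Fintype.sum_prod_type, Lh, Rh, L, R, he0, mul_one]
    have main : ∀ S, ee 1 S * (∑ l, Lh S l ^ 2 + ∑ r, Rh S r ^ 2) +
        2 * ∑ l, ∑ r, M S l r * (Lh S l * Rh S r) ≤
        (σ - 1) * (∑ l, Lh S l ^ 2 + ∑ r, Rh S r ^ 2) := by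
      intro S
      have hnn : 0 ≤ ∑ l, Lh S l ^ 2 + ∑ r, Rh S r ^ 2 := by positivity
      rcases Nat.lt_or_ge S.card 2 with hc | hc
      · interval_cases hcc : S.card
        · rw [Finset.card_eq_zero] at hcc
          subst hcc
          have := bil_const (M ∅) D τ (by positivity) hτ hrow hcol h0 _ _ hsum
          rw [he0]
          nlinarith
        · rw [Finset.card_eq_one] at hcc
          obtain ⟨j, rfl⟩ := hcc
          have t := bil_top (M {j}) σ τ hτ (by linarith) (htop j) (h1 j) (Lh {j})
          have := bil_le (M {j}) σ (by linarith) (Lh {j}) (Rh {j}) t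
          rw [he1]
          linarith
      · have := bil_le (M S) τ hτ (Lh S) (Rh S) (h2 S hc _)
        have h3 := ee_le 1 S
        nlinarith
    have tot := Finset.sum_le_sum fun S (_ : S ∈ Finset.univ) => main S
    simp only [mul_add, Finset.sum_add_distrib, ← Finset.mul_sum] at tot
    rw [← qL, ← qR, ← nL, ← nR, ← qX] at tot
    rw [hquad, hsq]
    refine le_of_mul_le_mul_left ?_ hP
    linarith
  · rw [Fintype.linearIndependent_iff]
    intro a ha j
    obtain ⟨l⟩ := (inferInstance : Nonempty V)
    have z1 := congrFun ha (Sum.inl (l, 0))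
    have z2 := congrFun ha (Sum.inl (l, Pi.single j 1))
    simp only [Finset.sum_apply, Pi.smul_apply, smul_eq_mul, Pi.zero_apply, F, ee,
      Finset.prod_singleton, chi_zero] at z1 z2
    have z3 : ∑ k, a k * (σ * 1) - ∑ k, a k * (σ * chi ((Pi.single j 1 : Fin i → ZMod 2) k)) = 2 * σ * a j := by
      rw [← Finset.sum_sub_distrib, Finset.sum_eq_single j]
      · simp [chi_one]; ring
      · intro b _ hb; simp [hb, chi_zero]
      · simp
    rw [z1, z2] at z3
    have : 2 * σ ≠ 0 := by linarith
    have : 2 * σ * a j = 0 := by linarith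
    simpa [show σ ≠ 0 by linarith] using this
  · intro j
    ext x
    rcases x with ⟨l, s⟩ | ⟨r, s⟩
    · rw [gr_inl]
      simp only [F, Pi.smul_apply, smul_eq_mul, ee_add, he1]
      have : ∑ r, (if base l r then 1 else 0) * (ee s {j} * ee (volt l r) {j} * c j r) =
          ee s {j} * σ ^ 2 := by
        rw [← htop j l, Finset.mul_sum]
        exact Finset.sum_congr rfl fun r _ => by simp only [hMdef, c]; ring
      rw [this]; ring
    · rw [gr_inr]
      simp only [F, Pi.smul_apply, smul_eq_mul, ee_add, he1]
      have : ∑ l, (if base l r then 1 else 0) * (σ * (ee s {j} * ee (volt l r) {j})) =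
          ee s {j} * σ * c j r := by
        simp only [c]
        rw [Finset.mul_sum]
        exact Finset.sum_congr rfl fun r _ => by simp only [hMdef]; ring
      rw [this]; ring

end PartC

section PartD
open Matrix

theorem split_bound {E C : Type*} [Fintype E] [DecidableEq E] (cs : Finset C)
    (U : Finset E) (τ : C → E → E) (Good : E → C → Prop)
    (hinj : ∀ c ∈ cs, Set.InjOn (τ c) U)
    (hg : ∀ η ∈ U, ∀ c ∈ cs, ∀ c' ∈ cs, Good η c → Good η c' → c = c')
    (hb : ∀ η ∈ U, ∀ η' ∈ U, ∀ c ∈ cs, ∀ c' ∈ cs, ¬ Good η c → ¬ Good η' c' →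
      τ c η = τ c' η' → c = c')
    (ε : C → ℝ) (hε : ∀ c, ε c ^ 2 = 1) (f : E → ℝ) :
    ∑ η ∈ U, (∑ c ∈ cs, ε c * f (τ c η)) ^ 2 ≤ 4 * cs.card * ∑ ξ, f ξ ^ 2 := by
  classical
  have h1 : ∀ η ∈ U, (∑ c ∈ cs, ε c * f (τ c η)) ^ 2 ≤
      2 * ∑ c ∈ cs, f (τ c η) ^ 2 +
      2 * (cs.card * ∑ c ∈ cs.filter (fun c => ¬ Good η c), f (τ c η) ^ 2) := by
    intro η hη
    rw [← Finset.sum_filter_add_sum_filter_not cs (fun c => Good η c) (fun c => ε c * f (τ c η))]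
    set A := ∑ c ∈ cs.filter (fun c => Good η c), ε c * f (τ c η) with hA
    set B := ∑ c ∈ cs.filter (fun c => ¬ Good η c), ε c * f (τ c η) with hB
    have hA2 : A ^ 2 ≤ ∑ c ∈ cs, f (τ c η) ^ 2 := by
      by_cases hne : (cs.filter (fun c => Good η c)).Nonempty
      · obtain ⟨c, hc⟩ := hne
        have hc' := hc
        rw [Finset.mem_filter] at hc'
        have : A = ε c * f (τ c η) := by
          rw [hA]
          apply Finset.sum_eq_single_of_mem c hc
          intro b hb' hbc
          rw [Finset.mem_filter] at hb'
          exact absurd (hg η hη b hb'.1 c hc'.1 hb'.2 hc'.2) hbc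
        rw [this, mul_pow, hε, one_mul]
        exact Finset.single_le_sum (f := fun c => f (τ c η) ^ 2) (fun _ _ => sq_nonneg _) hc'.1
      · rw [Finset.not_nonempty_iff_eq_empty] at hne
        rw [hA, hne]
        simp
        exact Finset.sum_nonneg fun _ _ => sq_nonneg _
    have hB2 : B ^ 2 ≤ cs.card * ∑ c ∈ cs.filter (fun c => ¬ Good η c), f (τ c η) ^ 2 := by
      rw [hB]
      refine sq_sum_le_card_mul_sum_sq.trans ?_
      have e : ∀ c, (ε c * f (τ c η)) ^ 2 = f (τ c η) ^ 2 := by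
        intro c; rw [mul_pow, hε, one_mul]
      simp only [e]
      have : ((cs.filter (fun c => ¬ Good η c)).card : ℝ) ≤ cs.card := by
        exact_mod_cast Finset.card_filter_le _ _
      have h0 : 0 ≤ ∑ c ∈ cs.filter (fun c => ¬ Good η c), f (τ c η) ^ 2 :=
        Finset.sum_nonneg fun _ _ => sq_nonneg _
      gcongr
    nlinarith [sq_nonneg (A - B)]
  have h2 : ∑ η ∈ U, ∑ c ∈ cs, f (τ c η) ^ 2 ≤ cs.card * ∑ ξ, f ξ ^ 2 := by
    rw [Finset.sum_comm]
    have : ∀ c ∈ cs, ∑ η ∈ U, f (τ c η) ^ 2 ≤ ∑ ξ, f ξ ^ 2 := by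
      intro c hc
      rw [← Finset.sum_image (f := fun ξ => f ξ ^ 2) (hinj c hc)]
      exact Finset.sum_le_univ_sum_of_nonneg fun _ => sq_nonneg _
    refine (Finset.sum_le_sum this).trans ?_
    simp
  have h3 : ∑ η ∈ U, ∑ c ∈ cs.filter (fun c => ¬ Good η c), f (τ c η) ^ 2 ≤ ∑ ξ, f ξ ^ 2 := by
    rw [Finset.sum_sigma']
    rw [← Finset.sum_image (s := U.sigma fun η => cs.filter (fun c => ¬ Good η c))
      (g := fun x => τ x.2 x.1) (f := fun ξ => f ξ ^ 2)]
    · exact Finset.sum_le_univ_sum_of_nonneg fun _ => sq_nonneg _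
    · rintro ⟨η, c⟩ h ⟨η', c'⟩ h' heq
      simp only [Finset.coe_sigma, Set.mem_sigma_iff, Finset.mem_coe, Finset.mem_filter] at h h'
      have hcc := hb η h.1 η' h'.1 c h.2.1 c' h'.2.1 h.2.2 h'.2.2 heq
      subst hcc
      have := hinj c h.2.1 h.1 h'.1 heq
      subst this
      rfl
  calc _ ≤ ∑ η ∈ U, (2 * ∑ c ∈ cs, f (τ c η) ^ 2 +
      2 * (cs.card * ∑ c ∈ cs.filter (fun c => ¬ Good η c), f (τ c η) ^ 2)) :=
        Finset.sum_le_sum h1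
    _ = 2 * ∑ η ∈ U, ∑ c ∈ cs, f (τ c η) ^ 2 +
      2 * (cs.card * ∑ η ∈ U, ∑ c ∈ cs.filter (fun c => ¬ Good η c), f (τ c η) ^ 2) := by
        rw [Finset.sum_add_distrib]; simp only [Finset.mul_sum]
    _ ≤ 2 * (cs.card * ∑ ξ, f ξ ^ 2) + 2 * (cs.card * ∑ ξ, f ξ ^ 2) := by gcongr
    _ = _ := by ring

variable {K : Type*} [Field K] [Fintype K] [DecidableEq K] [CharP K 2] {n : ℕ}

abbrev WW (K : Type*) (n : ℕ) := (Fin (n + 1) → K) × (Fin (n + 1) → K)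

def nz (K : Type*) [Field K] [Fintype K] [DecidableEq K] : Finset K :=
  Finset.univ.filter (fun c => c ≠ 0)

def rr (c : K) (w : WW K n) (b : K) : Fin (n + 1) → K :=
  Fin.snoc (α := fun _ => K) (fun k : Fin n => w.1 k.succ + c * w.2 k.succ) b

def stp (c : K) (w : WW K n) (b : K) : WW K n := (rr c w b, w.2 + c • rr c w b)

def stepE (c : K) : (WW K n × K) ≃ (WW K n × K) where
  toFun x := (stp c x.1 x.2, x.1.1 0)
  invFun y := ((Fin.cons (α := fun _ => K) y.2
      (fun k : Fin n => y.1.1 k.castSucc + c * (y.1.2 + c • y.1.1) k.succ), y.1.2 + c • y.1.1),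
      y.1.1 (Fin.last n))
  left_inv := by
    rintro ⟨⟨p, q⟩, b⟩
    have h : q + c • rr c (p, q) b + c • rr c (p, q) b = q := by
      rw [add_assoc, CharTwo.add_self_eq_zero, add_zero]
    simp only [stp, h]
    refine Prod.ext (Prod.ext ?_ rfl) ?_
    · ext k
      refine Fin.cases ?_ (fun k => ?_) k
      · simp
      · simp [rr]
        rw [add_assoc, CharTwo.add_self_eq_zero, add_zero]
    · simp [rr]
  right_inv := by
    rintro ⟨⟨p, q⟩, a⟩
    have h : rr c (Fin.cons (α := fun _ => K) a
      (fun k : Fin n => p k.castSucc + c * (q + c • p) k.succ), q + c • p) (p (Fin.last n)) = p := by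
      ext k
      refine Fin.lastCases ?_ (fun k => ?_) k
      · simp [rr]
      · simp only [rr, Fin.snoc_castSucc, Fin.cons_succ]
        rw [add_assoc, CharTwo.add_self_eq_zero, add_zero]
    simp only [stp, h]
    refine Prod.ext (Prod.ext rfl ?_) ?_
    · change q + c • p + c • p = q
      rw [add_assoc, CharTwo.add_self_eq_zero, add_zero]
    · simp

theorem sum_stp (c : K) (F : WW K n → ℝ) :
    ∑ w, ∑ b, F (stp c w b) = Fintype.card K * ∑ w, F w := by
  have := Equiv.sum_comp (stepE (n := n) c) (fun x => F x.1)
  rw [Fintype.sum_prod_type (f := fun x : WW K n × K => F (stepE (n := n) c x).1),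
    Fintype.sum_prod_type (f := fun x : WW K n × K => F x.1)] at this
  simp only [stepE, Equiv.coe_fn_mk] at this
  rw [this]
  simp [Finset.mul_sum]

def Dop (u : Fin (n + 1) → K) : Fin (n + 1) → K :=
  Fin.snoc (α := fun _ => K) (fun k : Fin n => u k.succ) 0

def tau (c : K) (η : WW K n) : WW K n :=
  (Dop η.1 + c • (η.2 + c • η.1), η.2 + c • η.1)

theorem phase (c : K) (w : WW K n) (b : K) (η : WW K n) :
    w.1 ⬝ᵥ η.1 + w.2 ⬝ᵥ η.2 = (stp c w b).1 ⬝ᵥ (tau c η).1 + (stp c w b).2 ⬝ᵥ (tau c η).2 +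
      c * ((stp c w b).2 0 + c * (stp c w b).1 0) * η.1 0 + w.1 0 * η.1 0 := by
  obtain ⟨p, q⟩ := w
  obtain ⟨u, v⟩ := η
  have h2 : (2 : K) = 0 := CharTwo.two_eq_zero
  simp only [stp, tau]
  set r := rr c (p, q) b with hr
  have h1 : r ⬝ᵥ Dop u = ∑ k : Fin n, (p k.succ + c * q k.succ) * u k.succ := by
    simp only [dotProduct]
    rw [Fin.sum_univ_castSucc]
    simp [hr, rr, Dop]
  have hp : p ⬝ᵥ u = p 0 * u 0 + ∑ k : Fin n, p k.succ * u k.succ := by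
    simp only [dotProduct]; rw [Fin.sum_univ_succ]
  have hq : q ⬝ᵥ u = q 0 * u 0 + ∑ k : Fin n, q k.succ * u k.succ := by
    simp only [dotProduct]; rw [Fin.sum_univ_succ]
  have h3 : ∑ k : Fin n, (p k.succ + c * q k.succ) * u k.succ =
      ∑ k : Fin n, p k.succ * u k.succ + c * ∑ k : Fin n, q k.succ * u k.succ := by
    rw [Finset.mul_sum, ← Finset.sum_add_distrib]
    exact Finset.sum_congr rfl fun k _ => by ring
  simp only [dotProduct_add, add_dotProduct, dotProduct_smul, smul_dotProduct, smul_eq_mul, h1, hp,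
    hq, h3, Pi.add_apply, Pi.smul_apply]
  linear_combination (-(c * (r ⬝ᵥ v)) - c * c * (r ⬝ᵥ u) - c * ∑ k : Fin n, q k.succ * u k.succ - c * c * r 0 * u 0 - c * q 0 * u 0) * h2

theorem tau_inj (c : K) (η η' : WW K n) (h0 : η.1 0 = 0) (h0' : η'.1 0 = 0)
    (h : tau c η = tau c η') : η = η' := by
  obtain ⟨u, v⟩ := η
  obtain ⟨u', v'⟩ := η'
  simp only [tau, Prod.mk.injEq] at h
  obtain ⟨h1, h2⟩ := h
  rw [h2, add_left_inj] at h1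
  have hu : u = u' := by
    ext k
    refine Fin.cases ?_ (fun k => ?_) k
    · simp at h0 h0'; rw [h0, h0']
    · have := congrFun h1 k.castSucc
      simpa [Dop] using this
  subst hu
  rw [add_left_inj] at h2
  rw [h2]

def GoodP (η : WW K n) (c : K) : Prop :=
  ∃ N, (∀ k, N < k → η.1 k = 0 ∧ η.2 k = 0) ∧ η.1 N ≠ 0 ∧ η.2 N = c * η.1 N

theorem good_uniq (η : WW K n) (c c' : K) (h : GoodP η c) (h' : GoodP η c') : c = c' := by
  obtain ⟨N, h1, h2, h3⟩ := h
  obtain ⟨N', h1', h2', h3'⟩ := h'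
  have : N = N' := by
    apply le_antisymm
    · by_contra hc; exact h2 (h1' N (not_le.1 hc)).1
    · by_contra hc; exact h2' (h1 N' (not_le.1 hc)).1
  subst this
  rw [h3] at h3'
  exact mul_right_cancel₀ h2 h3'

theorem bad_form (η : WW K n) (hη : η ≠ 0) (c : K) (h : ¬ GoodP η c) :
    ∃ N, (∀ k, N < k → (tau c η).2 k = 0) ∧ (tau c η).2 N ≠ 0 ∧
      (tau c η).1 N = c * (tau c η).2 N := by
  obtain ⟨u, v⟩ := η
  have hne : (Finset.univ.filter (fun k => u k ≠ 0 ∨ v k ≠ 0)).Nonempty := by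
    by_contra hc
    rw [Finset.not_nonempty_iff_eq_empty, Finset.filter_eq_empty_iff] at hc
    apply hη
    refine Prod.ext ?_ ?_
    · ext k; by_contra h0; exact hc (Finset.mem_univ k) (Or.inl h0)
    · ext k; by_contra h0; exact hc (Finset.mem_univ k) (Or.inr h0)
  let N := Finset.max' _ hne
  have hN := Finset.max'_mem _ hne
  have hNmax : ∀ k, N < k → u k = 0 ∧ v k = 0 := by
    intro k hk
    by_contra h0
    have : k ≤ N := Finset.le_max' _ _ (by
      rw [Finset.mem_filter]
      refine ⟨Finset.mem_univ _, ?_⟩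
      by_contra h1
      push Not at h1
      exact h0 h1)
    exact absurd hk (not_lt.2 this)
  rw [Finset.mem_filter] at hN
  have hN2 : u N ≠ 0 ∨ v N ≠ 0 := hN.2
  refine ⟨N, ?_, ?_, ?_⟩
  · intro k hk
    obtain ⟨h1, h2⟩ := hNmax k hk
    simp [tau, h1, h2]
  · intro h0
    simp only [tau, Pi.add_apply, Pi.smul_apply, smul_eq_mul] at h0
    have hv : v N = c * u N := by
      have := CharTwo.add_eq_zero.1 h0
      exact this
    apply h
    refine ⟨N, hNmax, ?_, hv⟩
    intro hu
    simp only at hu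
    rw [hu, mul_zero] at hv
    rcases hN2 with h | h
    · exact h hu
    · exact h hv
  · have : Dop u N = 0 := by
      clear_value N
      revert hNmax
      refine Fin.lastCases ?_ (fun k => ?_) N
      · intro _; simp [Dop]
      · intro hm
        have := (hm k.succ (Fin.castSucc_lt_succ)).1
        simpa [Dop] using this
    simp [tau, this]
    ring

theorem bad_uniq (η η' : WW K n) (hη : η ≠ 0) (hη' : η' ≠ 0) (c c' : K) (h : ¬ GoodP η c)
    (h' : ¬ GoodP η' c') (heq : tau c η = tau c' η') : c = c' := by
  obtain ⟨N, h1, h2, h3⟩ := bad_form η hη c h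
  obtain ⟨N', h1', h2', h3'⟩ := bad_form η' hη' c' h'
  rw [← heq] at h1' h2' h3'
  have : N = N' := by
    apply le_antisymm
    · by_contra hc; exact h2 (h1' N (not_le.1 hc))
    · by_contra hc; exact h2' (h1 N' (not_le.1 hc))
  subst this
  rw [h3] at h3'
  exact mul_right_cancel₀ h2 h3'

/-- the main linear operator -/
def KK (H : WW K n → K → ℝ) (w : WW K n) (κ : K) : ℝ :=
  ∑ c ∈ nz K, ∑ b, H (stp c w b) (κ + c)

variable (ψ : K → ℝ)

def pr (a b : WW K n × K) : ℝ := ψ (a.1.1 ⬝ᵥ b.1.1 + a.1.2 ⬝ᵥ b.1.2 + a.2 * b.2)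

theorem pr_orth (hψa : ∀ a b, ψ (a + b) = ψ a * ψ b) (hψ1 : ∀ a, ψ a ^ 2 = 1)
    (hψs : ∀ y, ∑ x, ψ (x * y) = if y = 0 then (Fintype.card K : ℝ) else 0)
    (a a' : WW K n × K) : ∑ b, pr ψ a b * pr ψ a' b =
      if a = a' then (Fintype.card (WW K n × K) : ℝ) else 0 := by
  classical
  split_ifs with h
  · subst h
    simp [pr, ← sq, hψ1]
  · obtain ⟨⟨p, q⟩, k⟩ := a
    obtain ⟨⟨p', q'⟩, k'⟩ := a'
    have h1 : ∀ b, pr ψ ((p, q), k) b * pr ψ ((p', q'), k') b = pr ψ ((p + p', q + q'), k + k') b := by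
      intro b
      simp only [pr]
      rw [← hψa]; congr 1
      simp only [add_dotProduct]; ring
    simp only [h1]
    have hne : ∃ t : WW K n × K, (p + p') ⬝ᵥ t.1.1 + (q + q') ⬝ᵥ t.1.2 + (k + k') * t.2 = 1 := by
      by_contra hcon
      apply h
      have hz : ∀ t : WW K n × K, (p + p') ⬝ᵥ t.1.1 + (q + q') ⬝ᵥ t.1.2 + (k + k') * t.2 = 0 := by
        intro t
        by_contra h0
        apply hcon
        refine ⟨(((p + p') ⬝ᵥ t.1.1 + (q + q') ⬝ᵥ t.1.2 + (k + k') * t.2)⁻¹) • t, ?_⟩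
        simp only [Prod.smul_fst, Prod.smul_snd, dotProduct_smul, smul_eq_mul]
        generalize ((p + p') ⬝ᵥ t.1.1) = A at *
        generalize ((q + q') ⬝ᵥ t.1.2) = B at *
        field_simp
      have e1 : p + p' = 0 := dotProduct_eq_zero _ fun t => by
        simpa using hz ((t, 0), 0)
      have e2 : q + q' = 0 := dotProduct_eq_zero _ fun t => by
        simpa using hz ((0, t), 0)
      have e3 : k + k' = 0 := by
        simpa using hz ((0, 0), 1)
      have f1 : p = p' := by
        ext j; exact CharTwo.add_eq_zero.1 (congrFun e1 j)
      have f2 : q = q' := by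
        ext j; exact CharTwo.add_eq_zero.1 (congrFun e2 j)
      rw [f1, f2, CharTwo.add_eq_zero.1 e3]
    obtain ⟨t, ht⟩ := hne
    obtain ⟨x, hx⟩ : ∃ x, ψ x ≠ 1 := by
      by_contra hc
      push Not at hc
      have := hψs 1
      simp [hc] at this
    set a := ((p + p', q + q'), k + k') with ha
    have hs : ∀ b, pr ψ a (b + x • t) = pr ψ a b * ψ x := by
      intro b
      simp only [pr]
      rw [← hψa]; congr 1
      have : x = x * ((p + p') ⬝ᵥ t.1.1 + (q + q') ⬝ᵥ t.1.2 + (k + k') * t.2) := by rw [ht, mul_one]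
      conv_rhs => rw [this]
      simp only [ha, Prod.fst_add, Prod.snd_add, Prod.smul_fst, Prod.smul_snd, dotProduct_add,
        dotProduct_smul, smul_eq_mul]
      ring
    have := Equiv.sum_comp (Equiv.addRight (x • t)) (fun b => pr ψ a b)
    simp only [Equiv.coe_addRight, hs, ← Finset.sum_mul] at this
    have h3 : (∑ b, pr ψ a b) * (ψ x - 1) = 0 := by linarith
    rcases mul_eq_zero.1 h3 with h4 | h4
    · exact h4
    · exact absurd (by linarith) hx

theorem KK_fourier (hψa : ∀ a b, ψ (a + b) = ψ a * ψ b) (hψ1 : ∀ a, ψ a ^ 2 = 1)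
    (hψs : ∀ y, ∑ x, ψ (x * y) = if y = 0 then (Fintype.card K : ℝ) else 0)
    (H : WW K n → K → ℝ) (η : WW K n) (θ : K) :
    ∑ x : WW K n × K, KK H x.1 x.2 * pr ψ x (η, θ) =
      if η.1 0 = 0 then (Fintype.card K : ℝ) * ∑ c ∈ nz K, ψ (c * θ) *
        ∑ x : WW K n × K, H x.1 x.2 * pr ψ x (tau c η, θ) else 0 := by
  have key : ∀ c, ∑ x : WW K n × K, (∑ b, H (stp c x.1 b) (x.2 + c)) * pr ψ x (η, θ) =
      if η.1 0 = 0 then (Fintype.card K : ℝ) * (ψ (c * θ) *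
        ∑ x : WW K n × K, H x.1 x.2 * pr ψ x (tau c η, θ)) else 0 := by
    intro c
    have e1 : ∑ x : WW K n × K, (∑ b, H (stp c x.1 b) (x.2 + c)) * pr ψ x (η, θ) =
        ∑ κ, ∑ y : WW K n × K, H y.1 (κ + c) * (ψ (y.1.1 ⬝ᵥ (tau c η).1 + y.1.2 ⬝ᵥ (tau c η).2) *
          ψ (c * (y.1.2 0 + c * y.1.1 0) * η.1 0) * ψ (y.2 * η.1 0) * ψ (κ * θ)) := by
      rw [Fintype.sum_prod_type, Finset.sum_comm]
      refine Finset.sum_congr rfl fun κ _ => ?_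
      rw [← Equiv.sum_comp (stepE (n := n) c)]
      symm
      refine (Fintype.sum_prod_type _).trans ?_
      refine Finset.sum_congr rfl fun w _ => ?_
      symm
      rw [Finset.sum_mul]
      refine Finset.sum_congr rfl fun b _ => ?_
      simp only [stepE, Equiv.coe_fn_mk, pr]
      rw [← hψa, ← hψa, ← hψa, phase c w b η]
    rw [e1]
    have e2 : ∀ κ, ∑ y : WW K n × K, H y.1 (κ + c) * (ψ (y.1.1 ⬝ᵥ (tau c η).1 + y.1.2 ⬝ᵥ (tau c η).2) *
          ψ (c * (y.1.2 0 + c * y.1.1 0) * η.1 0) * ψ (y.2 * η.1 0) * ψ (κ * θ)) =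
        if η.1 0 = 0 then (Fintype.card K : ℝ) * ∑ w : WW K n, H w (κ + c) * (ψ (w.1 ⬝ᵥ (tau c η).1 + w.2 ⬝ᵥ (tau c η).2) * ψ (κ * θ)) else 0 := by
      intro κ
      have e3 : ∀ (w : WW K n), ∑ a : K, H w (κ + c) * (ψ (w.1 ⬝ᵥ (tau c η).1 + w.2 ⬝ᵥ (tau c η).2) *
          ψ (c * (w.2 0 + c * w.1 0) * η.1 0) * ψ (a * η.1 0) * ψ (κ * θ)) =
          H w (κ + c) * (ψ (w.1 ⬝ᵥ (tau c η).1 + w.2 ⬝ᵥ (tau c η).2) *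
          ψ (c * (w.2 0 + c * w.1 0) * η.1 0) * (if η.1 0 = 0 then (Fintype.card K : ℝ) else 0) * ψ (κ * θ)) := by
        intro w
        rw [← hψs, Finset.mul_sum, Finset.sum_mul, Finset.mul_sum]
      rw [Fintype.sum_prod_type]
      simp only [e3]
      split_ifs with h
      · have h0 : ψ 0 = 1 := by
          have h1 := hψa 0 0
          have h2 := hψ1 0
          rw [add_zero] at h1
          rw [sq] at h2
          linarith
        simp only [h, mul_zero, h0, Finset.mul_sum]
        exact Finset.sum_congr rfl fun w _ => by ring
      · simp
    simp only [e2]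
    split_ifs with h
    · rw [← Finset.mul_sum]
      congr 1
      rw [Fintype.sum_prod_type, Finset.sum_comm (f := fun (x : WW K n) (y : K) => H x y * pr ψ (x, y) (tau c η, θ)), Finset.mul_sum]
      rw [← Equiv.sum_comp (Equiv.addRight c) (fun κ => ψ (c * θ) * ∑ x, H x κ * pr ψ (x, κ) (tau c η, θ))]
      refine Finset.sum_congr rfl fun κ _ => ?_
      rw [Finset.mul_sum]
      refine Finset.sum_congr rfl fun w _ => ?_
      simp only [pr, Equiv.coe_addRight]
      have : ψ ((κ + c) * θ) = ψ (κ * θ) * ψ (c * θ) := by rw [add_mul, hψa]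
      rw [hψa _ ((κ + c) * θ), this, hψa]
      have h1 := hψ1 (c * θ)
      linear_combination (-(H w (κ + c) * (ψ (w.1 ⬝ᵥ (tau c η).1) * ψ (w.2 ⬝ᵥ (tau c η).2)) * ψ (κ * θ))) * h1
    · simp
  have e0 : ∑ x : WW K n × K, KK H x.1 x.2 * pr ψ x (η, θ) =
      ∑ c ∈ nz K, ∑ x : WW K n × K, (∑ b, H (stp c x.1 b) (x.2 + c)) * pr ψ x (η, θ) := by
    rw [Finset.sum_comm]
    refine Finset.sum_congr rfl fun x _ => ?_
    rw [KK, Finset.sum_mul]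
  rw [e0]
  simp only [key]
  split_ifs with h
  · rw [Finset.mul_sum]
  · simp

theorem KK_bound (hψa : ∀ a b, ψ (a + b) = ψ a * ψ b) (hψ1 : ∀ a, ψ a ^ 2 = 1)
    (hψs : ∀ y, ∑ x, ψ (x * y) = if y = 0 then (Fintype.card K : ℝ) else 0)
    (H : WW K n → K → ℝ) (hH : ∑ w, ∑ κ, H w κ = 0) :
    ∑ w, ∑ κ, KK H w κ ^ 2 ≤
      (4 * (nz K).card + 1) * (Fintype.card K : ℝ) ^ 2 * ∑ w, ∑ κ, H w κ ^ 2 := by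
  classical
  have h0 : ψ 0 = 1 := by
    have h1 := hψa 0 0
    have h2 := hψ1 0
    rw [add_zero] at h1
    rw [sq] at h2
    linarith
  let f : WW K n → K → ℝ := fun η θ => ∑ x : WW K n × K, H x.1 x.2 * pr ψ x (η, θ)
  have hf0 : f 0 0 = 0 := by
    simp only [f, pr]
    rw [Fintype.sum_prod_type]
    simpa [h0] using hH
  have hP : (0:ℝ) < Fintype.card (WW K n × K) := by exact_mod_cast Fintype.card_pos
  have p1 := parseval1 (pr ψ (n := n)) _ (pr_orth ψ hψa hψ1 hψs) (fun x => H x.1 x.2)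
  have p2 := parseval1 (pr ψ (n := n)) _ (pr_orth ψ hψa hψ1 hψs) (fun x => KK H x.1 x.2)
  rw [Fintype.sum_prod_type (f := fun x : WW K n × K => H x.1 x.2 ^ 2), Fintype.sum_prod_type_right] at p1
  rw [Fintype.sum_prod_type (f := fun x : WW K n × K => KK H x.1 x.2 ^ 2), Fintype.sum_prod_type_right] at p2
  simp only [KK_fourier ψ hψa hψ1 hψs H] at p2
  have main : ∀ θ, ∑ η : WW K n, (if η.1 0 = 0 then (Fintype.card K : ℝ) * ∑ c ∈ nz K, ψ (c * θ) *
      f (tau c η) θ else 0) ^ 2 ≤ (4 * (nz K).card + 1) * (Fintype.card K : ℝ) ^ 2 * ∑ η, f η θ ^ 2 := by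
    intro θ
    let U : Finset (WW K n) := Finset.univ.filter (fun η => η.1 0 = 0 ∧ η ≠ 0)
    have s1 := split_bound (nz K) U tau GoodP
      (by
        intro c _ η hη η' hη' h
        simp [U] at hη hη'
        exact tau_inj c η η' hη.1 hη'.1 h)
      (by intro η _ c _ c' _; exact good_uniq η c c')
      (by
        intro η hη η' hη' c _ c' _
        simp [U] at hη hη'
        exact bad_uniq η η' hη.2 hη'.2 c c')
      (fun c => ψ (c * θ)) (fun c => hψ1 _) (fun η => f η θ)
    have s2 : (∑ c ∈ nz K, ψ (c * θ) * f (tau c 0) θ) ^ 2 ≤ ∑ η, f η θ ^ 2 := by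
      have t0 : ∀ c : K, tau c (0 : WW K n) = 0 := by
        intro c
        have hd : Dop (0 : Fin (n + 1) → K) = 0 := by
          ext k
          refine Fin.lastCases ?_ (fun k => ?_) k <;> simp [Dop]
        simp [tau, hd]
      simp only [t0, ← Finset.sum_mul]
      have hle : f 0 θ ^ 2 ≤ ∑ η, f η θ ^ 2 :=
        Finset.single_le_sum (f := fun η => f η θ ^ 2) (fun _ _ => sq_nonneg _) (Finset.mem_univ _)
      by_cases hθ : θ = 0
      · subst hθ; rw [hf0]; simp; exact Finset.sum_nonneg fun _ _ => sq_nonneg _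
      · have : ∑ c ∈ nz K, ψ (c * θ) = -1 := by
          have h1 := hψs θ
          rw [if_neg hθ] at h1
          have h2 := Finset.sum_filter_add_sum_filter_not Finset.univ (fun c : K => c ≠ 0) (fun c => ψ (c * θ))
          rw [h1] at h2
          simp [Finset.filter_eq', h0] at h2
          unfold nz
          simp
          linarith
        rw [this]
        simpa using hle
    have e : ∀ η : WW K n, (if η.1 0 = 0 then (Fintype.card K : ℝ) * ∑ c ∈ nz K, ψ (c * θ) *
      f (tau c η) θ else 0) ^ 2 = (Fintype.card K : ℝ) ^ 2 * (if η.1 0 = 0 then (∑ c ∈ nz K, ψ (c * θ) *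
      f (tau c η) θ) ^ 2 else 0) := by
      intro η
      split_ifs <;> ring
    simp only [e]
    rw [← Finset.mul_sum, ← Finset.sum_filter]
    have hins : Finset.univ.filter (fun η : WW K n => η.1 0 = 0) = insert 0 U := by
      ext η
      simp only [Finset.mem_filter, Finset.mem_univ, true_and, Finset.mem_insert, U]
      constructor
      · intro h; by_cases h' : η = 0
        · exact Or.inl h'
        · exact Or.inr ⟨h, h'⟩
      · rintro (h | h)
        · rw [h]; rfl
        · exact h.1
    rw [hins, Finset.sum_insert (by simp [U])]
    have : 0 ≤ (Fintype.card K : ℝ) ^ 2 := by positivity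
    calc _ ≤ (Fintype.card K : ℝ) ^ 2 * (∑ η, f η θ ^ 2 + 4 * (nz K).card * ∑ η, f η θ ^ 2) := by
          gcongr
      _ = _ := by ring
  have tot := Finset.sum_le_sum fun θ (_ : θ ∈ Finset.univ) => main θ
  rw [← Finset.mul_sum] at tot
  have p2' : ∑ θ, ∑ η : WW K n, (if η.1 0 = 0 then (Fintype.card K : ℝ) * ∑ c ∈ nz K, ψ (c * θ) *
      f (tau c η) θ else 0) ^ 2 = Fintype.card (WW K n × K) * ∑ w, ∑ κ, KK H w κ ^ 2 := p2
  have p1' : ∑ θ, ∑ η, f η θ ^ 2 = Fintype.card (WW K n × K) * ∑ w, ∑ κ, H w κ ^ 2 := p1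
  rw [p2', p1'] at tot
  refine le_of_mul_le_mul_left ?_ hP
  linarith

end PartD

section PartE
open Matrix

theorem tri_sq {A : Type*} [Fintype A] (x y : A → ℝ) (a b N : ℝ) (ha : 0 ≤ a) (hb : 0 ≤ b)
    (hx : ∑ k, x k ^ 2 ≤ a ^ 2 * N) (hy : ∑ k, y k ^ 2 ≤ b ^ 2 * N) :
    ∑ k, (x k + y k) ^ 2 ≤ (a + b) ^ 2 * N := by
  have hx0 : 0 ≤ ∑ k, x k ^ 2 := Finset.sum_nonneg fun _ _ => sq_nonneg _
  have hy0 : 0 ≤ ∑ k, y k ^ 2 := Finset.sum_nonneg fun _ _ => sq_nonneg _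
  rcases ha.eq_or_lt with h | h
  · subst h
    have hz : ∑ k, x k ^ 2 = 0 := by
      apply le_antisymm _ hx0
      simpa using hx
    rw [Finset.sum_eq_zero_iff_of_nonneg (fun _ _ => sq_nonneg _)] at hz
    have : ∀ k, x k = 0 := fun k => by simpa using hz k (Finset.mem_univ k)
    simp only [this, zero_add]
    exact hy
  rcases hb.eq_or_lt with h' | h'
  · subst h'
    have hz : ∑ k, y k ^ 2 = 0 := by
      apply le_antisymm _ hy0
      simpa using hy
    rw [Finset.sum_eq_zero_iff_of_nonneg (fun _ _ => sq_nonneg _)] at hz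
    have : ∀ k, y k = 0 := fun k => by simpa using hz k (Finset.mem_univ k)
    simp only [this, add_zero]
    exact hx
  have hp : ∀ k, (x k + y k) ^ 2 ≤ (1 + b / a) * x k ^ 2 + (1 + a / b) * y k ^ 2 := by
    intro k
    have : (1 + b / a) * x k ^ 2 + (1 + a / b) * y k ^ 2 - (x k + y k) ^ 2 =
        (b * x k - a * y k) ^ 2 / (a * b) := by
      field_simp; ring
    have h2 : 0 ≤ (b * x k - a * y k) ^ 2 / (a * b) := by positivity
    linarith
  calc _ ≤ ∑ k, ((1 + b / a) * x k ^ 2 + (1 + a / b) * y k ^ 2) := Finset.sum_le_sum fun k _ => hp k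
    _ = (1 + b / a) * ∑ k, x k ^ 2 + (1 + a / b) * ∑ k, y k ^ 2 := by
      rw [Finset.sum_add_distrib, Finset.mul_sum, Finset.mul_sum]
    _ ≤ (1 + b / a) * (a ^ 2 * N) + (1 + a / b) * (b ^ 2 * N) := by gcongr
    _ = _ := by field_simp; ring

theorem reduce {Ω : Type*} [Fintype Ω] [DecidableEq Ω] [Nonempty Ω] {i : ℕ} (hi : 1 ≤ i)
    (bX : Ω → Ω → Prop) [∀ x y, Decidable (bX x y)] (vX : Ω → Ω → Fin i → ZMod 2)
    (hirr : ∀ x, ¬ bX x x)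
    (X : Finset (Fin i) → Ω → Ω → ℝ)
    (hX : ∀ S x y, X S x y = (if bX x y then 1 else 0) * ee (vX x y) S)
    (u D' n : ℕ) (hu : u ≤ D') (C : ℝ) (hC0 : 0 ≤ C) (hC : C ≤ u - 2)
    (hn : n = 2 * (Fintype.card Ω * 2 * 2 ^ i))
    (row0 : ∀ x, ∑ y, X ∅ x y = D') (col0 : ∀ y, ∑ x, X ∅ x y = D')
    (row1 : ∀ j x, ∑ y, X {j} x y = u) (col1 : ∀ j y, ∑ x, X {j} x y = u)
    (hb : ∀ S (h : Ω → ℝ), 2 ≤ S.card ∨ ∑ x, h x = 0 →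
      ∑ y, (∑ x, X S x y * h x) ^ 2 ≤ C ^ 2 * ∑ x, h x ^ 2) :
    ∃ G' : SimpleGraph (Fin n), G'.Connected ∧ IsRegularGraph G' (2 * D' + 2 + 1) ∧
      lam (adjMat G') 2 = 2 * Real.sqrt ((u : ℝ) ^ 2 + 1) - 1 ∧
      i ≤ eigMult (adjMat G') (2 * Real.sqrt ((u : ℝ) ^ 2 + 1) - 1) := by
  classical
  let ρ : Finset (Fin i) → Bool → ℝ := fun S t => ee (if t then 1 else 0 : Fin i → ZMod 2) S
  have hρ : ∀ S t, ρ S t ^ 2 = 1 := by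
    intro S t; rcases ee_cases (if t then 1 else 0 : Fin i → ZMod 2) S with h | h <;>
      simp only [ρ, h] <;> norm_num
  let base : Ω × Bool → Ω × Bool → Prop := fun l r => bX l.1 r.1 ∨ l.1 = r.1
  let volt : Ω × Bool → Ω × Bool → Fin i → ZMod 2 := fun l r =>
    if l.1 = r.1 then (if r.2 then 1 else 0) else vX l.1 r.1
  let M : Finset (Fin i) → Ω × Bool → Ω × Bool → ℝ := fun S l r =>
    X S l.1 r.1 + (if l.1 = r.1 then ρ S r.2 else 0)
  have hM : ∀ S l r, M S l r = (if base l r then 1 else 0) * ee (volt l r) S := by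
    rintro S ⟨x, t⟩ ⟨y, t'⟩
    simp only [M, base, volt, hX]
    by_cases h : x = y
    · subst h; simp [hirr, ρ]
    · simp [h]
  have mcol : ∀ S (g : Ω × Bool → ℝ) y t', ∑ l, M S l (y, t') * g l =
      ∑ x, X S x y * (g (x, true) + g (x, false)) + ρ S t' * (g (y, true) + g (y, false)) := by
    intro S g y t'
    rw [Fintype.sum_prod_type]
    simp only [M, Fintype.sum_bool, ← mul_add, add_mul, Finset.sum_add_distrib]
    congr 1
    rw [Finset.sum_eq_single y]
    · simp
    · intro b _ hb; simp [hb]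
    · simp
  have mrow : ∀ S (g : Ω × Bool → ℝ) x t, ∑ r, M S (x, t) r * g r =
      ∑ y, X S x y * (g (y, true) + g (y, false)) + (ρ S true * g (x, true) + ρ S false * g (x, false)) := by
    intro S g x t
    rw [Fintype.sum_prod_type]
    simp only [M, Fintype.sum_bool, mul_add, add_mul, Finset.sum_add_distrib]
    have e : ∀ b, ∑ y, (if x = y then ρ S b else 0) * g (y, b) = ρ S b * g (x, b) := by
      intro b
      rw [Finset.sum_eq_single x]
      · simp
      · intro b _ hb; simp [hb.symm]
      · simp
    rw [e, e]
  have mbd : ∀ S (g : Ω × Bool → ℝ), 2 ≤ S.card ∨ ∑ l, g l = 0 →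
      ∑ r, (∑ l, M S l r * g l) ^ 2 ≤ (2 * (C + 1)) ^ 2 * ∑ l, g l ^ 2 := by
    intro S g hg
    let h : Ω → ℝ := fun x => g (x, true) + g (x, false)
    have hh : 2 ≤ S.card ∨ ∑ x, h x = 0 := by
      rcases hg with hg | hg
      · exact Or.inl hg
      · right; rw [← hg, Fintype.sum_prod_type]; simp [h]
    have h1 := hb S h hh
    have h2 : ∀ t', ∑ y, (∑ x, X S x y * h x + ρ S t' * h y) ^ 2 ≤ (C + 1) ^ 2 * ∑ x, h x ^ 2 := by
      intro t'
      apply tri_sq _ _ _ _ _ hC0 zero_le_one h1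
      simp [mul_pow, hρ]
    have h3 : ∑ x, h x ^ 2 ≤ 2 * ∑ l, g l ^ 2 := by
      rw [Fintype.sum_prod_type, Finset.mul_sum]
      refine Finset.sum_le_sum fun x _ => ?_
      simp only [h, Fintype.sum_bool]
      nlinarith [sq_nonneg (g (x, true) - g (x, false))]
    rw [Fintype.sum_prod_type, Finset.sum_comm]
    simp only [mcol, Fintype.sum_bool]
    have a1 := h2 true
    have a2 := h2 false
    have : (C + 1) ^ 2 * ∑ x, h x ^ 2 ≤ (C + 1) ^ 2 * (2 * ∑ l, g l ^ 2) := by gcongr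
    simp only [h] at a1 a2 this
    linarith
  set q := Real.sqrt ((u : ℝ) ^ 2 + 1) with hq
  have hq2 : q ^ 2 = (u : ℝ) ^ 2 + 1 := by rw [hq, Real.sq_sqrt (by positivity)]
  have hq0 : 0 ≤ q := Real.sqrt_nonneg _
  have hqu : (u : ℝ) ≤ q := by
    rw [hq]; apply Real.le_sqrt_of_sq_le; linarith
  have hqu' : q ≤ u + 1 := by
    have : (0:ℝ) ≤ u := by positivity
    nlinarith
  have huD : (u : ℝ) ≤ D' := by exact_mod_cast hu
  refine voltage hi base volt M hM (2 * D' + 2) n (2 * q) (2 * (C + 1)) (by linarith) (by linarith)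
    (by push_cast; linarith) (by rw [hn]; simp) ?_ ?_ ?_ ?_ ?_ ?_
  · rintro ⟨x, t⟩
    have := mrow ∅ (fun _ => 1) x t
    simp only [mul_one, ← Finset.sum_mul, row0] at this
    rw [this]; simp [ρ, ee]; ring
  · rintro ⟨x, t⟩
    have := mcol ∅ (fun _ => 1) x t
    simp only [mul_one, ← Finset.sum_mul, col0] at this
    rw [this]; simp [ρ, ee]; ring
  · intro g hg; exact mbd ∅ g (Or.inr hg)
  · rintro j ⟨x, t⟩
    have hc : ∀ y t', ∑ l, M {j} l (y, t') = 2 * u + 2 * ρ {j} t' := by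
      intro y t'
      have := mcol {j} (fun _ => 1) y t'
      simp only [mul_one, ← Finset.sum_mul, col1] at this
      rw [this]; ring
    rw [mrow]
    simp only [hc, ← Finset.sum_mul, row1]
    have r1 : ρ {j} true = -1 := by simp [ρ, ee, chi_one]
    have r2 : ρ {j} false = 1 := by simp [ρ, ee, chi_zero]
    rw [r1, r2, mul_pow, hq2]; ring
  · intro j g hg; exact mbd {j} g (Or.inr hg)
  · intro S hS g; exact mbd S g (Or.inl hS)

end PartE

section PartF
open Matrix

variable {K : Type*} [Field K] [Fintype K] [DecidableEq K] [CharP K 2] {n : ℕ} (col : K → Fin 4)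

def iot (l : Fin 4) : ZMod 11 := (l.val : ZMod 11)

theorem iot_inj : Function.Injective iot := by decide

def sg (l : Fin 4) (x : K) : ℝ := if col x = l then -1 else 1

def EE (S : Finset (Fin n)) (w : WW K n) (δ : ZMod 11) : ℝ :=
  ∏ j ∈ S, (if δ = iot (col (w.1 j.castSucc)) then -1 else 1)

def sl (S : Finset (Fin n)) (w : WW K n) (l : Fin 4) : ℝ := ∏ j ∈ S, sg col l (w.1 j.castSucc)

theorem EE_sq (S : Finset (Fin n)) (w : WW K n) (δ : ZMod 11) : EE col S w δ ^ 2 = 1 := by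
  unfold EE
  rw [← Finset.prod_pow]
  apply Finset.prod_eq_one
  intro j _
  split_ifs <;> norm_num

theorem sl_sq (S : Finset (Fin n)) (w : WW K n) (l : Fin 4) : sl col S w l ^ 2 = 1 := by
  unfold sl
  rw [← Finset.prod_pow]
  apply Finset.prod_eq_one
  intro j _
  unfold sg
  split_ifs <;> norm_num

theorem EE_iot (S : Finset (Fin n)) (w : WW K n) (l : Fin 4) :
    EE col S w (iot l) = sl col S w l := by
  unfold EE sl sg
  refine Finset.prod_congr rfl fun j _ => ?_
  have : (iot l = iot (col (w.1 j.castSucc))) ↔ (col (w.1 j.castSucc) = l) :=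
    ⟨fun h => (iot_inj h).symm, fun h => by rw [h]⟩
  simp only [this]

theorem EE_decomp (S : Finset (Fin n)) (w : WW K n) (δ : ZMod 11) :
    EE col S w δ = 1 + ∑ l, (sl col S w l - 1) * (if δ = iot l then 1 else 0) := by
  by_cases h : ∃ l, δ = iot l
  · obtain ⟨l, rfl⟩ := h
    rw [EE_iot, Finset.sum_eq_single l]
    · simp
    · intro b _ hb
      have : ¬ (iot l = iot b) := fun h => hb (iot_inj h).symm
      simp [this]
    · simp
  · push Not at h
    simp only [h, if_false, mul_zero, Finset.sum_const_zero, add_zero]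
    unfold EE
    apply Finset.prod_eq_one
    intro j _
    simp [h]

theorem EE_conv (S : Finset (Fin n)) (w : WW K n) (a : ZMod 11 → ℝ) (φ' : ZMod 11) :
    ∑ φ, EE col S w (φ' - φ) * a φ = ∑ φ, a φ + ∑ l, (sl col S w l - 1) * a (φ' - iot l) := by
  simp only [EE_decomp, add_mul, one_mul, Finset.sum_add_distrib, Finset.sum_mul]
  congr 1
  rw [Finset.sum_comm]
  refine Finset.sum_congr rfl fun l _ => ?_
  rw [Finset.sum_eq_single (φ' - iot l)]
  · simp
  · intro b _ hb
    have : ¬ (φ' - b = iot l) := by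
      intro h; apply hb; rw [← h]; ring
    simp [this]
  · simp

theorem EE_zero (S : Finset (Fin n)) (w : WW K n) (a : ZMod 11 → ℝ) (ha : ∑ φ, a φ = 0) :
    ∑ φ', (∑ φ, EE col S w (φ' - φ) * a φ) ^ 2 ≤ 64 * ∑ φ, a φ ^ 2 := by
  simp only [EE_conv, ha, zero_add]
  have h1 : ∀ φ', (∑ l, (sl col S w l - 1) * a (φ' - iot l)) ^ 2 ≤
      16 * ∑ l, a (φ' - iot l) ^ 2 := by
    intro φ'
    refine sq_sum_le_card_mul_sum_sq.trans ?_
    simp only [Finset.card_univ, Fintype.card_fin, Finset.mul_sum]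
    refine Finset.sum_le_sum fun l _ => ?_
    have h2 := sl_sq col S w l
    have h3 : (sl col S w l - 1) ^ 2 ≤ 4 := by
      nlinarith [sq_nonneg (sl col S w l + 1)]
    rw [mul_pow]
    have := mul_le_mul_of_nonneg_right h3 (sq_nonneg (a (φ' - iot l)))
    push_cast
    linarith
  refine (Finset.sum_le_sum fun φ' _ => h1 φ').trans ?_
  rw [← Finset.mul_sum, Finset.sum_comm]
  have h2 : ∀ l : Fin 4, ∑ φ', a (φ' - iot l) ^ 2 = ∑ φ, a φ ^ 2 := fun l =>
    Equiv.sum_comp (Equiv.subRight (iot l)) (fun φ => a φ ^ 2)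
  simp only [h2]
  simp
  linarith

theorem EE_const (S : Finset (Fin n)) (w : WW K n) (φ' : ZMod 11) :
    ∑ φ, EE col S w (φ' - φ) = 7 + ∑ l, sl col S w l := by
  have := EE_conv col S w (fun _ => 1) φ'
  simp only [mul_one, Finset.sum_sub_distrib] at this
  rw [this]
  simp [ZMod.card]
  ring

theorem EE_tot (S : Finset (Fin n)) (w : WW K n) (φ : ZMod 11) :
    ∑ φ', EE col S w (φ' - φ) = 7 + ∑ l, sl col S w l := by
  rw [← EE_const col S w 0]
  have h1 := Equiv.sum_comp (Equiv.subRight φ) (fun x => EE col S w x)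
  have h2 := Equiv.sum_comp (Equiv.subLeft 0) (fun x => EE col S w x)
  simp only [Equiv.subRight_apply, Equiv.subLeft_apply] at h1 h2
  rw [h1, h2]

theorem EE_gen (S : Finset (Fin n)) (w : WW K n) (a : ZMod 11 → ℝ) (m : ℝ)
    (hm : ∑ φ, a φ = 11 * m) :
    ∑ φ', (∑ φ, EE col S w (φ' - φ) * a φ) ^ 2 ≤
      11 * m ^ 2 * (7 + ∑ l, sl col S w l) ^ 2 + 64 * ∑ φ, (a φ - m) ^ 2 := by
  have hz : ∑ φ, (a φ - m) = 0 := by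
    rw [Finset.sum_sub_distrib, hm]; simp [ZMod.card]
  have h1 := EE_zero col S w (fun φ => a φ - m) hz
  set t := 7 + ∑ l, sl col S w l with ht
  have h2 : ∀ φ', ∑ φ, EE col S w (φ' - φ) * a φ = m * t + ∑ φ, EE col S w (φ' - φ) * (a φ - m) := by
    intro φ'
    rw [ht, ← EE_const col S w φ', Finset.mul_sum, ← Finset.sum_add_distrib]
    exact Finset.sum_congr rfl fun _ _ => by ring
  have h3 : ∑ φ', ∑ φ, EE col S w (φ' - φ) * (a φ - m) = 0 := by
    rw [Finset.sum_comm]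
    simp only [← Finset.sum_mul, EE_tot]
    rw [← Finset.mul_sum, hz, mul_zero]
  simp only [h2]
  have h4 : ∀ φ', (m * t + ∑ φ, EE col S w (φ' - φ) * (a φ - m)) ^ 2 =
      (m * t) ^ 2 + 2 * m * t * (∑ φ, EE col S w (φ' - φ) * (a φ - m)) +
      (∑ φ, EE col S w (φ' - φ) * (a φ - m)) ^ 2 := fun φ' => by ring
  simp only [h4, Finset.sum_add_distrib]
  rw [← Finset.mul_sum, h3]
  simp [ZMod.card]
  nlinarith

theorem sum_prod_dig (S : Finset (Fin n)) (g : K → ℝ) (A : ℝ) (hg : ∑ x, g x = A * Fintype.card K) :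
    ∑ w : WW K n, ∏ j ∈ S, g (w.1 j.castSucc) = A ^ S.card * Fintype.card (WW K n) := by
  classical
  have h1 : ∑ p : Fin (n + 1) → K, ∏ j ∈ S, g (p j.castSucc) =
      A ^ S.card * Fintype.card K ^ (n + 1) := by
    have e1 : ∀ p : Fin (n + 1) → K, ∏ j ∈ S, g (p j.castSucc) =
        ∏ j, (if j ∈ S.map Fin.castSuccEmb then g (p j) else 1) := by
      intro p
      rw [Finset.prod_ite_mem, Finset.univ_inter, Finset.prod_map]
      rfl
    simp only [e1]
    have := Finset.prod_univ_sum (fun _ : Fin (n + 1) => (Finset.univ : Finset K))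
      (fun j x => if j ∈ S.map Fin.castSuccEmb then g x else 1)
    rw [Fintype.piFinset_univ] at this
    rw [← this]
    have e2 : ∀ j : Fin (n + 1), (∑ x, if j ∈ S.map Fin.castSuccEmb then g x else 1) =
        (if j ∈ S.map Fin.castSuccEmb then A else 1) * Fintype.card K := by
      intro j
      split_ifs
      · exact hg
      · simp
    simp only [e2]
    rw [Finset.prod_mul_distrib, Finset.prod_ite_mem, Finset.univ_inter]
    simp
  rw [Fintype.sum_prod_type]
  simp only [Finset.sum_const, Finset.card_univ, nsmul_eq_mul]
  rw [← Finset.mul_sum, h1]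
  simp
  ring

theorem EE_avg (hs1 : ∀ l, ∑ x, sg col l x = 1 / 2 * Fintype.card K)
    (hs2 : ∀ l l', l ≠ l' → ∑ x, sg col l x * sg col l' x = 0 * Fintype.card K)
    (S : Finset (Fin n)) (hS : 2 ≤ S.card) :
    ∑ w : WW K n, (7 + ∑ l, sl col S w l) ^ 2 ≤ 67 * (Fintype.card (WW K n) : ℝ) := by
  have a1 : ∀ l, ∑ w : WW K n, sl col S w l = (1 / 2) ^ S.card * Fintype.card (WW K n) :=
    fun l => sum_prod_dig S (sg col l) _ (hs1 l)
  have a2 : ∀ l l', l ≠ l' → ∑ w : WW K n, sl col S w l * sl col S w l' = 0 := by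
    intro l l' h
    have := sum_prod_dig (n := n) S (fun x => sg col l x * sg col l' x) _ (hs2 l l' h)
    simp only [Finset.prod_mul_distrib] at this
    unfold sl
    rw [this, zero_pow (by omega), zero_mul]
  have a3 : ∀ l, ∑ w : WW K n, sl col S w l * sl col S w l = Fintype.card (WW K n) := by
    intro l
    simp only [← sq, sl_sq]
    simp
  have e : ∀ w : WW K n, (7 + ∑ l, sl col S w l) ^ 2 =
      49 + 14 * ∑ l, sl col S w l + ∑ l, ∑ l', sl col S w l * sl col S w l' := by
    intro w
    rw [← Finset.sum_mul_sum]; ring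
  have e0 : ∑ w : WW K n, (7 + ∑ l, sl col S w l) ^ 2 = 49 * Fintype.card (WW K n) +
      14 * (∑ w : WW K n, ∑ l, sl col S w l) +
      ∑ w : WW K n, ∑ l, ∑ l', sl col S w l * sl col S w l' := by
    rw [Finset.sum_congr rfl fun w _ => e w, Finset.sum_add_distrib, Finset.sum_add_distrib,
      ← Finset.mul_sum]
    simp [mul_comm]
  rw [e0]
  have e2 : ∑ w : WW K n, ∑ l, sl col S w l = 4 * ((1 / 2) ^ S.card * Fintype.card (WW K n)) := by
    rw [Finset.sum_comm]
    simp only [a1]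
    simp
  have e3 : ∑ w : WW K n, ∑ l, ∑ l', sl col S w l * sl col S w l' = 4 * Fintype.card (WW K n) := by
    rw [Finset.sum_comm]
    have : ∀ l, ∑ w : WW K n, ∑ l', sl col S w l * sl col S w l' = Fintype.card (WW K n) := by
      intro l
      rw [Finset.sum_comm, Finset.sum_eq_single l]
      · exact a3 l
      · intro b _ hb; exact a2 l b hb.symm
      · simp
    simp only [this]
    simp
  rw [e3, e2]
  have hp : ((1:ℝ) / 2) ^ S.card ≤ 1 / 4 := by
    calc ((1:ℝ) / 2) ^ S.card ≤ (1 / 2) ^ 2 := pow_le_pow_of_le_one (by norm_num) (by norm_num) hS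
      _ = 1 / 4 := by norm_num
  have hN : (0:ℝ) ≤ Fintype.card (WW K n) := by positivity
  have := mul_le_mul_of_nonneg_right hp hN
  linarith

theorem EE_A (hs1 : ∀ l, ∑ x, sg col l x = 1 / 2 * Fintype.card K)
    (hs2 : ∀ l l', l ≠ l' → ∑ x, sg col l x * sg col l' x = 0 * Fintype.card K)
    (S : Finset (Fin n)) (a : ZMod 11 → ℝ) (hS : 2 ≤ S.card ∨ ∑ φ, a φ = 0) :
    ∑ w : WW K n, ∑ φ', (∑ φ, EE col S w (φ' - φ) * a φ) ^ 2 ≤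
      67 * Fintype.card (WW K n) * ∑ φ, a φ ^ 2 := by
  have hN : (0:ℝ) ≤ Fintype.card (WW K n) := by positivity
  rcases hS with hS | hS
  · set m := (∑ φ, a φ) / 11 with hm
    have hm' : ∑ φ, a φ = 11 * m := by rw [hm]; field_simp
    refine (Finset.sum_le_sum fun w _ => EE_gen col S w a m hm').trans ?_
    rw [Finset.sum_add_distrib, ← Finset.mul_sum]
    have h1 := EE_avg col hs1 hs2 S hS
    have h2 : ∑ φ, (a φ - m) ^ 2 = ∑ φ, a φ ^ 2 - 11 * m ^ 2 := by
      have : ∀ φ, (a φ - m) ^ 2 = a φ ^ 2 - 2 * m * a φ + m ^ 2 := fun φ => by ring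
      simp only [this, Finset.sum_add_distrib, Finset.sum_sub_distrib, ← Finset.mul_sum, hm']
      simp [ZMod.card]; ring
    have h3 : 0 ≤ ∑ φ, (a φ - m) ^ 2 := Finset.sum_nonneg fun _ _ => sq_nonneg _
    have h4 := mul_le_mul_of_nonneg_left h1 (show 0 ≤ 11 * m ^ 2 by positivity)
    have h5 := mul_nonneg hN h3
    simp only [Finset.sum_const, Finset.card_univ, nsmul_eq_mul]
    have h6 : ∑ φ, a φ ^ 2 = ∑ φ, (a φ - m) ^ 2 + 11 * m ^ 2 := by linarith
    rw [h6]
    nlinarith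
  · refine (Finset.sum_le_sum fun w _ => EE_zero col S w a hS).trans ?_
    have h3 : 0 ≤ ∑ φ, a φ ^ 2 := Finset.sum_nonneg fun _ _ => sq_nonneg _
    have h5 := mul_nonneg hN h3
    simp only [Finset.sum_const, Finset.card_univ, nsmul_eq_mul]
    nlinarith

theorem EE_any (S : Finset (Fin n)) (w : WW K n) (a : ZMod 11 → ℝ) :
    ∑ φ', (∑ φ, EE col S w (φ' - φ) * a φ) ^ 2 ≤ 121 * ∑ φ, a φ ^ 2 := by
  have h1 : ∀ φ', (∑ φ, EE col S w (φ' - φ) * a φ) ^ 2 ≤ 11 * ∑ φ, a φ ^ 2 := by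
    intro φ'
    refine sq_sum_le_card_mul_sum_sq.trans ?_
    simp only [mul_pow, EE_sq, one_mul]
    simp [ZMod.card]
  refine (Finset.sum_le_sum fun φ' _ => h1 φ').trans ?_
  simp [ZMod.card]
  linarith

theorem Qbound (hK : Fintype.card K = 64) (ψ : K → ℝ)
    (hψa : ∀ a b, ψ (a + b) = ψ a * ψ b) (hψ1 : ∀ a, ψ a ^ 2 = 1)
    (hψs : ∀ y, ∑ x, ψ (x * y) = if y = 0 then (Fintype.card K : ℝ) else 0)
    (hs1 : ∀ l, ∑ x, sg col l x = 1 / 2 * Fintype.card K)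
    (hs2 : ∀ l l', l ≠ l' → ∑ x, sg col l x * sg col l' x = 0 * Fintype.card K)
    (hnz : (nz K).card = 63)
    (S : Finset (Fin n)) (H : ZMod 11 → WW K n → K → ℝ)
    (hS : 2 ≤ S.card ∨ ∑ φ, ∑ w, ∑ κ, H φ w κ = 0) :
    ∑ w, ∑ κ, ∑ φ', (∑ φ, EE col S w (φ' - φ) * KK (H φ) w κ) ^ 2 ≤
      76 * 4032 ^ 2 * ∑ φ, ∑ w, ∑ κ, H φ w κ ^ 2 := by
  have hN : (0:ℝ) < Fintype.card (WW K n) := by exact_mod_cast Fintype.card_pos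
  obtain ⟨N, hNdef⟩ : ∃ N : ℝ, N = ((Fintype.card (WW K n) : ℕ) : ℝ) := ⟨_, rfl⟩
  rw [← hNdef] at hN
  let a : ZMod 11 → ℝ := fun φ => (∑ w, ∑ κ, H φ w κ) / (N * 64)
  let H' : ZMod 11 → WW K n → K → ℝ := fun φ w κ => H φ w κ - a φ
  have ha : ∀ φ, ∑ w, ∑ κ, H φ w κ = a φ * (N * 64) := by
    intro φ; simp only [a]; field_simp
  have hH'0 : ∀ φ, ∑ w, ∑ κ, H' φ w κ = 0 := by
    intro φ
    simp only [H', Finset.sum_sub_distrib, ha]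
    simp only [Finset.sum_const, Finset.card_univ, nsmul_eq_mul, hK]
    rw [← hNdef]; push_cast; ring
  have hKK : ∀ φ w κ, KK (H φ) w κ = 4032 * a φ + KK (H' φ) w κ := by
    intro φ w κ
    simp only [KK, H', Finset.sum_sub_distrib]
    simp only [Finset.sum_const, Finset.card_univ, nsmul_eq_mul, hK, hnz]
    push_cast; ring
  have hsq : ∑ φ, ∑ w, ∑ κ, H φ w κ ^ 2 = N * 64 * ∑ φ, a φ ^ 2 + ∑ φ, ∑ w, ∑ κ, H' φ w κ ^ 2 := by
    rw [Finset.mul_sum, ← Finset.sum_add_distrib]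
    refine Finset.sum_congr rfl fun φ _ => ?_
    have : ∀ w κ, H φ w κ ^ 2 = a φ ^ 2 + 2 * a φ * H' φ w κ + H' φ w κ ^ 2 := by
      intro w κ; simp only [H']; ring
    simp only [this, Finset.sum_add_distrib, ← Finset.mul_sum, hH'0]
    simp only [Finset.sum_const, Finset.card_univ, nsmul_eq_mul, hK]
    rw [← hNdef]; push_cast; ring
  have haS : 2 ≤ S.card ∨ ∑ φ, a φ = 0 := by
    rcases hS with h | h
    · exact Or.inl h
    · right
      simp only [ha, ← Finset.sum_mul] at h
      rcases mul_eq_zero.1 h with h | h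
      · exact h
      · exfalso; have : 0 < N * 64 := by positivity
        linarith
  have b1 : ∑ w : WW K n, ∑ κ : K, ∑ φ', (∑ φ, EE col S w (φ' - φ) * (4032 * a φ)) ^ 2 ≤
      67 * 4032 ^ 2 * (N * 64 * ∑ φ, a φ ^ 2) := by
    have h1 := EE_A col hs1 hs2 S a haS
    have : ∀ w φ', (∑ φ, EE col S w (φ' - φ) * (4032 * a φ)) ^ 2 =
        4032 ^ 2 * (∑ φ, EE col S w (φ' - φ) * a φ) ^ 2 := by
      intro w φ'
      rw [← mul_pow, Finset.mul_sum]
      congr 1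
      exact Finset.sum_congr rfl fun _ _ => by ring
    simp only [this, ← Finset.mul_sum]
    simp only [Finset.sum_const, Finset.card_univ, nsmul_eq_mul, hK]
    push_cast
    rw [← hNdef] at h1
    have h2 := mul_le_mul_of_nonneg_left h1 (show (0:ℝ) ≤ 4032 ^ 2 * 64 by norm_num)
    rw [← Finset.mul_sum]
    linarith
  have b2 : ∑ w : WW K n, ∑ κ : K, ∑ φ', (∑ φ, EE col S w (φ' - φ) * KK (H' φ) w κ) ^ 2 ≤
      121 * (253 * 4096) * ∑ φ, ∑ w, ∑ κ, H' φ w κ ^ 2 := by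
    have h1 : ∀ w κ, ∑ φ', (∑ φ, EE col S w (φ' - φ) * KK (H' φ) w κ) ^ 2 ≤
        121 * ∑ φ, KK (H' φ) w κ ^ 2 := fun w κ => EE_any col S w _
    refine (Finset.sum_le_sum fun w _ => Finset.sum_le_sum fun κ _ => h1 w κ).trans ?_
    have h2 : ∑ w : WW K n, ∑ κ, ∑ φ, KK (H' φ) w κ ^ 2 = ∑ φ, ∑ w, ∑ κ, KK (H' φ) w κ ^ 2 := by
      rw [Finset.sum_comm (s := (Finset.univ : Finset (ZMod 11)))]
      refine Finset.sum_congr rfl fun w _ => ?_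
      rw [Finset.sum_comm]
    simp only [← Finset.mul_sum]
    rw [h2, mul_assoc]
    refine mul_le_mul_of_nonneg_left ?_ (by norm_num)
    rw [Finset.mul_sum]
    refine Finset.sum_le_sum fun φ _ => ?_
    have := KK_bound ψ hψa hψ1 hψs (H' φ) (hH'0 φ)
    rw [hK, hnz] at this
    norm_num at this ⊢
    exact this
  have hp : ∀ x y : ℝ, (x + y) ^ 2 ≤ 28 / 25 * x ^ 2 + 28 / 3 * y ^ 2 := by
    intro x y
    nlinarith [sq_nonneg (3 * x - 25 * y)]
  simp only [hKK, mul_add, Finset.sum_add_distrib]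
  have tot : ∑ w : WW K n, ∑ κ : K, ∑ φ', (∑ φ, EE col S w (φ' - φ) * (4032 * a φ) +
      ∑ φ, EE col S w (φ' - φ) * KK (H' φ) w κ) ^ 2 ≤
      28 / 25 * (∑ w : WW K n, ∑ κ : K, ∑ φ', (∑ φ, EE col S w (φ' - φ) * (4032 * a φ)) ^ 2) +
      28 / 3 * (∑ w : WW K n, ∑ κ : K, ∑ φ', (∑ φ, EE col S w (φ' - φ) * KK (H' φ) w κ) ^ 2) := by
    simp only [Finset.mul_sum (s := (Finset.univ : Finset (WW K n))), Finset.mul_sum (s := (Finset.univ : Finset K))]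
    rw [← Finset.sum_add_distrib]
    refine Finset.sum_le_sum fun w _ => ?_
    rw [← Finset.sum_add_distrib]
    refine Finset.sum_le_sum fun κ _ => ?_
    rw [Finset.mul_sum, Finset.mul_sum, ← Finset.sum_add_distrib]
    exact Finset.sum_le_sum fun φ' _ => hp _ _
  refine tot.trans ?_
  rw [hsq]
  have p1 : 0 ≤ N * 64 * ∑ φ, a φ ^ 2 := by positivity
  have p2 : 0 ≤ ∑ φ, ∑ w, ∑ κ, H' φ w κ ^ 2 := by positivity
  generalize (N * 64 * ∑ φ, a φ ^ 2) = A at *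
  generalize (∑ φ, ∑ w, ∑ κ, H' φ w κ ^ 2) = B at *
  linarith

end PartF

section PartG
open Matrix

theorem field_data : ∃ (K : Type) (_ : Field K) (_ : Fintype K) (_ : DecidableEq K) (_ : CharP K 2),
    Fintype.card K = 64 ∧
    (∃ ψ : K → ℝ, (∀ a b, ψ (a + b) = ψ a * ψ b) ∧ (∀ a, ψ a ^ 2 = 1) ∧
      (∀ y, ∑ x, ψ (x * y) = if y = 0 then (Fintype.card K : ℝ) else 0)) ∧
    (∃ col : K → Fin 4, (∀ l, ∑ x, sg col l x = 1 / 2 * Fintype.card K) ∧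
      (∀ l l', l ≠ l' → ∑ x, sg col l x * sg col l' x = 0 * Fintype.card K)) := by
  classical
  letI : Fintype (GaloisField 2 6) := Fintype.ofFinite _
  have hcard : Fintype.card (GaloisField 2 6) = 64 := by
    rw [← Nat.card_eq_fintype_card, GaloisField.card 2 6 (by norm_num)]
    norm_num
  refine ⟨GaloisField 2 6, inferInstance, inferInstance, inferInstance, inferInstance, hcard, ?_, ?_⟩
  · obtain ⟨f, hf⟩ : ∃ f : Module.Dual (ZMod 2) (GaloisField 2 6), f 1 ≠ 0 := by
      by_contra h
      push Not at h
      exact one_ne_zero ((Module.forall_dual_apply_eq_zero_iff (ZMod 2) (1 : GaloisField 2 6)).1 h)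
    have ha : ∀ a b, chi (f (a + b)) = chi (f a) * chi (f b) := fun a b => by
      rw [map_add, chi_add]
    refine ⟨fun x => chi (f x), ha, fun a => by rw [sq, chi_sq], ?_⟩
    intro y
    split_ifs with hy
    · subst hy
      simp [chi_zero]
    · have h1 : ∑ x, chi (f (x * y)) = ∑ x, chi (f x) :=
        Equiv.sum_comp (Equiv.mulRight₀ y hy) (fun x => chi (f x))
      have h2 : ∑ x, chi (f (x + 1)) = ∑ x, chi (f x) :=
        Equiv.sum_comp (Equiv.addRight (1 : GaloisField 2 6)) (fun x => chi (f x))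
      have h3 : chi (f 1) = -1 := by simp [chi, hf]
      simp only [ha, h3] at h2
      rw [← Finset.sum_mul] at h2
      rw [h1]
      linarith
  · have e : GaloisField 2 6 ≃ Fin 4 × Fin 16 := Fintype.equivOfCardEq (by rw [hcard]; rfl)
    have hsum : ∀ g : Fin 4 → ℝ, ∑ x, g (e x).1 = 16 * ∑ l, g l := by
      intro g
      rw [Equiv.sum_comp e (fun y => g y.1), Fintype.sum_prod_type]
      simp [Finset.mul_sum]
    refine ⟨fun x => (e x).1, fun l => ?_, fun l l' hl => ?_⟩
    · unfold sg
      rw [hsum (fun a => if a = l then (-1:ℝ) else 1), hcard]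
      fin_cases l <;> simp [Fin.sum_univ_four] <;> norm_num
    · unfold sg
      rw [hsum (fun a => (if a = l then (-1:ℝ) else 1) * (if a = l' then (-1:ℝ) else 1)), zero_mul]
      fin_cases l <;> fin_cases l' <;> simp [Fin.sum_univ_four] at hl ⊢

variable {K : Type*} [Field K] [Fintype K] [DecidableEq K] [CharP K 2] {n z : ℕ} (col : K → Fin 4)

abbrev Om (K : Type*) (n z : ℕ) := WW K n × K × ZMod 11 × Fin z

theorem sumOm (f : Om K n z → ℝ) : ∑ x, f x = ∑ w, ∑ κ, ∑ φ, ∑ t, f (w, κ, φ, t) := by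
  rw [Fintype.sum_prod_type]
  refine Finset.sum_congr rfl fun w _ => ?_
  rw [Fintype.sum_prod_type]
  refine Finset.sum_congr rfl fun κ _ => ?_
  rw [Fintype.sum_prod_type]

def mX (S : Finset (Fin n)) (x y : Om K n z) : ℝ :=
  ∑ c ∈ nz K, ∑ b, if x.1 = stp c y.1 b ∧ x.2.1 = y.2.1 + c then
    EE col S y.1 (y.2.2.1 - x.2.2.1) else 0

def eX (T : Finset (WW K n)) (x y : Om K n z) : ℝ :=
  ∑ t ∈ T, if x = (y.1 + t, y.2) then 1 else 0

theorem mX_app (S : Finset (Fin n)) (h : Om K n z → ℝ) (y : Om K n z) :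
    ∑ x, mX col S x y * h x = ∑ φ, EE col S y.1 (y.2.2.1 - φ) *
      KK (fun w κ => ∑ t, h (w, κ, φ, t)) y.1 y.2.1 := by
  unfold mX KK
  simp only [Finset.sum_mul, Finset.mul_sum]
  rw [Finset.sum_comm, Finset.sum_comm (s := (Finset.univ : Finset (ZMod 11)))]
  refine Finset.sum_congr rfl fun c _ => ?_
  rw [Finset.sum_comm, Finset.sum_comm (s := (Finset.univ : Finset (ZMod 11)))]
  refine Finset.sum_congr rfl fun b _ => ?_
  rw [sumOm, Finset.sum_eq_single (stp c y.1 b), Finset.sum_eq_single (y.2.1 + c)]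
  · simp
  · intro κ _ hκ
    simp [hκ]
  · simp
  · intro w _ hw
    simp [hw]
  · simp

theorem eX_app (T : Finset (WW K n)) (h : Om K n z → ℝ) (y : Om K n z) :
    ∑ x, eX T x y * h x = ∑ t ∈ T, h (y.1 + t, y.2) := by
  unfold eX
  simp only [Finset.sum_mul]
  rw [Finset.sum_comm]
  refine Finset.sum_congr rfl fun t _ => ?_
  simp

theorem eX_row (T : Finset (WW K n)) (x : Om K n z) : ∑ y, eX T x y = T.card := by
  unfold eX
  rw [Finset.sum_comm]
  have : ∀ t, (∑ y : Om K n z, if x = (y.1 + t, y.2) then (1:ℝ) else 0) = 1 := by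
    intro t
    rw [Finset.sum_eq_single (x.1 - t, x.2)]
    · simp
    · intro y _ hy
      rw [if_neg]
      intro h
      apply hy
      rw [h]; simp
    · simp
  simp only [this]
  simp

theorem mX_row (S : Finset (Fin n)) (g : ℝ) (hg : ∀ w : WW K n, 7 + ∑ l, sl col S w l = g)
    (x : Om K n z) : ∑ y, mX col S x y = g * z * ((nz K).card * Fintype.card K) := by
  unfold mX
  rw [Finset.sum_comm]
  have : ∀ c : K, (∑ y : Om K n z, ∑ b, if x.1 = stp c y.1 b ∧ x.2.1 = y.2.1 + c then
    EE col S y.1 (y.2.2.1 - x.2.2.1) else 0) = g * z * Fintype.card K := by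
    intro c
    rw [sumOm]
    have h1 : ∀ w : WW K n, (∑ κ : K, ∑ φ : ZMod 11, ∑ t : Fin z, ∑ b,
        if x.1 = stp c w b ∧ x.2.1 = κ + c then EE col S w (φ - x.2.2.1) else 0) =
        g * z * ∑ b, if x.1 = stp c w b then 1 else 0 := by
      intro w
      rw [Finset.sum_eq_single (x.2.1 - c)]
      · simp only [sub_add_cancel, and_true]
        have : ∀ φ : ZMod 11, ∑ t : Fin z, ∑ b,
            (if x.1 = stp c w b then EE col S w (φ - x.2.2.1) else 0) =
            EE col S w (φ - x.2.2.1) * (z * ∑ b, if x.1 = stp c w b then 1 else 0) := by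
          intro φ
          rw [Finset.sum_const, Finset.card_univ, Fintype.card_fin, nsmul_eq_mul, mul_left_comm]
          congr 1
          rw [Finset.mul_sum]
          refine Finset.sum_congr rfl fun b _ => ?_
          split_ifs <;> simp
        simp only [this]
        rw [← Finset.sum_mul, EE_tot, hg]
        ring
      · intro κ _ hκ
        have : ¬ (x.2.1 = κ + c) := fun h => hκ (by rw [h]; ring)
        simp [this]
      · simp
    simp only [h1]
    rw [← Finset.mul_sum, sum_stp c (fun w => if x.1 = w then (1:ℝ) else 0)]
    simp
  simp only [this]
  simp
  ring

theorem mX_col (S : Finset (Fin n)) (g : ℝ) (hg : ∀ w : WW K n, 7 + ∑ l, sl col S w l = g)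
    (y : Om K n z) : ∑ x, mX col S x y = g * z * ((nz K).card * Fintype.card K) := by
  have := mX_app col S (fun _ => 1) y
  simp only [mul_one, KK] at this
  rw [this, ← Finset.sum_mul, EE_const, hg]
  simp
  ring

theorem sl_empty (w : WW K n) : 7 + ∑ l, sl col ∅ w l = 11 := by
  simp [sl]; norm_num

theorem sl_single (j : Fin n) (w : WW K n) : 7 + ∑ l, sl col {j} w l = 9 := by
  simp only [sl, sg, Finset.prod_singleton]
  generalize col (w.1 j.castSucc) = a
  fin_cases a <;> simp [Fin.sum_univ_four] <;> norm_num

theorem stp_inj (c : K) (w : WW K n) (b b' : K) (h : stp c w b = stp c w b') : b = b' := by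
  have := congrFun (congrArg Prod.fst h) (Fin.last n)
  simpa [stp, rr] using this

theorem mX_val (S : Finset (Fin n)) (x y : Om K n z) :
    mX col S x y = if (∃ b, x.1 = stp (x.2.1 - y.2.1) y.1 b) ∧ x.2.1 ≠ y.2.1 then
      EE col S y.1 (y.2.2.1 - x.2.2.1) else 0 := by
  unfold mX
  split_ifs with h
  · obtain ⟨⟨b, hb⟩, hne⟩ := h
    rw [Finset.sum_eq_single (x.2.1 - y.2.1), Finset.sum_eq_single b]
    · rw [if_pos ⟨hb, by ring⟩]
    · intro b' _ hb'
      rw [if_neg]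
      rintro ⟨h, _⟩
      exact hb' (stp_inj _ _ _ _ (h.symm.trans hb))
    · simp
    · intro c _ hc
      refine Finset.sum_eq_zero fun b' _ => ?_
      rw [if_neg]
      rintro ⟨_, h⟩
      exact hc (by rw [h]; ring)
    · intro h
      exact absurd (by simp [nz, sub_ne_zero, hne]) h
  · refine Finset.sum_eq_zero fun c hc => Finset.sum_eq_zero fun b _ => ?_
    rw [if_neg]
    rintro ⟨h1, h2⟩
    have hc0 : c ≠ 0 := by simpa [nz] using hc
    apply h
    refine ⟨⟨b, ?_⟩, ?_⟩
    · rw [h1]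
      congr 1
      rw [h2]; ring
    · rw [h2]; simpa using hc0

theorem eX_val (T : Finset (WW K n)) (x y : Om K n z) :
    eX T x y = if x.1 - y.1 ∈ T ∧ x.2 = y.2 then 1 else 0 := by
  unfold eX
  split_ifs with h
  · rw [Finset.sum_eq_single_of_mem (x.1 - y.1) h.1]
    · rw [if_pos]
      ext1
      · simp
      · exact h.2
    · intro t _ ht
      rw [if_neg]
      intro h'
      apply ht
      rw [h']; simp
  · refine Finset.sum_eq_zero fun t ht => ?_
    rw [if_neg]
    intro h'
    apply h
    rw [h']
    simpa using ht

def vv (x y : Om K n z) (j : Fin n) : ZMod 2 :=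
  if x.2.1 = y.2.1 then 0 else
    if y.2.2.1 - x.2.2.1 = iot (col (y.1.1 j.castSucc)) then 1 else 0

theorem vv_ee (S : Finset (Fin n)) (x y : Om K n z) :
    ee (vv col x y) S = if x.2.1 = y.2.1 then 1 else EE col S y.1 (y.2.2.1 - x.2.2.1) := by
  unfold ee vv EE
  split_ifs with h
  · simp [chi_zero]
  · refine Finset.prod_congr rfl fun j _ => ?_
    split_ifs
    · exact chi_one
    · exact chi_zero

theorem eX_bound (T : Finset (WW K n)) (h : Om K n z → ℝ) :
    ∑ y, (∑ x, eX T x y * h x) ^ 2 ≤ (T.card : ℝ) ^ 2 * ∑ x, h x ^ 2 := by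
  simp only [eX_app]
  have h1 : ∀ y : Om K n z, (∑ t ∈ T, h (y.1 + t, y.2)) ^ 2 ≤
      T.card * ∑ t ∈ T, h (y.1 + t, y.2) ^ 2 := fun y => sq_sum_le_card_mul_sum_sq
  refine (Finset.sum_le_sum fun y _ => h1 y).trans ?_
  rw [← Finset.mul_sum, Finset.sum_comm]
  have h2 : ∀ t : WW K n, ∑ y : Om K n z, h (y.1 + t, y.2) ^ 2 = ∑ x, h x ^ 2 := by
    intro t
    exact Equiv.sum_comp ((Equiv.addRight t).prodCongr (Equiv.refl (K × ZMod 11 × Fin z)))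
      (fun x => h x ^ 2)
  simp only [h2]
  simp
  apply le_of_eq
  ring

theorem mX_bound (hK : Fintype.card K = 64) (ψ : K → ℝ)
    (hψa : ∀ a b, ψ (a + b) = ψ a * ψ b) (hψ1 : ∀ a, ψ a ^ 2 = 1)
    (hψs : ∀ y, ∑ x, ψ (x * y) = if y = 0 then (Fintype.card K : ℝ) else 0)
    (hs1 : ∀ l, ∑ x, sg col l x = 1 / 2 * Fintype.card K)
    (hs2 : ∀ l l', l ≠ l' → ∑ x, sg col l x * sg col l' x = 0 * Fintype.card K)
    (hnz : (nz K).card = 63)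
    (S : Finset (Fin n)) (h : Om K n z → ℝ)
    (hS : 2 ≤ S.card ∨ ∑ x, h x = 0) :
    ∑ y, (∑ x, mX col S x y * h x) ^ 2 ≤ (218 / 25 * (4032 * z) : ℝ) ^ 2 * ∑ x, h x ^ 2 := by
  simp only [mX_app]
  have e0 : ∀ f : WW K n → K → ZMod 11 → ℝ, ∑ w, ∑ κ, ∑ φ, f w κ φ = ∑ φ, ∑ w, ∑ κ, f w κ φ := by
    intro f
    rw [Finset.sum_comm (s := (Finset.univ : Finset (ZMod 11)))]
    refine Finset.sum_congr rfl fun w _ => ?_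
    rw [Finset.sum_comm]
  let H : ZMod 11 → WW K n → K → ℝ := fun φ w κ => ∑ t, h (w, κ, φ, t)
  have hS' : 2 ≤ S.card ∨ ∑ φ, ∑ w, ∑ κ, H φ w κ = 0 := by
    refine hS.imp id fun h0 => ?_
    rw [sumOm, e0] at h0
    exact h0
  have q := Qbound col hK ψ hψa hψ1 hψs hs1 hs2 hnz S H hS'
  have hH : ∑ φ, ∑ w, ∑ κ, H φ w κ ^ 2 ≤ z * ∑ x, h x ^ 2 := by
    rw [sumOm, e0]
    simp only [Finset.mul_sum (s := (Finset.univ : Finset (ZMod 11))),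
      Finset.mul_sum (s := (Finset.univ : Finset (WW K n))),
      Finset.mul_sum (s := (Finset.univ : Finset K))]
    refine Finset.sum_le_sum fun φ _ => Finset.sum_le_sum fun w _ => Finset.sum_le_sum fun κ _ => ?_
    refine sq_sum_le_card_mul_sum_sq.trans ?_
    simp
  rw [sumOm (fun y => (∑ φ, EE col S y.1 (y.2.2.1 - φ) *
      KK (fun w κ => ∑ t, h (w, κ, φ, t)) y.1 y.2.1) ^ 2)]
  have e1 : ∑ w, ∑ κ, ∑ φ', ∑ t : Fin z, (∑ φ, EE col S w (φ' - φ) *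
      KK (fun w κ => ∑ t, h (w, κ, φ, t)) w κ) ^ 2 =
      z * ∑ w, ∑ κ, ∑ φ', (∑ φ, EE col S w (φ' - φ) * KK (H φ) w κ) ^ 2 := by
    simp only [Finset.mul_sum (s := (Finset.univ : Finset (ZMod 11))),
      Finset.mul_sum (s := (Finset.univ : Finset (WW K n))),
      Finset.mul_sum (s := (Finset.univ : Finset K)), H]
    refine Finset.sum_congr rfl fun w _ => Finset.sum_congr rfl fun κ _ => Finset.sum_congr rfl fun φ' _ => ?_
    rw [Finset.sum_const, Finset.card_univ, Fintype.card_fin, nsmul_eq_mul]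
  have hz : (0:ℝ) ≤ z := by positivity
  have hh : 0 ≤ ∑ x, h x ^ 2 := Finset.sum_nonneg fun _ _ => sq_nonneg _
  generalize ∑ x, h x ^ 2 = N at *
  refine (le_of_eq e1).trans ?_
  refine (mul_le_mul_of_nonneg_left q hz).trans ?_
  refine (mul_le_mul_of_nonneg_left (mul_le_mul_of_nonneg_left hH (by norm_num)) hz).trans ?_
  have : 0 ≤ (z:ℝ) ^ 2 * N := by positivity
  nlinarith

theorem exists_T (hK : Fintype.card K = 64) (hn : 1 ≤ n) (m : ℕ) (hm : m < 36288) :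
    ∃ T : Finset (WW K n), T.card = m ∧ (0 : WW K n) ∉ T := by
  have h1 : m ≤ (Finset.univ.erase (0 : WW K n)).card := by
    rw [Finset.card_erase_of_mem (Finset.mem_univ _), Finset.card_univ]
    have : Fintype.card (WW K n) = 64 ^ (n + 1) * 64 ^ (n + 1) := by
      simp [hK]
    rw [this]
    have h2 : 64 ^ 2 ≤ 64 ^ (n + 1) := Nat.pow_le_pow_right (by norm_num) (by omega)
    have := Nat.mul_le_mul h2 h2
    norm_num at this ⊢
    omega
  obtain ⟨T, hT, hc⟩ := Finset.exists_subset_card_eq h1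
  exact ⟨T, hc, fun h => by simpa using hT h⟩

theorem assemble (u z ζ i : ℕ) (hz : 1 ≤ z) (hζ : ζ < 36288) (hu : u = 9 * (4032 * z) + ζ)
    (hi : 1 ≤ i) (N : ℕ) (hN : N = 2 * ((64 ^ (2 * (i + 1) + 1) * 11 * z) * 2 * 2 ^ i)) :
    ∃ G' : SimpleGraph (Fin N), G'.Connected ∧
      IsRegularGraph G' (2 * (11 * (4032 * z) + ζ) + 2 + 1) ∧
      lam (adjMat G') 2 = 2 * Real.sqrt ((u : ℝ) ^ 2 + 1) - 1 ∧
      i ≤ eigMult (adjMat G') (2 * Real.sqrt ((u : ℝ) ^ 2 + 1) - 1) := by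
  classical
  obtain ⟨K, _, _, _, _, hK, ⟨ψ, hψa, hψ1, hψs⟩, ⟨col, hs1, hs2⟩⟩ := field_data
  have hnz : (nz K).card = 63 := by
    have : nz K = Finset.univ.erase 0 := by ext; simp [nz]
    rw [this, Finset.card_erase_of_mem (Finset.mem_univ _), Finset.card_univ, hK]
  obtain ⟨T, hT, hT0⟩ := exists_T (K := K) (n := i) hK hi ζ hζ
  haveI : NeZero z := ⟨by omega⟩
  have hcard : Fintype.card (Om K i z) = 64 ^ (2 * (i + 1) + 1) * 11 * z := by
    simp [hK, ZMod.card]; ring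
  have hz1 : (1:ℝ) ≤ z := by exact_mod_cast hz
  have huR : (u : ℝ) = 9 * (4032 * z) + ζ := by rw [hu]; push_cast; ring
  refine reduce (Ω := Om K i z) hi
    (fun x y => ((∃ b, x.1 = stp (x.2.1 - y.2.1) y.1 b) ∧ x.2.1 ≠ y.2.1) ∨
      (x.1 - y.1 ∈ T ∧ x.2 = y.2)) (vv col) ?_ (fun S x y => mX col S x y + eX T x y) ?_
    u (11 * (4032 * z) + ζ) N (by omega) (218 / 25 * (4032 * z) + ζ) (by positivity) ?_ ?_ ?_ ?_ ?_ ?_ ?_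
  · rintro x (⟨_, h⟩ | ⟨h, _⟩)
    · exact h rfl
    · rw [sub_self] at h; exact hT0 h
  · intro S x y
    rw [mX_val, eX_val, vv_ee]
    by_cases h : x.2.1 = y.2.1
    · simp [h]
    · have h' : ¬ (x.2 = y.2) := fun e => h (by rw [e])
      simp [h, h']
  · rw [huR]; linarith
  · rw [hN, hcard]
  · intro x
    rw [Finset.sum_add_distrib, mX_row col ∅ 11 (sl_empty col), eX_row, hT, hnz, hK]
    push_cast; ring
  · intro y
    have := eX_app T (fun _ => 1) y
    simp only [mul_one] at this
    rw [Finset.sum_add_distrib, mX_col col ∅ 11 (sl_empty col), this, Finset.sum_const, hT, hnz, hK]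
    push_cast; ring
  · intro j x
    rw [Finset.sum_add_distrib, mX_row col {j} 9 (sl_single col j), eX_row, hT, hnz, hK, huR]
    push_cast; ring
  · intro j y
    have := eX_app T (fun _ => 1) y
    simp only [mul_one] at this
    rw [Finset.sum_add_distrib, mX_col col {j} 9 (sl_single col j), this, Finset.sum_const, hT,
      hnz, hK, huR]
    push_cast; ring
  · intro S h hS
    have b1 := mX_bound col hK ψ hψa hψ1 hψs hs1 hs2 hnz S h hS
    have b2 := eX_bound T h
    rw [hT] at b2
    have := tri_sq _ _ _ _ _ (by positivity) (by positivity) b1 b2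
    simpa only [add_mul, Finset.sum_add_distrib] using this

end PartG

theorem stmt_2 (u : ℕ) (hu : 10 ^ 5 ≤ u) :
    ∃ d : ℕ, (d : ℝ) ≤ 5 * u / 2 ∧
      ∃ nseq : ℕ → ℕ, StrictMono nseq ∧ 0 < nseq 0 ∧
        (∀ i, nseq (i + 1) ≤ 4 * nseq i ^ 9) ∧
        ∀ i : ℕ, 1 ≤ i → ∃ G : SimpleGraph (Fin (nseq i)), G.Connected ∧
          IsRegularGraph G d ∧
          lam (adjMat G) 2 = 2 * Real.sqrt ((u : ℝ) ^ 2 + 1) - 1 ∧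
          i ≤ eigMult (adjMat G) (2 * Real.sqrt ((u : ℝ) ^ 2 + 1) - 1) := by
  obtain ⟨z, hz⟩ : ∃ z, z = u / 36288 := ⟨_, rfl⟩
  obtain ⟨ζ, hζ⟩ : ∃ ζ, ζ = u % 36288 := ⟨_, rfl⟩
  have hz1 : 1 ≤ z := by omega
  have hζ1 : ζ < 36288 := by omega
  have hu1 : u = 9 * (4032 * z) + ζ := by omega
  have key : ∀ i, 2 * ((64 ^ (2 * (i + 1 + 1) + 1) * 11 * z) * 2 * 2 ^ (i + 1)) =
      8192 * (2 * ((64 ^ (2 * (i + 1) + 1) * 11 * z) * 2 * 2 ^ i)) := by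
    intro i; ring
  have pos : ∀ i, 64 ≤ 2 * ((64 ^ (2 * (i + 1) + 1) * 11 * z) * 2 * 2 ^ i) := by
    intro i
    have h1 : 64 ^ 1 ≤ 64 ^ (2 * (i + 1) + 1) := Nat.pow_le_pow_right (by norm_num) (by omega)
    have h2 : 1 ≤ 2 ^ i := Nat.one_le_two_pow
    calc 64 = 64 ^ 1 * 1 * 1 := by norm_num
      _ ≤ 64 ^ (2 * (i + 1) + 1) * z * 2 ^ i := Nat.mul_le_mul (Nat.mul_le_mul h1 hz1) h2
      _ ≤ 44 * (64 ^ (2 * (i + 1) + 1) * z * 2 ^ i) := Nat.le_mul_of_pos_left _ (by norm_num)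
      _ = _ := by ring
  refine ⟨2 * (11 * (4032 * z) + ζ) + 2 + 1, ?_,
    fun i => 2 * ((64 ^ (2 * (i + 1) + 1) * 11 * z) * 2 * 2 ^ i), ?_, ?_, ?_, ?_⟩
  · have : 2 * (2 * (11 * (4032 * z) + ζ) + 2 + 1) ≤ 5 * u := by omega
    have h : ((2 * (2 * (11 * (4032 * z) + ζ) + 2 + 1) : ℕ) : ℝ) ≤ ((5 * u : ℕ) : ℝ) := by
      exact_mod_cast this
    push_cast at h ⊢
    linarith
  · refine strictMono_nat_of_lt_succ fun i => ?_
    have h1 := key i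
    have h2 := pos i
    simp only [h1]
    omega
  · have := pos 0
    simp only
    omega
  · intro i
    have h1 := key i
    have h2 := pos i
    simp only [h1]
    generalize 2 * ((64 ^ (2 * (i + 1) + 1) * 11 * z) * 2 * 2 ^ i) = m at *
    have h3 : 64 ^ 8 ≤ m ^ 8 := Nat.pow_le_pow_left h2 8
    calc 8192 * m ≤ (4 * 64 ^ 8) * m := Nat.mul_le_mul_right _ (by norm_num)
      _ ≤ (4 * m ^ 8) * m := Nat.mul_le_mul_right _ (Nat.mul_le_mul_left _ h3)
      _ = 4 * m ^ 9 := by ring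
  · intro i hi
    exact assemble u z ζ i hz1 hζ1 hu1 hi _ rfl
end

section
/- Let a and d be positive integers with 0 ≤ a ≤ d, and let G be a bipartite d-regular graph on n vertices. Then there exists a finitely supported probability distribution on pairs (H, M), where H is an a-factor of G and M is an n×n real matrix with spectral norm ‖M‖ ≤ 6√d, such that for all vectors u, v ∈ ℝ^n and all real t ≥ 0, the probability that |uᵀ(A_H − (a/d)·A_G + M)v| > t·(2+√2)·√(d·n·⌈log₂ n⌉)·‖u‖_∞·‖v‖_∞ is at most 2·(log₂ d)·e^{−t²/2}. -/
open Matrix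

/-- `G` is bipartite. -/
def Bipartite {V : Type*} (G : SimpleGraph V) : Prop := G.Colorable 2

/-- The spectral norm (largest singular value) of a real square matrix. -/
noncomputable def specNorm {V : Type*} [Fintype V] [DecidableEq V] (M : Matrix V V ℝ) : ℝ :=
  ‖Matrix.toEuclideanCLM (𝕜 := ℝ) M‖


namespace Aux

open Finset

lemma adjMat_apply {V : Type*} [Fintype V] (G : SimpleGraph V) (x y : V) [Decidable (G.Adj x y)] :
    adjMat G x y = if G.Adj x y then 1 else 0 := by
  unfold adjMat
  simp [SimpleGraph.adjMatrix_apply]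

lemma deg_eq_sum {V : Type*} [Fintype V] (G : SimpleGraph V) (x : V) :
    (deg G x : ℝ) = ∑ y, adjMat G x y := by
  classical
  unfold deg adjMat
  simp only [SimpleGraph.adjMatrix_apply]
  rw [Finset.sum_boole, ← SimpleGraph.card_neighborFinset_eq_degree,
    SimpleGraph.neighborFinset_eq_filter]

/-- no cycles of length at most `B` -/
def NoShort {V : Type*} (F : SimpleGraph V) (B : ℕ) : Prop :=
  ∀ (v : V) (c : F.Walk v v), c.IsCycle → B < c.length

lemma path_ext {V : Type*} {F : SimpleGraph V} {B : ℕ} (hF : NoShort F B) {x r y : V}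
    (p : F.Walk x r) (hp : p.IsPath) (hl : p.length + 1 ≤ B) (h : F.Adj y x) (hy : y ≠ p.snd) :
    (SimpleGraph.Walk.cons h p).IsPath := by
  classical
  rw [SimpleGraph.Walk.cons_isPath_iff]
  refine ⟨hp, fun hmem => ?_⟩
  have hc : (SimpleGraph.Walk.cons h (p.takeUntil y hmem)).IsCycle := by
    rw [SimpleGraph.Walk.cons_isCycle_iff]
    refine ⟨hp.takeUntil hmem, fun he => hy ?_⟩
    have := p.edges_takeUntil_subset_edges hmem he
    rw [Sym2.eq_swap] at this
    exact (hp.eq_snd_of_mem_edges this)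
  have h1 := hF _ _ hc
  have h2 := p.length_takeUntil_le_length hmem
  simp only [SimpleGraph.Walk.length_cons] at h1
  omega

/-- acyclic graph with all degrees different from one has no edges -/
lemma exists_cycle {V : Type*} [Fintype V] (F : SimpleGraph V) (hdeg : ∀ x, deg F x ≠ 1)
    {a b : V} (hab : F.Adj a b) : ∃ (v : V) (c : F.Walk v v), c.IsCycle := by
  classical
  by_contra hno
  push Not at hno
  have key : ∀ j : ℕ, ∃ (x r : V) (p : F.Walk x r), p.IsPath ∧ p.length = j + 1 := by
    intro j
    induction j with
    | zero => exact ⟨a, b, SimpleGraph.Walk.cons hab .nil, by simp [hab.ne], by simp⟩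
    | succ j ih =>
      obtain ⟨x, r, p, hp, hl⟩ := ih
      have hnn : ¬ p.Nil := by
        intro h
        rw [← SimpleGraph.Walk.length_eq_zero_iff] at h
        omega
      have hadj := p.adj_snd hnn
      have hd : 1 < (F.neighborFinset x).card := by
        have h1 := hdeg x
        unfold deg at h1
        rw [← SimpleGraph.card_neighborFinset_eq_degree] at h1
        have h2 : 0 < (F.neighborFinset x).card := Finset.card_pos.2 ⟨p.snd, by simpa using hadj⟩
        have h3 : (@SimpleGraph.neighborFinset _ F x _).card = (F.neighborFinset x).card := by
          congr!
        rw [h3] at h1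
        omega
      obtain ⟨y, hy, hne⟩ := Finset.exists_mem_ne hd p.snd
      have hy' : F.Adj y x := SimpleGraph.Adj.symm (by simpa using hy)
      refine ⟨y, r, SimpleGraph.Walk.cons hy' p, ?_, by simp [hl]⟩
      exact path_ext (B := p.length + 1) (fun v c hc => absurd hc (hno v c)) p hp le_rfl hy' hne
  obtain ⟨x, r, p, hp, hl⟩ := key (Fintype.card V)
  have := hp.length_lt
  omega

/-- Moore bound -/
lemma moore {V : Type*} [Fintype V] [DecidableEq V] (F : SimpleGraph V) [DecidableRel F.Adj] (k : ℕ)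
    (hk : Fintype.card V ≤ 2 ^ k) (hF : NoShort F (2 * k)) (U : Finset V) (hU : U.Nonempty) :
    ∃ x ∈ U, (U.filter (F.Adj x)).card ≤ 2 := by
  by_contra hno
  push Not at hno
  obtain ⟨r, hr⟩ := hU
  have key : ∀ j : ℕ, j + 1 ≤ k → ∃ X : Finset V, 3 * 2 ^ j ≤ X.card ∧ X ⊆ U ∧
      ∀ x ∈ X, ∃ p : F.Walk x r, p.IsPath ∧ p.length = j + 1 := by
    intro j
    induction j with
    | zero =>
      intro _
      refine ⟨U.filter (F.Adj r), by have := hno r hr; simp; omega, Finset.filter_subset _ _, ?_⟩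
      intro x hx
      have h : F.Adj x r := (Finset.mem_filter.1 hx).2.symm
      exact ⟨SimpleGraph.Walk.cons h .nil, by simp [h.ne], by simp⟩
    | succ j ih =>
      intro hj
      obtain ⟨X, hX, hXU, hp⟩ := ih (by omega)
      have hs : ∀ x, ∃ s : V, x ∈ X → ∃ p : F.Walk x r, p.IsPath ∧ p.length = j + 1 ∧ p.snd = s := by
        intro x
        by_cases hx : x ∈ X
        · obtain ⟨p, hp1, hp2⟩ := hp x hx
          exact ⟨p.snd, fun _ => ⟨p, hp1, hp2, rfl⟩⟩
        · exact ⟨x, fun h => absurd h hx⟩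
      choose s hs using hs
      let C : V → Finset V := fun x => (U.filter (F.Adj x)).erase (s x)
      have hC : ∀ x ∈ X, 2 ≤ (C x).card := by
        intro x hx
        have h1 := hno x (hXU hx)
        have h2 := Finset.pred_card_le_card_erase (s := U.filter (F.Adj x)) (a := s x)
        simp only [C]
        omega
      have hCp : ∀ x ∈ X, ∀ y ∈ C x, ∃ p : F.Walk y r, p.IsPath ∧ p.length = j + 2 ∧ p.snd = x := by
        intro x hx y hy
        simp only [C, Finset.mem_erase, Finset.mem_filter] at hy
        obtain ⟨p, hp1, hp2, hp3⟩ := hs x hx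
        refine ⟨.cons hy.2.2.symm p, path_ext hF _ hp1 ?_ _ ?_, by simp [hp2], by simp⟩
        · omega
        · rw [hp3]; exact hy.1
      refine ⟨X.biUnion C, ?_, ?_, ?_⟩
      · rw [Finset.card_biUnion]
        · have := Finset.card_nsmul_le_sum X (fun x => (C x).card) 2 hC
          rw [smul_eq_mul] at this
          rw [pow_succ]
          omega
        · intro x hx x' hx' hne
          rw [Function.onFun, Finset.disjoint_left]
          intro y hy hy'
          obtain ⟨q, hpp, hl, hsn⟩ := hCp x hx y hy
          obtain ⟨q', hpp', hl', hsn'⟩ := hCp x' hx' y hy'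
          have : q ≠ q' := by
            rintro rfl
            exact hne (hsn.symm.trans hsn')
          obtain ⟨w, -, -, c, hc, hlc⟩ := hpp.exists_isCycle_length_le_add_of_ne hpp' this
          have := hF _ _ hc
          omega
      · intro y hy
        obtain ⟨x, hx, hy⟩ := Finset.mem_biUnion.1 hy
        simp only [C, Finset.mem_erase, Finset.mem_filter] at hy
        exact hy.2.1
      · intro y hy
        obtain ⟨x, hx, hy⟩ := Finset.mem_biUnion.1 hy
        obtain ⟨q, hpp, hl, -⟩ := hCp x hx y hy
        exact ⟨q, hpp, hl⟩
  have h3 : 3 ≤ Fintype.card V := (Nat.succ_le_of_lt (hno r hr)).trans (Finset.card_le_univ _)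
  obtain _ | k := k
  · simp at hk; omega
  obtain ⟨X, hX, -, -⟩ := key k (by omega)
  have := Finset.card_le_univ X
  rw [pow_succ] at hk
  have : 0 < 2 ^ k := by positivity
  omega

lemma orient {V : Type*} [Fintype V] [DecidableEq V] (F : SimpleGraph V) (k : ℕ)
    (hk : Fintype.card V ≤ 2 ^ k) (hF : NoShort F (2 * k)) :
    ∃ R : V → V → Prop, (∀ x y, F.Adj x y → R x y ∨ R y x) ∧ (∀ x y, R x y → F.Adj x y) ∧
      ∀ (x : V) [DecidablePred (R x)], (Finset.univ.filter (R x)).card ≤ 2 := by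
  classical
  have key : ∀ (m : ℕ) (U : Finset V), U.card = m →
    ∃ R : V → V → Prop, (∀ x ∈ U, ∀ y ∈ U, F.Adj x y → R x y ∨ R y x) ∧
      (∀ x y, R x y → F.Adj x y) ∧
      ∀ (x : V), (Finset.univ.filter (R x)).card ≤ 2 := by
    intro m
    induction m with
    | zero =>
      intro U hU
      rw [Finset.card_eq_zero] at hU
      subst hU
      exact ⟨fun _ _ => False, by simp, by simp, by simp⟩
    | succ m ih =>
      intro U hU
      obtain ⟨z, hz, hzc⟩ := moore F k hk hF U (Finset.card_pos.1 (by omega))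
      obtain ⟨R, h1, h3, h2⟩ := ih (U.erase z) (by rw [Finset.card_erase_of_mem hz]; omega)
      refine ⟨fun x y => if x = z then y ∈ U ∧ F.Adj z y else R x y, ?_, ?_, ?_⟩
      · intro x hx y hy hxy
        by_cases hxz : x = z
        · left; subst hxz; simp [hy, hxy]
        · by_cases hyz : y = z
          · right; subst hyz; simp [hx, hxy.symm]
          · simp only [hxz, hyz, if_false]
            exact h1 x (by simp [hxz, hx]) y (by simp [hyz, hy]) hxy
      · intro x y
        beta_reduce
        split_ifs with h
        · subst h; exact fun h => h.2
        · exact h3 x y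
      · intro x
        by_cases hxz : x = z
        · simp only [hxz, if_true]
          convert hzc using 2
          ext y; simp
        · simp only [hxz, if_false]; exact h2 x
  obtain ⟨R, h1, h3, h2⟩ := key _ Finset.univ rfl
  refine ⟨R, by simpa using h1, h3, fun x _ => ?_⟩
  convert h2 x

/-- balanced signing of `F` -/
def Bal {V : Type*} [Fintype V] (F : SimpleGraph V) (T : Matrix V V ℝ) : Prop :=
  (∀ x y, T x y = T y x) ∧ (∀ x, ∑ y, T x y = 0) ∧
  (∀ x y, F.Adj x y → T x y = 1 ∨ T x y = -1) ∧ (∀ x y, ¬ F.Adj x y → T x y = 0)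

lemma Bal.neg {V : Type*} [Fintype V] {F : SimpleGraph V} {T : Matrix V V ℝ} (h : Bal F T) :
    Bal F (-T) := by
  obtain ⟨h1, h2, h3, h4⟩ := h
  refine ⟨fun x y => by simp [h1 x y], fun x => by simp [h2 x], fun x y hxy => ?_, fun x y hxy => ?_⟩
  · rcases h3 x y hxy with h | h <;> simp [h]
  · simp [h4 x y hxy]

lemma Bal.smul {V : Type*} [Fintype V] {F : SimpleGraph V} {T : Matrix V V ℝ} (h : Bal F T)
    {e : ℝ} (he : e = 1 ∨ e = -1) : Bal F (e • T) := by
  rcases he with rfl | rfl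
  · simpa using h
  · simpa using h.neg

lemma Bal.add {V : Type*} [Fintype V] {F F₁ F₂ : SimpleGraph V} {T₁ T₂ : Matrix V V ℝ}
    (h : Bal F₁ T₁) (h' : Bal F₂ T₂) (hF : ∀ x y, F.Adj x y ↔ F₁.Adj x y ∨ F₂.Adj x y)
    (hdis : ∀ x y, F₁.Adj x y → ¬ F₂.Adj x y) : Bal F (T₁ + T₂) := by
  obtain ⟨h1, h2, h3, h4⟩ := h
  obtain ⟨g1, g2, g3, g4⟩ := h'
  refine ⟨fun x y => by simp [h1 x y, g1 x y], fun x => by simp [Finset.sum_add_distrib, h2 x, g2 x],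
    fun x y hxy => ?_, fun x y hxy => ?_⟩
  · rcases (hF x y).1 hxy with h | h
    · simpa [g4 x y (hdis x y h)] using h3 x y h
    · simpa [h4 x y (fun h' => hdis x y h' h)] using g3 x y h
  · rw [hF] at hxy
    push Not at hxy
    simp [h4 x y hxy.1, g4 x y hxy.2]

lemma Bal.abs_eq {V : Type*} [Fintype V] {F : SimpleGraph V} {T : Matrix V V ℝ} (h : Bal F T)
    (x y : V) : |T x y| = adjMat F x y := by
  classical
  rw [adjMat_apply]
  split_ifs with hxy
  · rcases h.2.2.1 x y hxy with h | h <;> simp [h]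
  · simp [h.2.2.2 x y hxy]

/-- positive part of a signing -/
def posG {V : Type*} (F : SimpleGraph V) (T : Matrix V V ℝ) (hT : ∀ x y, T x y = T y x) :
    SimpleGraph V where
  Adj x y := F.Adj x y ∧ T x y = 1
  symm := ⟨fun x y h => ⟨h.1.symm, by rw [hT]; exact h.2⟩⟩
  loopless := ⟨fun x h => F.loopless.irrefl x h.1⟩

lemma posG_adjMat {V : Type*} [Fintype V] {F : SimpleGraph V} {T : Matrix V V ℝ} (h : Bal F T) :
    adjMat (posG F T h.1) = (1/2 : ℝ) • (adjMat F + T) := by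
  classical
  ext x y
  simp only [Matrix.smul_apply, Matrix.add_apply, adjMat_apply, smul_eq_mul, posG]
  by_cases hxy : F.Adj x y
  · rcases h.2.2.1 x y hxy with h | h
    · simp [hxy, h]; norm_num
    · simp [hxy, h]; norm_num
  · simp [hxy, h.2.2.2 x y hxy]

lemma posG_deg {V : Type*} [Fintype V] {F : SimpleGraph V} {T : Matrix V V ℝ} (h : Bal F T) (x : V) :
    2 * deg (posG F T h.1) x = deg F x := by
  have : (2 * deg (posG F T h.1) x : ℝ) = deg F x := by
    rw [deg_eq_sum, deg_eq_sum, posG_adjMat h]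
    simp only [Matrix.smul_apply, Matrix.add_apply, smul_eq_mul]
    rw [← Finset.mul_sum, Finset.sum_add_distrib, h.2.1 x]
    ring
  exact_mod_cast this

lemma Bal.even {V : Type*} [Fintype V] {F : SimpleGraph V} {T : Matrix V V ℝ} (h : Bal F T) (x : V) :
    Even (deg F x) := by
  rw [← posG_deg h x]; exact even_two_mul _

/-- signed matrix of a walk -/
noncomputable def cmat {V : Type*} [DecidableEq V] (c : V → ℝ) {F : SimpleGraph V} :
    ∀ {u v : V}, F.Walk u v → Matrix V V ℝ
  | _, _, .nil => 0
  | u, _, .cons (v := w) _ p => Matrix.of (fun x y => if s(x, y) = s(u, w) then c u else 0) + cmat c p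

lemma cmat_symm {V : Type*} [DecidableEq V] (c : V → ℝ) {F : SimpleGraph V}
    {u v : V} (p : F.Walk u v) (x y : V) : cmat c p x y = cmat c p y x := by
  induction p with
  | nil => simp [cmat]
  | cons h p ih => simp only [cmat, Matrix.add_apply, Matrix.of_apply, ih, Sym2.eq_swap (a := x)]

lemma edge_split {V : Type*} [DecidableEq V] {u w : V} (h : u ≠ w) (a : ℝ) (x y : V) :
    (if s(x, y) = s(u, w) then a else 0) =
      (if x = u then (if y = w then a else 0) else 0) + (if x = w then (if y = u then a else 0) else 0) := by
  simp only [Sym2.eq_iff]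
  by_cases h1 : x = u <;> by_cases h2 : x = w <;> by_cases h3 : y = u <;> by_cases h4 : y = w <;>
    simp_all

lemma cmat_row {V : Type*} [Fintype V] [DecidableEq V] (c : V → ℝ) {F : SimpleGraph V}
    (hc : ∀ x y, F.Adj x y → c y = - c x)
    {u v : V} (p : F.Walk u v) (x : V) :
    ∑ y, cmat c p x y = (if x = u then c u else 0) - (if x = v then c v else 0) := by
  induction p with
  | nil => simp [cmat]
  | @cons u w v h p ih =>
    simp only [cmat, Matrix.add_apply, Matrix.of_apply, Finset.sum_add_distrib, ih,
      edge_split h.ne]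
    rw [hc u w h]
    by_cases h1 : x = u <;> by_cases h2 : x = w <;> simp_all <;> ring

lemma cmat_abs {V : Type*} [Fintype V] [DecidableEq V] (c : V → ℝ) {F : SimpleGraph V}
    (hc1 : ∀ x, c x = 1 ∨ c x = -1)
    {u v : V} (p : F.Walk u v) :
    ∑ x, ∑ y, |cmat c p x y| ≤ 2 * p.length := by
  induction p with
  | nil => simp [cmat]
  | @cons u w v h p ih =>
    have hcu : |c u| = 1 := by rcases hc1 u with h | h <;> simp [h]
    have h1 : ∀ x y, |cmat c (.cons h p) x y| ≤
      (if x = u then (if y = w then 1 else 0) else 0) + (if x = w then (if y = u then 1 else 0) else 0)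
        + |cmat c p x y| := by
      intro x y
      simp only [cmat, Matrix.add_apply, Matrix.of_apply]
      refine (abs_add_le _ _).trans ?_
      rw [← edge_split h.ne]
      gcongr
      split_ifs <;> simp [hcu]
    refine (Finset.sum_le_sum fun x _ => Finset.sum_le_sum fun y _ => h1 x y).trans ?_
    simp only [Finset.sum_add_distrib, SimpleGraph.Walk.length_cons]
    have e1 : ∀ a b : V, ∑ x, ∑ y, (if x = a then (if y = b then (1:ℝ) else 0) else 0) = 1 := by
      intro a b
      simp
    rw [e1, e1]
    push_cast
    linarith

lemma cmat_not_mem {V : Type*} [DecidableEq V] (c : V → ℝ) {F : SimpleGraph V}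
    {u v : V} (p : F.Walk u v) (x y : V) (h : s(x, y) ∉ p.edges) : cmat c p x y = 0 := by
  induction p with
  | nil => simp [cmat]
  | cons h' p ih =>
    simp only [SimpleGraph.Walk.edges_cons, List.mem_cons, not_or] at h
    simp only [cmat, Matrix.add_apply, Matrix.of_apply, ih h.2, if_neg h.1, add_zero]

lemma cmat_mem {V : Type*} [DecidableEq V] (c : V → ℝ) {F : SimpleGraph V}
    (hc1 : ∀ x, c x = 1 ∨ c x = -1)
    {u v : V} (p : F.Walk u v) (hp : p.IsTrail) (x y : V) (h : s(x, y) ∈ p.edges) :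
    cmat c p x y = 1 ∨ cmat c p x y = -1 := by
  induction p with
  | nil => simp at h
  | @cons u w v h' p ih =>
    rw [SimpleGraph.Walk.isTrail_cons] at hp
    simp only [SimpleGraph.Walk.edges_cons, List.mem_cons] at h
    simp only [cmat, Matrix.add_apply, Matrix.of_apply]
    by_cases he : s(x, y) = s(u, w)
    · rw [if_pos he, cmat_not_mem c p x y (he ▸ hp.2), add_zero]
      exact hc1 u
    · rw [if_neg he, zero_add]
      exact ih hp.1 (h.resolve_left he)

/-- Peel off a cycle. -/
lemma peel {V : Type*} [Fintype V] (c : V → ℝ) (F : SimpleGraph V)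
    (hc1 : ∀ x, c x = 1 ∨ c x = -1) (hc : ∀ x y, F.Adj x y → c y = - c x)
    (hev : ∀ x, Even (deg F x)) {v : V} (p : F.Walk v v) (hp : p.IsCycle) :
    ∃ (C F' : SimpleGraph V) (T : Matrix V V ℝ), Bal C T ∧ (∑ x, ∑ y, |T x y| ≤ 2 * p.length) ∧
      (∀ x y, F.Adj x y ↔ C.Adj x y ∨ F'.Adj x y) ∧ (∀ x y, C.Adj x y → ¬ F'.Adj x y) ∧
      F' < F ∧ (∀ x, Even (deg F' x)) ∧ adjMat F = adjMat C + adjMat F' := by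
  classical
  let C : SimpleGraph V := SimpleGraph.fromEdgeSet {e | e ∈ p.edges}
  have hCadj : ∀ x y, C.Adj x y ↔ s(x, y) ∈ p.edges := by
    intro x y
    simp only [C, SimpleGraph.fromEdgeSet_adj, Set.mem_ofPred_eq]
    refine ⟨fun h => h.1, fun h => ⟨h, (p.adj_of_mem_edges h).ne⟩⟩
  have hCF : ∀ x y, C.Adj x y → F.Adj x y := fun x y h => p.adj_of_mem_edges ((hCadj x y).1 h)
  have hB : Bal C (cmat c p) := by
    refine ⟨cmat_symm c p, fun x => by rw [cmat_row c hc]; simp, fun x y h => ?_, fun x y h => ?_⟩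
    · exact cmat_mem c hc1 p hp.isTrail x y ((hCadj x y).1 h)
    · exact cmat_not_mem c p x y (fun h' => h ((hCadj x y).2 h'))
  have hadd : adjMat F = adjMat C + adjMat (F \ C) := by
    ext x y
    simp only [Matrix.add_apply, adjMat_apply, SimpleGraph.sdiff_adj]
    have := hCF x y
    by_cases h1 : C.Adj x y <;> by_cases h2 : F.Adj x y <;> simp_all
  refine ⟨C, F \ C, cmat c p, hB, cmat_abs c hc1 p, ?_, ?_, ?_, ?_, hadd⟩
  · intro x y
    have := hCF x y
    rw [SimpleGraph.sdiff_adj]; tauto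
  · intro x y h h'
    rw [SimpleGraph.sdiff_adj] at h'; exact h'.2 h
  · refine lt_of_le_of_ne sdiff_le ?_
    intro he
    have hnn := hp.not_nil
    have h1 := p.adj_snd hnn
    have h2 : C.Adj v p.snd := by
      rw [hCadj]
      exact p.mk_start_snd_mem_edges hnn
    have h3 : ∀ x y, F.Adj x y → ¬ C.Adj x y := by
      intro x y hxy
      have : (F \ C).Adj x y := by rw [he]; exact hxy
      exact ((SimpleGraph.sdiff_adj _ _ _ _).1 this).2
    exact h3 _ _ h1 h2
  · intro x
    have h1 : deg F x = deg C x + deg (F \ C) x := by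
      have : (deg F x : ℝ) = deg C x + deg (F \ C) x := by
        simp only [deg_eq_sum, hadd, Matrix.add_apply, Finset.sum_add_distrib]
      exact_mod_cast this
    have h2 := hev x
    rw [h1, Nat.even_add] at h2
    exact h2.1 (hB.even x)

lemma euler {V : Type*} [Fintype V] (c : V → ℝ) (hc1 : ∀ x, c x = 1 ∨ c x = -1) (F : SimpleGraph V)
    (hc : ∀ x y, F.Adj x y → c y = - c x)
    (hev : ∀ x, Even (deg F x)) : ∃ T, Bal F T := by
  induction F using WellFoundedLT.induction with
  | ind F ih =>
  by_cases hF : ∃ a b, F.Adj a b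
  · obtain ⟨a, b, hab⟩ := hF
    obtain ⟨v, p, hp⟩ := exists_cycle F (fun x h => by have := hev x; rw [h] at this; simp at this) hab
    obtain ⟨C, F', T, hB, -, h1, h2, hlt, hev', -⟩ := peel c F hc1 hc hev p hp
    obtain ⟨T', hT'⟩ := ih F' hlt (fun x y h => hc x y (hlt.le h)) hev'
    exact ⟨T + T', hB.add hT' h1 h2⟩
  · push Not at hF
    exact ⟨0, by simp, by simp, fun x y h => absurd h (hF x y), by simp⟩

lemma decomp {V : Type} [Fintype V] [DecidableEq V] (c : V → ℝ) (hc1 : ∀ x, c x = 1 ∨ c x = -1) (k : ℕ) (F : SimpleGraph V)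
    (hc : ∀ x y, F.Adj x y → c y = - c x)
    (hev : ∀ x, Even (deg F x)) :
    ∃ (ι : Type) (_ : Fintype ι) (S : ι → Matrix V V ℝ) (S0 : Matrix V V ℝ) (F0 : SimpleGraph V),
      (∀ ε : ι → ℝ, (∀ i, ε i = 1 ∨ ε i = -1) → Bal F (S0 + ∑ i, ε i • S i)) ∧
      (∀ i, ∑ x, ∑ y, |S i x y| ≤ 4 * k) ∧
      (∑ i, ∑ x, ∑ y, |S i x y| ≤ ∑ x, ∑ y, adjMat F x y) ∧
      F0 ≤ F ∧ NoShort F0 (2 * k) ∧ Bal F0 S0 := by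
  induction F using WellFoundedLT.induction with
  | ind F ih =>
  by_cases hF : NoShort F (2 * k)
  · obtain ⟨T, hT⟩ := euler c hc1 F hc hev
    refine ⟨Empty, inferInstance, fun _ => 0, T, F, fun ε _ => by simpa using hT, by simp, ?_,
      le_rfl, hF, hT⟩
    simp only [Finset.univ_eq_empty, Finset.sum_empty]
    refine Finset.sum_nonneg fun x _ => Finset.sum_nonneg fun y _ => ?_
    rw [← hT.abs_eq]; positivity
  · unfold NoShort at hF
    push Not at hF
    obtain ⟨v, p, hp, hl⟩ := hF
    obtain ⟨C, F', T, hB, hTl, h1, h2, hlt, hev', hadd⟩ := peel c F hc1 hc hev p hp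
    obtain ⟨ι, _, S, S0, F0, g1, g2, g3, g4, g5, g6⟩ :=
      ih F' hlt (fun x y h => hc x y (hlt.le h)) hev'
    refine ⟨Option ι, inferInstance, fun i => i.elim T S, S0, F0, ?_, ?_, ?_, g4.trans hlt.le, g5, g6⟩
    · intro ε hε
      rw [Fintype.sum_option]
      have := (hB.smul (hε none)).add (g1 (fun i => ε (some i)) (fun i => hε _)) h1 h2
      convert this using 1
      simp only [Option.elim]
      abel
    · rintro (_ | i)
      · simp only [Option.elim]
        refine hTl.trans ?_
        have : (p.length : ℝ) ≤ 2 * k := by exact_mod_cast hl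
        linarith
      · exact g2 i
    · rw [Fintype.sum_option]
      simp only [Option.elim]
      simp only [hadd, Matrix.add_apply, Finset.sum_add_distrib, hB.abs_eq]
      gcongr

lemma matching {V : Type*} [Fintype V] (c : V → ℝ) (hc1 : ∀ x, c x = 1 ∨ c x = -1) (F : SimpleGraph V)
    (hc : ∀ x y, F.Adj x y → c y = - c x) (d : ℕ) (hd : 0 < d) (hreg : IsRegularGraph F d) :
    ∃ P ≤ F, IsRegularGraph P 1 := by
  classical
  have hdeg : ∀ x, (F.neighborFinset x).card = d := by
    intro x
    rw [← hreg x]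
    unfold deg
    rw [← SimpleGraph.card_neighborFinset_eq_degree]
  obtain ⟨f, hf, hfa⟩ := (Finset.all_card_le_biUnion_card_iff_exists_injective
    (fun x => F.neighborFinset x)).1 (by
      intro s
      set N := s.biUnion fun x => F.neighborFinset x with hN
      have h1 : ∑ x ∈ s, ((F.neighborFinset x) ∩ N).card = d * s.card := by
        rw [Finset.sum_congr rfl (g := fun _ => d)]
        · simp [mul_comm]
        · intro x hx
          rw [Finset.inter_eq_left.2, hdeg]
          exact Finset.subset_biUnion_of_mem (fun x => F.neighborFinset x) hx
      have h2 : ∑ x ∈ s, ((F.neighborFinset x) ∩ N).card = ∑ y ∈ N, ((F.neighborFinset y) ∩ s).card := by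
        have := Finset.sum_card_bipartiteAbove_eq_sum_card_bipartiteBelow (s := s) (t := N) F.Adj
        convert this using 3
        · ext y; simp [Finset.bipartiteAbove, and_comm]
        · ext y; simp [Finset.bipartiteBelow, and_comm, SimpleGraph.adj_comm]
      have h3 : ∑ y ∈ N, ((F.neighborFinset y) ∩ s).card ≤ N.card * d := by
        refine Finset.sum_le_card_nsmul _ _ _ fun y _ => ?_
        rw [← hdeg y]
        exact Finset.card_le_card Finset.inter_subset_left
      rw [← h2, h1, mul_comm] at h3
      exact Nat.le_of_mul_le_mul_right h3 hd)
  have hfa' : ∀ x, F.Adj x (f x) := fun x => by simpa using hfa x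
  have hfc : ∀ x, c (f x) = - c x := fun x => hc x _ (hfa' x)
  have hsurj := Finite.surjective_of_injective hf
  let P : SimpleGraph V :=
    { Adj := fun x y => (c x = 1 ∧ f x = y) ∨ (c y = 1 ∧ f y = x)
      symm := ⟨fun x y h => h.symm⟩
      loopless := ⟨fun x h => by
        rcases h with h | h <;> exact (hfa' x).ne h.2.symm⟩ }
  refine ⟨P, ?_, ?_⟩
  · rintro x y (⟨_, rfl⟩ | ⟨_, rfl⟩)
    · exact hfa' x
    · exact (hfa' y).symm
  · intro x
    have : (deg P x : ℝ) = 1 := by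
      rw [deg_eq_sum]
      simp only [adjMat_apply, P]
      obtain ⟨y, hy⟩ := hsurj x
      rcases hc1 x with h | h
      · have e : ∀ z, ((c x = 1 ∧ f x = z) ∨ (c z = 1 ∧ f z = x)) ↔ f x = z := by
          intro z
          constructor
          · rintro (h' | ⟨h1, h2⟩)
            · exact h'.2
            · have := hfc z
              rw [h2, h, h1] at this
              norm_num at this
          · exact fun h' => Or.inl ⟨h, h'⟩
        simp only [e]
        simp
      · have hy1 : c y = 1 := by
          have := hfc y
          rw [hy, h] at this
          linarith
        have e : ∀ z, ((c x = 1 ∧ f x = z) ∨ (c z = 1 ∧ f z = x)) ↔ y = z := by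
          intro z
          constructor
          · rintro (⟨h1, _⟩ | ⟨h1, h2⟩)
            · rw [h] at h1; norm_num at h1
            · exact hf (hy.trans h2.symm)
          · rintro rfl; exact Or.inr ⟨hy1, hy⟩
        simp only [e]
        simp
    exact_mod_cast this

lemma specNorm_add {V : Type*} [Fintype V] [DecidableEq V] (A B : Matrix V V ℝ) :
    specNorm (A + B) ≤ specNorm A + specNorm B := by
  unfold specNorm
  rw [map_add]; exact norm_add_le _ _

lemma specNorm_smul {V : Type*} [Fintype V] [DecidableEq V] (a : ℝ) (B : Matrix V V ℝ) :
    specNorm (a • B) = |a| * specNorm B := by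
  unfold specNorm
  rw [map_smul, norm_smul, Real.norm_eq_abs]

lemma specNorm_neg {V : Type*} [Fintype V] [DecidableEq V] (B : Matrix V V ℝ) :
    specNorm (-B) = specNorm B := by
  unfold specNorm
  rw [map_neg, norm_neg]

lemma specNorm_nonneg {V : Type*} [Fintype V] [DecidableEq V] (B : Matrix V V ℝ) :
    0 ≤ specNorm B := norm_nonneg _

lemma schur {V : Type*} [Fintype V] [DecidableEq V] (B : Matrix V V ℝ) (r s : ℝ)
    (hr0 : 0 ≤ r) (hs0 : 0 ≤ s)
    (hr : ∀ x, ∑ y, |B x y| ≤ r) (hs : ∀ y, ∑ x, |B x y| ≤ s) : specNorm B ≤ √(r * s) := by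
  unfold specNorm
  refine ContinuousLinearMap.opNorm_le_bound _ (Real.sqrt_nonneg _) fun z => ?_
  rw [← Real.sqrt_sq (norm_nonneg z), ← Real.sqrt_mul (by positivity)]
  apply Real.le_sqrt_of_sq_le
  rw [EuclideanSpace.norm_sq_eq, EuclideanSpace.norm_sq_eq]
  simp only [Matrix.ofLp_toEuclideanCLM, Matrix.mulVec, dotProduct, Real.norm_eq_abs, sq_abs]
  have h1 : ∀ x, (∑ y, B x y * z y) ^ 2 ≤ r * ∑ y, |B x y| * z y ^ 2 := by
    intro x
    have := Finset.sum_sq_le_sum_mul_sum_of_sq_le_mul Finset.univ (r := fun y => B x y * z y)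
      (f := fun y => |B x y|) (g := fun y => |B x y| * z y ^ 2) (fun _ _ => by positivity)
      (fun _ _ => by positivity) (fun y _ => by
        rw [mul_pow, ← sq_abs (B x y)]; apply le_of_eq; ring)
    refine this.trans ?_
    gcongr
    exact hr x
  calc ∑ x, (∑ y, B x y * z y) ^ 2 ≤ ∑ x, r * ∑ y, |B x y| * z y ^ 2 := Finset.sum_le_sum fun x _ => h1 x
    _ = r * ∑ y, (∑ x, |B x y|) * z y ^ 2 := by
        rw [← Finset.mul_sum, Finset.sum_comm]
        simp only [Finset.sum_mul]
    _ ≤ r * ∑ y, s * z y ^ 2 := by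
        gcongr with y _
        exact hs y
    _ = r * s * ∑ y, z y ^ 2 := by rw [← Finset.mul_sum]; ring

lemma adjMat_nonneg {V : Type*} [Fintype V] (F : SimpleGraph V) (x y : V) : 0 ≤ adjMat F x y := by
  classical
  rw [adjMat_apply]; split_ifs <;> norm_num

lemma adjMat_symm {V : Type*} [Fintype V] (F : SimpleGraph V) (x y : V) :
    adjMat F x y = adjMat F y x := by
  classical
  rw [adjMat_apply, adjMat_apply]; simp [SimpleGraph.adj_comm]

lemma specNorm_adj {V : Type*} [Fintype V] [DecidableEq V] (F : SimpleGraph V) (d : ℕ)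
    (hreg : IsRegularGraph F d) : specNorm (adjMat F) ≤ d := by
  have h1 : ∀ x, ∑ y, |adjMat F x y| = d := by
    intro x
    simp only [abs_of_nonneg (adjMat_nonneg F _ _)]
    rw [← deg_eq_sum, hreg x]
  have := schur (adjMat F) d d (by positivity) (by positivity) (fun x => (h1 x).le) (fun y => by
    simp only [adjMat_symm F _ y]; exact (h1 y).le)
  rwa [Real.sqrt_mul_self (by positivity)] at this

lemma specNorm_left {V : Type*} [Fintype V] [DecidableEq V] (F F0 : SimpleGraph V) (d k : ℕ)
    (hk : Fintype.card V ≤ 2 ^ k)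
    (hreg : IsRegularGraph F d) (hle : F0 ≤ F) (hF0 : NoShort F0 (2 * k)) (S : Matrix V V ℝ)
    (hS : Bal F0 S) : specNorm S ≤ 2 * √(2 * d) := by
  classical
  obtain ⟨R, hR1, hR2, hR3⟩ := orient F0 k hk hF0
  have hSabs : ∀ x, ∑ y, |S x y| ≤ d := by
    intro x
    rw [← hreg x, deg_eq_sum]
    refine Finset.sum_le_sum fun y _ => ?_
    rw [hS.abs_eq, adjMat_apply, adjMat_apply]
    have := @hle x y
    split_ifs <;> simp_all
  have hS1 : ∀ x y, |S x y| ≤ 1 := by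
    intro x y
    rw [hS.abs_eq, adjMat_apply]
    split_ifs <;> simp
  let B : Matrix V V ℝ := Matrix.of fun x y => if R x y then S x y else 0
  let C : Matrix V V ℝ := Matrix.of fun x y => if R x y then 0 else S x y
  have hSBC : S = B + C := by
    ext x y
    simp only [B, C, Matrix.add_apply, Matrix.of_apply]
    split_ifs <;> simp
  have hBS : ∀ x y, |B x y| ≤ |S x y| := by
    intro x y; simp only [B, Matrix.of_apply]; split_ifs <;> simp
  have hCS : ∀ x y, |C x y| ≤ |S x y| := by
    intro x y; simp only [C, Matrix.of_apply]; split_ifs <;> simp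
  have hcnt : ∀ x, ∑ y, (if R x y then (1:ℝ) else 0) ≤ 2 := by
    intro x
    rw [Finset.sum_boole]
    exact_mod_cast hR3 x
  have hB := schur B 2 d (by norm_num) (by positivity)
    (fun x => (Finset.sum_le_sum fun y _ => by
      simp only [B, Matrix.of_apply]; split_ifs <;> simp [hS1]).trans (hcnt x))
    (fun y => (Finset.sum_le_sum fun x _ => by
      rw [hS.1 y x]; exact hBS x y).trans (hSabs y))
  have hC := schur C d 2 (by positivity) (by norm_num)
    (fun x => (Finset.sum_le_sum fun y _ => hCS x y).trans (hSabs x))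
    (fun y => (Finset.sum_le_sum fun x _ => by
      simp only [C, Matrix.of_apply]
      by_cases h : R x y
      · simp only [h, if_true, abs_zero]; split_ifs <;> simp
      · by_cases h' : R y x
        · simp [h, h', hS1]
        · have : S x y = 0 := hS.2.2.2 x y (fun ha => by have := hR1 x y ha; tauto)
          simp [h, h', this]).trans (hcnt y))
  rw [mul_comm (d : ℝ) 2] at hC
  have := specNorm_add B C
  rw [← hSBC] at this
  linarith

/-- sign of a boolean -/
noncomputable def sg (b : Bool) : ℝ := if b then 1 else -1

lemma mgf {ι : Type*} [Fintype ι] [DecidableEq ι] (a : ι → ℝ) :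
    ∑ ε : ι → Bool, (1/2 : ℝ) ^ Fintype.card ι * Real.exp (∑ i, sg (ε i) * a i)
      ≤ Real.exp ((∑ i, a i ^ 2) / 2) := by
  have h1 : ∀ ε : ι → Bool, (1/2 : ℝ) ^ Fintype.card ι * Real.exp (∑ i, sg (ε i) * a i) =
      ∏ i, (1/2 * Real.exp (sg (ε i) * a i)) := by
    intro ε
    rw [Real.exp_sum, Finset.prod_mul_distrib, Finset.prod_const, Finset.card_univ]
  simp only [h1]
  have h2 := Finset.prod_univ_sum (fun _ : ι => (Finset.univ : Finset Bool))
    (fun i b => 1/2 * Real.exp (sg b * a i))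
  rw [Fintype.piFinset_univ] at h2
  rw [← h2, Finset.sum_div, Real.exp_sum]
  refine Finset.prod_le_prod (fun i _ => Finset.sum_nonneg fun b _ => by positivity) fun i _ => ?_
  refine le_trans (le_of_eq ?_) (Real.cosh_le_exp_half_sq (a i))
  rw [Real.cosh_eq]
  simp [sg]
  ring

lemma hoeff1 {ι : Type*} [Fintype ι] [DecidableEq ι] (a : ι → ℝ) (σ t : ℝ) (hσ : 0 < σ) (ht : 0 ≤ t)
    (ha : ∑ i, a i ^ 2 ≤ σ ^ 2) :
    ∑ ε : ι → Bool, (if t * σ < ∑ i, sg (ε i) * a i then (1/2 : ℝ) ^ Fintype.card ι else 0)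
      ≤ Real.exp (-t ^ 2 / 2) := by
  have h := mgf (fun i => t / σ * a i)
  have h1 : ∀ ε : ι → Bool, (if t * σ < ∑ i, sg (ε i) * a i then (1/2 : ℝ) ^ Fintype.card ι else 0)
      ≤ Real.exp (-t ^ 2) *
        ((1/2 : ℝ) ^ Fintype.card ι * Real.exp (∑ i, sg (ε i) * (t / σ * a i))) := by
    intro ε
    rw [mul_left_comm, ← Real.exp_add]
    split_ifs with hlt
    · apply le_mul_of_one_le_right (by positivity)
      rw [Real.one_le_exp_iff]
      have e1 : ∑ i, sg (ε i) * (t / σ * a i) = t / σ * ∑ i, sg (ε i) * a i := by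
        rw [Finset.mul_sum]
        exact Finset.sum_congr rfl fun i _ => by ring
      have e2 : t / σ * (t * σ) ≤ t / σ * ∑ i, sg (ε i) * a i := by gcongr
      have e3 : t / σ * (t * σ) = t ^ 2 := by field_simp
      rw [e1]; linarith
    · positivity
  refine (Finset.sum_le_sum fun ε _ => h1 ε).trans ?_
  rw [← Finset.mul_sum]
  refine (mul_le_mul_of_nonneg_left h (Real.exp_pos _).le).trans ?_
  rw [← Real.exp_add, Real.exp_le_exp]
  have h2 : ∑ i, (t / σ * a i) ^ 2 = (t / σ) ^ 2 * ∑ i, a i ^ 2 := by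
    rw [Finset.mul_sum]; simp only [mul_pow]
  have h3 : (t / σ) ^ 2 * ∑ i, a i ^ 2 ≤ (t / σ) ^ 2 * σ ^ 2 := by gcongr
  have h4 : (t / σ) ^ 2 * σ ^ 2 = t ^ 2 := by field_simp
  rw [h2]
  linarith

lemma hoeff {ι : Type*} [Fintype ι] [DecidableEq ι] (a : ι → ℝ) (σ t : ℝ) (hσ : 0 ≤ σ) (ht : 0 ≤ t)
    (ha : ∑ i, a i ^ 2 ≤ σ ^ 2) :
    ∑ ε : ι → Bool, (if t * σ < |∑ i, sg (ε i) * a i| then (1/2 : ℝ) ^ Fintype.card ι else 0)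
      ≤ 2 * Real.exp (-t ^ 2 / 2) := by
  rcases hσ.eq_or_lt with rfl | hσ
  · have hz : ∀ i, a i = 0 := by
      intro i
      have h1 := Finset.single_le_sum (f := fun i => a i ^ 2) (fun i _ => sq_nonneg _) (Finset.mem_univ i)
      have h2 : a i ^ 2 ≤ 0 := by
        refine le_trans h1 (ha.trans (by norm_num))
      exact pow_eq_zero_iff (two_ne_zero) |>.1 (le_antisymm h2 (sq_nonneg _))
    simp only [hz]
    simp
    positivity
  · have h1 := hoeff1 a σ t hσ ht ha
    have h2 := hoeff1 (fun i => - a i) σ t hσ ht (by simpa using ha)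
    rw [two_mul]
    refine le_trans ?_ (add_le_add h1 h2)
    rw [← Finset.sum_add_distrib]
    refine Finset.sum_le_sum fun ε _ => ?_
    simp only [mul_neg, Finset.sum_neg_distrib]
    have hp : (0:ℝ) ≤ (1/2 : ℝ) ^ Fintype.card ι := by positivity
    by_cases h : t * σ < |∑ i, sg (ε i) * a i|
    · rw [if_pos h]
      rcases lt_abs.1 h with h | h
      · rw [if_pos h]; split_ifs <;> linarith
      · rw [if_pos h]; split_ifs <;> linarith
    · rw [if_neg h]; split_ifs <;> linarith

/-- the inductive statement -/
def Good (n k d a : ℕ) (G : SimpleGraph (Fin n)) (B : ℝ) : Prop :=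
  ∃ (Ω : Type) (_ : Fintype Ω) (w : Ω → ℝ) (H : Ω → SimpleGraph (Fin n))
    (M : Ω → Matrix (Fin n) (Fin n) ℝ),
    (∀ ω, 0 ≤ w ω) ∧ ∑ ω, w ω = 1 ∧
    (∀ ω, H ω ≤ G ∧ IsRegularGraph (H ω) a ∧ specNorm (M ω) ≤ B) ∧
    ∀ (u v : Fin n → ℝ) (t : ℝ), 0 ≤ t →
      ∑ ω, (if t * (2 + √2) * √(d * n * (k : ℝ)) * ‖u‖ * ‖v‖ <
          |u ⬝ᵥ (adjMat (H ω) - ((a : ℝ) / d) • adjMat G + M ω).mulVec v| then w ω else 0)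
        ≤ 2 * Real.logb 2 d * Real.exp (-t ^ 2 / 2)

lemma bil_abs {V : Type*} [Fintype V] (S : Matrix V V ℝ) (u v : V → ℝ) :
    |u ⬝ᵥ S.mulVec v| ≤ (∑ x, ∑ y, |S x y|) * (‖u‖ * ‖v‖) := by
  simp only [dotProduct, Matrix.mulVec]
  refine (Finset.abs_sum_le_sum_abs _ _).trans ?_
  rw [Finset.sum_mul]
  refine Finset.sum_le_sum fun x _ => ?_
  rw [abs_mul, Finset.sum_mul]
  calc |u x| * |∑ y, S x y * v y| ≤ ‖u‖ * ∑ y, |S x y| * ‖v‖ := by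
        gcongr
        · exact norm_le_pi_norm u x
        · refine (Finset.abs_sum_le_sum_abs _ _).trans (Finset.sum_le_sum fun y _ => ?_)
          rw [abs_mul]
          gcongr
          exact norm_le_pi_norm v y
    _ = _ := by
        rw [Finset.mul_sum]
        exact Finset.sum_congr rfl fun y _ => by ring

lemma Good.mono {n k d a : ℕ} {G : SimpleGraph (Fin n)} {B B' : ℝ} (h : Good n k d a G B)
    (hB : B ≤ B') : Good n k d a G B' := by
  obtain ⟨Ω, i, w, H, M, h1, h2, h3, h4⟩ := h
  exact ⟨Ω, i, w, H, M, h1, h2, fun ω => ⟨(h3 ω).1, (h3 ω).2.1, (h3 ω).2.2.trans hB⟩, h4⟩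

lemma logb_nonneg (d : ℕ) : 0 ≤ Real.logb 2 (d : ℝ) := by
  rcases Nat.eq_zero_or_pos d with rfl | hd
  · simp
  · exact Real.logb_nonneg (by norm_num) (by exact_mod_cast hd)

lemma adjMat_sdiff {V : Type*} [Fintype V] {F P : SimpleGraph V} (h : P ≤ F) :
    adjMat (F \ P) = adjMat F - adjMat P := by
  classical
  ext x y
  simp only [Matrix.sub_apply, adjMat_apply, SimpleGraph.sdiff_adj]
  have := @h x y
  by_cases h1 : P.Adj x y <;> by_cases h2 : F.Adj x y <;> simp_all

lemma reg_sdiff {V : Type*} [Fintype V] {F P : SimpleGraph V} (h : P ≤ F) {d a : ℕ} (had : a ≤ d)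
    (hF : IsRegularGraph F d) (hP : IsRegularGraph P a) : IsRegularGraph (F \ P) (d - a) := by
  intro x
  have : (deg (F \ P) x : ℝ) = ((d - a : ℕ) : ℝ) := by
    rw [deg_eq_sum, adjMat_sdiff h]
    simp only [Matrix.sub_apply, Finset.sum_sub_distrib]
    rw [← deg_eq_sum, ← deg_eq_sum, hF x, hP x, Nat.cast_sub had]
  exact_mod_cast this

lemma good_zero {n k d : ℕ} {G : SimpleGraph (Fin n)} : Good n k d 0 G 0 := by
  have h0 : adjMat (⊥ : SimpleGraph (Fin n)) = 0 := by
    classical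
    ext x y; rw [adjMat_apply]; simp
  refine ⟨Unit, inferInstance, fun _ => 1, fun _ => ⊥, fun _ => 0, by simp, by simp, ?_, ?_⟩
  · intro _
    refine ⟨bot_le, ?_, by simp [specNorm]⟩
    intro x
    have : (deg (⊥ : SimpleGraph (Fin n)) x : ℝ) = 0 := by rw [deg_eq_sum, h0]; simp
    exact_mod_cast this
  · intro u v t ht
    have := logb_nonneg d
    rw [Finset.sum_eq_zero]
    · positivity
    · intro _ _
      rw [if_neg]
      simp only [h0, not_lt]
      simp
      positivity

lemma good_compl {n k d a : ℕ} (hd : 0 < d) (had : a ≤ d) {G : SimpleGraph (Fin n)} {B : ℝ}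
    (hG : IsRegularGraph G d) (h : Good n k d (d - a) G B) : Good n k d a G B := by
  obtain ⟨Ω, i, w, H, M, h1, h2, h3, h4⟩ := h
  refine ⟨Ω, i, w, fun ω => G \ H ω, fun ω => - M ω, h1, h2, ?_, ?_⟩
  · intro ω
    refine ⟨sdiff_le, ?_, by rw [specNorm_neg]; exact (h3 ω).2.2⟩
    have := reg_sdiff (h3 ω).1 (Nat.sub_le d a) hG (h3 ω).2.1
    rwa [Nat.sub_sub_self had] at this
  · intro u v t ht
    refine le_trans (le_of_eq ?_) (h4 u v t ht)
    refine Finset.sum_congr rfl fun ω _ => ?_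
    have hd' : (d : ℝ) ≠ 0 := by positivity
    have e : adjMat (G \ H ω) - ((a : ℝ) / d) • adjMat G + - M ω =
        - (adjMat (H ω) - (((d - a : ℕ) : ℝ) / d) • adjMat G + M ω) := by
      rw [adjMat_sdiff (h3 ω).1, Nat.cast_sub had, sub_div, div_self hd', sub_smul, one_smul]
      abel
    rw [e, Matrix.neg_mulVec, dotProduct_neg, abs_neg]

lemma good_odd {n k d a : ℕ} (hd : 0 < d) (had : 2 * a ≤ d) {G P : SimpleGraph (Fin n)} {B : ℝ}
    (hG : IsRegularGraph G (d + 1)) (hP : IsRegularGraph P 1) (hPG : P ≤ G)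
    (h : Good n k d a (G \ P) B) : Good n k (d + 1) a G (B + 1) := by
  obtain ⟨Ω, i, w, H, M, h1, h2, h3, h4⟩ := h
  refine ⟨Ω, i, w, H, fun ω => M ω + ((a : ℝ) / d) • (adjMat P + (-(1 / (d + 1 : ℝ))) • adjMat G),
    h1, h2, ?_, ?_⟩
  · intro ω
    refine ⟨(h3 ω).1.trans sdiff_le, (h3 ω).2.1, ?_⟩
    refine (specNorm_add _ _).trans (add_le_add (h3 ω).2.2 ?_)
    rw [specNorm_smul]
    have e1 : specNorm (adjMat P) ≤ 1 := by simpa using specNorm_adj P 1 hP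
    have e2 : specNorm (adjMat G) ≤ d + 1 := by simpa using specNorm_adj G (d + 1) hG
    have e3 := specNorm_add (adjMat P) ((-(1 / (d + 1 : ℝ))) • adjMat G)
    rw [specNorm_smul, abs_neg, abs_of_nonneg (by positivity)] at e3
    have e4 : 1 / (d + 1 : ℝ) * specNorm (adjMat G) ≤ 1 / (d + 1 : ℝ) * (d + 1) := by gcongr
    rw [one_div_mul_cancel (by positivity)] at e4
    rw [abs_of_nonneg (by positivity)]
    have e5 : (a : ℝ) / d ≤ 1 / 2 := by
      rw [div_le_div_iff₀ (by positivity) (by norm_num)]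
      have : (2 * a : ℝ) ≤ d := by exact_mod_cast had
      linarith
    calc _ ≤ (1 / 2 : ℝ) * 2 := by
          gcongr
          · exact specNorm_nonneg _
          · linarith
      _ = 1 := by norm_num
  · intro u v t ht
    have e0 : 2 * Real.logb 2 (d : ℝ) * Real.exp (-t ^ 2 / 2) ≤
        2 * Real.logb 2 ((d + 1 : ℕ) : ℝ) * Real.exp (-t ^ 2 / 2) := by
      gcongr
      · norm_num
      · omega
    refine le_trans (Finset.sum_le_sum fun ω _ => ?_) ((h4 u v t ht).trans e0)
    have e : adjMat (H ω) - ((a : ℝ) / (d + 1 : ℕ)) • adjMat G +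
        (M ω + ((a : ℝ) / d) • (adjMat P + (-(1 / (d + 1 : ℝ))) • adjMat G)) =
        adjMat (H ω) - ((a : ℝ) / d) • adjMat (G \ P) + M ω := by
      rw [adjMat_sdiff hPG]
      ext x y
      simp only [Matrix.add_apply, Matrix.sub_apply, Matrix.smul_apply, smul_eq_mul]
      push_cast
      field_simp
      ring
    rw [e]
    have e2 : t * (2 + √2) * √(d * n * (k : ℝ)) * ‖u‖ * ‖v‖ ≤
        t * (2 + √2) * √((d + 1 : ℕ) * n * (k : ℝ)) * ‖u‖ * ‖v‖ := by
      gcongr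
      omega
    by_cases hh : t * (2 + √2) * √((d + 1 : ℕ) * n * (k : ℝ)) * ‖u‖ * ‖v‖ <
          |u ⬝ᵥ (adjMat (H ω) - ((a : ℝ) / d) • adjMat (G \ P) + M ω).mulVec v|
    · rw [if_pos hh, if_pos (e2.trans_lt hh)]
    · rw [if_neg hh]
      split_ifs
      · exact h1 ω
      · exact le_rfl

lemma good_halve {n k e a : ℕ} (he : 0 < e) (hae : a ≤ e) (hk : n ≤ 2 ^ k)
    (c : Fin n → ℝ) (hc1 : ∀ x, c x = 1 ∨ c x = -1) {G : SimpleGraph (Fin n)} {B : ℝ}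
    (hc : ∀ x y, G.Adj x y → c y = - c x)
    (hG : IsRegularGraph G (2 * e))
    (h : ∀ G' ≤ G, IsRegularGraph G' e → Good n k e a G' B) :
    Good n k (2 * e) a G (B + 2 * √e) := by
  classical
  obtain ⟨ι, _, S, S0, F0, g1, g2, g3, g4, g5, g6⟩ := decomp c hc1 k G hc
    (fun x => by rw [hG x]; exact even_two_mul e)
  let T : (ι → Bool) → Matrix (Fin n) (Fin n) ℝ := fun ε => S0 + ∑ i, sg (ε i) • S i
  have hT : ∀ ε, Bal G (T ε) := fun ε => g1 (fun i => sg (ε i)) (fun i => by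
    unfold sg; split_ifs <;> simp)
  let G1 : (ι → Bool) → SimpleGraph (Fin n) := fun ε => posG G (T ε) (hT ε).1
  have hG1 : ∀ ε, G1 ε ≤ G := fun ε x y hxy => hxy.1
  have hA1 : ∀ ε, adjMat (G1 ε) = (1/2 : ℝ) • (adjMat G + T ε) := fun ε => posG_adjMat (hT ε)
  have hr1 : ∀ ε, IsRegularGraph (G1 ε) e := by
    intro ε x
    have := posG_deg (hT ε) x
    rw [hG x] at this
    have h2 : deg (G1 ε) x = deg (posG G (T ε) (hT ε).1) x := rfl
    omega
  have h' := fun ε => h (G1 ε) (hG1 ε) (hr1 ε)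
  choose Ω fΩ w H M h1 h2 h3 h4 using h'
  have he' : (0 : ℝ) < e := by exact_mod_cast he
  have hae' : (a : ℝ) / e ≤ 1 := by
    rw [div_le_one he']; exact_mod_cast hae
  have hae2 : (a : ℝ) / (2 * e) ≤ 1 / 2 := by
    rw [div_le_div_iff₀ (by positivity) (by norm_num)]
    have : (a : ℝ) ≤ e := by exact_mod_cast hae
    linarith
  set p : ℝ := (1/2 : ℝ) ^ Fintype.card ι with hp
  have hp0 : 0 ≤ p := by positivity
  have hp1 : ∑ _ε : ι → Bool, p = 1 := by
    rw [Finset.sum_const, Finset.card_univ, Fintype.card_fun, Fintype.card_bool, nsmul_eq_mul, hp]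
    push_cast
    rw [← mul_pow]
    norm_num
  refine ⟨(ε : ι → Bool) × Ω ε, inferInstance, fun x => p * w x.1 x.2, fun x => H x.1 x.2,
    fun x => M x.1 x.2 + (-((a : ℝ) / (2 * e))) • S0, ?_, ?_, ?_, ?_⟩
  · intro x; exact mul_nonneg hp0 (h1 _ _)
  · rw [Fintype.sum_sigma]
    simp only [← Finset.mul_sum, h2, mul_one]
    exact hp1
  · intro x
    refine ⟨(h3 x.1 x.2).1.trans (hG1 _), (h3 x.1 x.2).2.1, ?_⟩
    refine (specNorm_add _ _).trans (add_le_add (h3 x.1 x.2).2.2 ?_)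
    rw [specNorm_smul, abs_neg, abs_of_nonneg (by positivity)]
    have e1 := specNorm_left G F0 (2 * e) k (by simpa using hk) hG g4 g5 S0 g6
    have e2 : √(2 * ((2 * e : ℕ) : ℝ)) = 2 * √e := by
      have : (2 * ((2 * e : ℕ) : ℝ)) = 2 ^ 2 * e := by push_cast; ring
      rw [this, Real.sqrt_mul (by positivity), Real.sqrt_sq (by norm_num)]
    rw [e2] at e1
    calc _ ≤ (1 / 2 : ℝ) * (2 * (2 * √e)) := by
          gcongr
          exact specNorm_nonneg _
      _ = _ := by ring
  · intro u v t ht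
    rw [Fintype.sum_sigma]
    set s : ℝ := √(e * n * (k : ℝ)) * (‖u‖ * ‖v‖) with hs
    have hs0 : 0 ≤ s := by positivity
    have hsq : √(((2 * e : ℕ) : ℝ) * n * (k : ℝ)) = √2 * √(e * n * (k : ℝ)) := by
      rw [← Real.sqrt_mul (by norm_num)]
      congr 1; push_cast; ring
    let α : ι → ℝ := fun i => (a : ℝ) / (2 * e) * (u ⬝ᵥ (S i).mulVec v)
    have h22 : √2 * √2 = (2 : ℝ) := Real.mul_self_sqrt (by norm_num)
    have hα : ∑ i, α i ^ 2 ≤ (√2 * s) ^ 2 := by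
      have b1 : ∀ i, α i ^ 2 ≤ k * (‖u‖ * ‖v‖) ^ 2 * ∑ x, ∑ y, |S i x y| := by
        intro i
        set Z := ∑ x, ∑ y, |S i x y| with hZ
        have hZ0 : 0 ≤ Z := Finset.sum_nonneg fun _ _ => Finset.sum_nonneg fun _ _ => abs_nonneg _
        have b2 : |α i| ≤ 1 / 2 * (Z * (‖u‖ * ‖v‖)) := by
          simp only [α]
          rw [abs_mul, abs_of_nonneg (by positivity)]
          gcongr
          exact bil_abs _ _ _
        calc α i ^ 2 = |α i| ^ 2 := (sq_abs _).symm
          _ ≤ (1 / 2 * (Z * (‖u‖ * ‖v‖))) ^ 2 := by gcongr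
          _ = (1 / 4 * (‖u‖ * ‖v‖) ^ 2 * Z) * Z := by ring
          _ ≤ (1 / 4 * (‖u‖ * ‖v‖) ^ 2 * Z) * (4 * k) := by
              gcongr
              exact g2 i
          _ = _ := by ring
      have b3 : ∑ x, ∑ y, adjMat G x y = n * (2 * e) := by
        simp only [← deg_eq_sum, hG _]
        simp
      calc ∑ i, α i ^ 2 ≤ ∑ i, k * (‖u‖ * ‖v‖) ^ 2 * ∑ x, ∑ y, |S i x y| :=
            Finset.sum_le_sum fun i _ => b1 i
        _ = k * (‖u‖ * ‖v‖) ^ 2 * ∑ i, ∑ x, ∑ y, |S i x y| := by rw [Finset.mul_sum]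
        _ ≤ k * (‖u‖ * ‖v‖) ^ 2 * (n * (2 * e)) := by
            rw [← b3]; gcongr
        _ = (√2 * s) ^ 2 := by
            rw [hs, mul_pow √2, mul_pow √(_), Real.sq_sqrt (by norm_num), Real.sq_sqrt (by positivity)]
            ring
    have hH := hoeff α (√2 * s) t (by positivity) ht hα
    have key : ∀ ε ω, (if t * (2 + √2) * √((2 * e : ℕ) * n * (k : ℝ)) * ‖u‖ * ‖v‖ <
          |u ⬝ᵥ (adjMat (H ε ω) - ((a : ℝ) / (2 * e : ℕ)) • adjMat G +
            (M ε ω + (-((a : ℝ) / (2 * e))) • S0)).mulVec v| then p * w ε ω else 0) ≤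
        (if t * (√2 * s) < |∑ i, sg (ε i) * α i| then p else 0) * w ε ω +
        p * (if t * (2 + √2) * √(e * n * (k : ℝ)) * ‖u‖ * ‖v‖ <
          |u ⬝ᵥ (adjMat (H ε ω) - ((a : ℝ) / e) • adjMat (G1 ε) + M ε ω).mulVec v|
          then w ε ω else 0) := by
      intro ε ω
      have hw := h1 ε ω
      have hmat : adjMat (H ε ω) - ((a : ℝ) / (2 * e : ℕ)) • adjMat G +
            (M ε ω + (-((a : ℝ) / (2 * e))) • S0) =
          (adjMat (H ε ω) - ((a : ℝ) / e) • adjMat (G1 ε) + M ε ω) +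
            ((a : ℝ) / (2 * e)) • ∑ i, sg (ε i) • S i := by
        rw [hA1]
        ext x y
        simp only [T, Matrix.add_apply, Matrix.sub_apply, Matrix.smul_apply, smul_eq_mul]
        push_cast
        field_simp
        ring
      have hX1 : u ⬝ᵥ (((a : ℝ) / (2 * e)) • ∑ i, sg (ε i) • S i).mulVec v =
          ∑ i, sg (ε i) * α i := by
        rw [Matrix.smul_mulVec, Matrix.sum_mulVec, dotProduct_smul, dotProduct_sum, smul_eq_mul,
          Finset.mul_sum]
        refine Finset.sum_congr rfl fun i _ => ?_
        rw [Matrix.smul_mulVec, dotProduct_smul, smul_eq_mul]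
        simp only [α]
        ring
      rw [hmat, Matrix.add_mulVec, dotProduct_add, hX1, hsq]
      set X2 := u ⬝ᵥ (adjMat (H ε ω) - ((a : ℝ) / e) • adjMat (G1 ε) + M ε ω).mulVec v
      set X1 := ∑ i, sg (ε i) * α i
      have hpw : 0 ≤ p * w ε ω := mul_nonneg hp0 hw
      by_cases c1 : t * (√2 * s) < |X1|
      · rw [if_pos c1]
        split_ifs <;> linarith
      · by_cases c2 : t * (2 + √2) * √(e * n * (k : ℝ)) * ‖u‖ * ‖v‖ < |X2|
        · rw [if_neg c1, if_pos c2]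
          split_ifs <;> linarith
        · rw [if_neg c1, if_neg c2, if_neg]
          · simp
          · push Not at c1 c2 ⊢
            refine (abs_add_le X2 X1).trans ((add_le_add c2 c1).trans (le_of_eq ?_))
            rw [hs]
            linear_combination (-(t * √(e * n * (k : ℝ)) * (‖u‖ * ‖v‖))) * h22
    refine (Finset.sum_le_sum fun ε _ => Finset.sum_le_sum fun ω _ => key ε ω).trans ?_
    simp only [Finset.sum_add_distrib, ← Finset.mul_sum, h2, mul_one]
    have hlast : ∑ ε : ι → Bool, p * ∑ ω, (if t * (2 + √2) * √(e * n * (k : ℝ)) * ‖u‖ * ‖v‖ <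
          |u ⬝ᵥ (adjMat (H ε ω) - ((a : ℝ) / e) • adjMat (G1 ε) + M ε ω).mulVec v|
          then w ε ω else 0) ≤ 2 * Real.logb 2 e * Real.exp (-t ^ 2 / 2) := by
      refine (Finset.sum_le_sum fun ε _ => mul_le_mul_of_nonneg_left (h4 ε u v t ht) hp0).trans ?_
      rw [← Finset.sum_mul, hp1, one_mul]
    rw [← Finset.mul_sum] at hlast
    refine (add_le_add hH hlast).trans (le_of_eq ?_)
    push_cast
    rw [Real.logb_mul (by norm_num) (by positivity), Real.logb_self_eq_one (by norm_num)]
    ring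

lemma good_main (n k : ℕ) (hk : n ≤ 2 ^ k) (c : Fin n → ℝ) (hc1 : ∀ x, c x = 1 ∨ c x = -1) (d : ℕ) :
    ∀ (a : ℕ) (G : SimpleGraph (Fin n)), 0 < d → a ≤ d → (∀ x y, G.Adj x y → c y = - c x) →
      IsRegularGraph G d → Good n k d a G (6 * √d) := by
  induction d using Nat.strong_induction_on with
  | _ d ih =>
  have low : ∀ (a : ℕ) (G : SimpleGraph (Fin n)), 0 < d → 2 * a ≤ d →
      (∀ x y, G.Adj x y → c y = - c x) → IsRegularGraph G d → Good n k d a G (6 * √d) := by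
    intro a G hd had hc hG
    rcases Nat.eq_zero_or_pos a with rfl | ha
    · exact good_zero.mono (by positivity)
    obtain ⟨e, he | he⟩ := Nat.even_or_odd' d
    · subst he
      have := good_halve (by omega) (by omega) hk c hc1 hc hG (fun G' hG' hr =>
        ih e (by omega) a G' (by omega) (by omega) (fun x y h => hc x y (hG' h)) hr)
      refine this.mono ?_
      have h2 : (8 / 6 : ℝ) * √e ≤ √((2 * e : ℕ) : ℝ) := by
        apply Real.le_sqrt_of_sq_le
        rw [mul_pow, Real.sq_sqrt (by positivity)]
        push_cast
        nlinarith [(Nat.cast_nonneg e : (0:ℝ) ≤ e)]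
      linarith
    · subst he
      obtain ⟨P, hPG, hP⟩ := matching c hc1 G hc _ hd hG
      have hr' : IsRegularGraph (G \ P) (2 * e) := by
        simpa using reg_sdiff hPG (by omega) hG hP
      have hc' : ∀ x y, (G \ P).Adj x y → c y = - c x :=
        fun x y h => hc x y ((SimpleGraph.sdiff_adj _ _ _ _).1 h).1
      have := good_halve (by omega) (by omega) hk c hc1 hc' hr' (fun G' hG' hr =>
        ih e (by omega) a G' (by omega) (by omega) (fun x y h => hc' x y (hG' h)) hr)
      have := good_odd (by omega) (by omega) hG hP hPG this
      refine this.mono ?_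
      have h2 : (1 + 8 * √e) / 6 ≤ √((2 * e + 1 : ℕ) : ℝ) := by
        apply Real.le_sqrt_of_sq_le
        have := Real.sq_sqrt (Nat.cast_nonneg e : (0:ℝ) ≤ e)
        push_cast
        nlinarith [sq_nonneg (√e - 1)]
      linarith
  intro a G hd had hc hG
  by_cases h : 2 * a ≤ d
  · exact low a G hd h hc hG
  · exact good_compl hd had hG (low (d - a) G hd (by omega) hc hG)

end Aux

/-- a finitely supported probability distribution on pairs `(H, M)` of an
`a`-factor `H` of `G` and a matrix `M` of spectral norm at most `6√d`, displaying
concentration for the bilinear forms `uᵀ(A_H - (a/d)A_G + M)v`.  The probability of an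
event is the sum of the weights `p x` over the pairs `x` in the support satisfying it. -/
theorem stmt_3 (a d n : ℕ) (ha : 0 < a) (hd : 0 < d) (had : a ≤ d)
    (G : SimpleGraph (Fin n)) (hbip : Bipartite G) (hreg : IsRegularGraph G d) :
    ∃ (s : Finset (SimpleGraph (Fin n) × Matrix (Fin n) (Fin n) ℝ))
      (p : SimpleGraph (Fin n) × Matrix (Fin n) (Fin n) ℝ → ℝ),
      (∀ x ∈ s, 0 ≤ p x) ∧ (∑ x ∈ s, p x = 1) ∧
      (∀ x ∈ s, x.1 ≤ G ∧ IsRegularGraph x.1 a ∧ specNorm x.2 ≤ 6 * Real.sqrt d) ∧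
      ∀ (u v : Fin n → ℝ) (t : ℝ), 0 ≤ t →
        (∑ x ∈ s,
            {y : SimpleGraph (Fin n) × Matrix (Fin n) (Fin n) ℝ |
              t * (2 + Real.sqrt 2) * Real.sqrt (d * n * (Nat.clog 2 n : ℝ)) * ‖u‖ * ‖v‖ <
              |u ⬝ᵥ (adjMat y.1 - ((a : ℝ) / d) • adjMat G + y.2).mulVec v|}.indicator p x)
          ≤ 2 * Real.logb 2 d * Real.exp (-t ^ 2 / 2) := by

  classical
  obtain ⟨col⟩ := hbip
  obtain ⟨Ω, _, w, H, M, h1, h2, h3, h4⟩ := Aux.good_main n (Nat.clog 2 n)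
    (Nat.le_pow_clog (by norm_num) n) (fun x => if col x = 0 then 1 else -1)
    (fun x => by beta_reduce; split_ifs <;> simp) d a G hd had
    (fun x y hxy => by
      have := col.valid hxy
      beta_reduce
      split_ifs with e1 e2 e2
      · exact absurd (e2.trans e1.symm) this
      · norm_num
      · norm_num
      · exfalso; apply this; omega) hreg
  let f : Ω → SimpleGraph (Fin n) × Matrix (Fin n) (Fin n) ℝ := fun ω => (H ω, M ω)
  refine ⟨Finset.univ.image f, fun x => ∑ ω with f ω = x, w ω, ?_, ?_, ?_, ?_⟩
  · intro x _
    exact Finset.sum_nonneg fun ω _ => h1 ω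
  · rw [Finset.sum_fiberwise_of_maps_to (fun ω _ => Finset.mem_image_of_mem f (Finset.mem_univ ω)), h2]
  · intro x hx
    obtain ⟨ω, -, rfl⟩ := Finset.mem_image.1 hx
    exact h3 ω
  · intro u v t ht
    refine le_trans (le_of_eq ?_) (h4 u v t ht)
    rw [← Finset.sum_fiberwise_of_maps_to
      (fun ω _ => Finset.mem_image_of_mem f (Finset.mem_univ ω))]
    refine Finset.sum_congr rfl fun x _ => ?_
    simp only [Set.indicator_apply, Set.mem_ofPred_eq]
    split_ifs with hx
    · refine Finset.sum_congr rfl fun ω hω => ?_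
      rw [← (Finset.mem_filter.1 hω).2] at hx
      rw [if_pos hx]
    · symm
      refine Finset.sum_eq_zero fun ω hω => ?_
      rw [← (Finset.mem_filter.1 hω).2] at hx
      rw [if_neg hx]
end

section
/- Let G be a graph on n vertices with maximum degree at most d and with no cycles of length at most 2⌈log₂ n⌉. Then the spectral norm of the adjacency matrix of G satisfies ‖A_G‖ ≤ 2√2·√d. -/
theorem cyc_of_paths {V : Type*} {G : SimpleGraph V} {a b : V} (p q : G.Walk a b)
    (hp : p.IsPath) (hq : q.IsPath) (hne : p ≠ q) :
    ∃ (v : V) (c : G.Walk v v), c.IsCycle ∧ c.length ≤ p.length + q.length := by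
  classical
  set H : SimpleGraph V := SimpleGraph.fromEdgeSet {e | e ∈ p.edges ++ q.edges} with hH
  have hHe : H.edgeSet = {e | e ∈ p.edges ++ q.edges} := by
    rw [hH, SimpleGraph.edgeSet_fromEdgeSet]
    ext e
    simp only [Set.mem_diff, Set.mem_setOf_eq, List.mem_append]
    constructor
    · exact fun h => h.1
    · intro h
      refine ⟨h, ?_⟩
      have : e ∈ G.edgeSet := by
        rcases h with h | h
        · exact p.edges_subset_edgeSet h
        · exact q.edges_subset_edgeSet h
      exact G.not_isDiag_of_mem_edgeSet this
  have hpH : ∀ e ∈ p.edges, e ∈ H.edgeSet := by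
    intro e he; rw [hHe]; simp [he]
  have hqH : ∀ e ∈ q.edges, e ∈ H.edgeSet := by
    intro e he; rw [hHe]; simp [he]
  have hnac : ¬ H.IsAcyclic := by
    intro hac
    have := hac.path_unique ⟨p.transfer H hpH, hp.transfer hpH⟩ ⟨q.transfer H hqH, hq.transfer hqH⟩
    have h2 : p.transfer H hpH = q.transfer H hqH := congrArg Subtype.val this
    apply hne
    have h3 := congrArg SimpleGraph.Walk.support h2
    simp only [SimpleGraph.Walk.support_transfer] at h3
    exact SimpleGraph.Walk.ext_support h3
  unfold SimpleGraph.IsAcyclic at hnac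
  push Not at hnac
  obtain ⟨v, c, hc⟩ := hnac
  have hcG : ∀ e ∈ c.edges, e ∈ G.edgeSet := by
    intro e he
    have := c.edges_subset_edgeSet he
    rw [hHe] at this
    rcases List.mem_append.1 this with h | h
    · exact p.edges_subset_edgeSet h
    · exact q.edges_subset_edgeSet h
  refine ⟨v, c.transfer G hcG, hc.transfer hcG, ?_⟩
  rw [SimpleGraph.Walk.length_transfer, ← c.length_edges, ← p.length_edges, ← q.length_edges,
    ← List.length_append]
  apply List.Subperm.length_le
  apply List.subperm_of_subset hc.edges_nodup
  intro e he
  have := c.edges_subset_edgeSet he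
  rw [hHe] at this
  exact this

theorem spec_le {n : ℕ} (A : Matrix (Fin n) (Fin n) ℝ) (hA : A.IsHermitian) (k : ℕ) (hk : k ≠ 0)
    (c : ℝ) (hc : 0 ≤ c) (h : (A ^ (2 * k)).trace ≤ c ^ (2 * k)) :
    ‖Matrix.toEuclideanCLM (𝕜 := ℝ) A‖ ≤ c := by
  open scoped Matrix.Norms.L2Operator in
  rw [Matrix.l2_opNorm_toEuclideanCLM]
  have htr : (A ^ (2 * k)).trace = ∑ i, hA.eigenvalues i ^ (2 * k) := by
    conv_lhs => rw [hA.spectral_theorem, ← map_pow, Unitary.conjStarAlgAut_apply,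
      Matrix.trace_mul_cycle]
    simp [Matrix.diagonal_pow, Matrix.trace]
  have hev : ∀ i, |hA.eigenvalues i| ≤ c := by
    intro i
    have : |hA.eigenvalues i| ^ (2 * k) ≤ c ^ (2 * k) := by
      refine le_trans ?_ h
      rw [htr, (even_two_mul k).pow_abs]
      exact Finset.single_le_sum (f := fun i => hA.eigenvalues i ^ (2 * k))
        (fun j _ => (even_two_mul k).pow_nonneg _) (Finset.mem_univ i)
    exact (pow_le_pow_iff_left₀ (abs_nonneg _) hc (by omega)).1 this
  have hn : ‖A‖ = ‖(Matrix.diagonal (hA.eigenvalues) : Matrix (Fin n) (Fin n) ℝ)‖ := by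
    conv_lhs => rw [hA.spectral_theorem, Unitary.conjStarAlgAut_apply]
    rw [mul_assoc, CStarRing.norm_coe_unitary_mul, ← Unitary.coe_star,
      CStarRing.norm_mul_coe_unitary]
    rfl
  rw [hn, Matrix.l2_opNorm_diagonal, pi_norm_le_iff_of_nonneg hc]
  exact hev

theorem pow_zero_of_lt {n : ℕ} (G : SimpleGraph (Fin n)) [DecidableRel G.Adj] (m : ℕ) (u v : Fin n)
    (h : m < G.dist u v) : (G.adjMatrix ℝ ^ m) u v = 0 := by
  rw [SimpleGraph.adjMatrix_pow_apply_eq_card_walk]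
  norm_cast
  rw [Fintype.card_eq_zero_iff]
  refine ⟨fun p => ?_⟩
  obtain ⟨p, hp⟩ := p
  have h1 := SimpleGraph.dist_le p
  have hp' : p.length = m := hp
  omega

theorem pow_nonneg_entry {n : ℕ} (G : SimpleGraph (Fin n)) [DecidableRel G.Adj] (m : ℕ)
    (u v : Fin n) : 0 ≤ (G.adjMatrix ℝ ^ m) u v := by
  rw [SimpleGraph.adjMatrix_pow_apply_eq_card_walk]
  positivity

/-- two distinct closer neighbours give a short cycle -/
theorem closer_unique {n k : ℕ} (G : SimpleGraph (Fin n))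
    (hcycle : ∀ (v : Fin n) (c : G.Walk v v), c.IsCycle → 2 * k < c.length)
    (u v w w' : Fin n) (hr : G.Reachable u v) (hw : G.Adj u w) (hw' : G.Adj u w')
    (hd : G.dist w v + 1 = G.dist u v) (hd' : G.dist w' v + 1 = G.dist u v)
    (hk : G.dist u v ≤ k) : w = w' := by
  by_contra hne
  obtain ⟨p, hp⟩ := (hw.reachable.symm.trans hr).exists_walk_length_eq_dist
  obtain ⟨q, hq⟩ := (hw'.reachable.symm.trans hr).exists_walk_length_eq_dist
  have h1 : (SimpleGraph.Walk.cons hw p).length = G.dist u v := by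
    rw [SimpleGraph.Walk.length_cons]; omega
  have h2 : (SimpleGraph.Walk.cons hw' q).length = G.dist u v := by
    rw [SimpleGraph.Walk.length_cons]; omega
  obtain ⟨x, c, hc, hl⟩ := cyc_of_paths _ _ (SimpleGraph.Walk.isPath_of_length_eq_dist _ h1)
    (SimpleGraph.Walk.isPath_of_length_eq_dist _ h2) (by
      intro h
      have := congrArg SimpleGraph.Walk.snd h
      simp at this
      exact hne this)
  have := hcycle x c hc
  omega

theorem no_same {n k : ℕ} (G : SimpleGraph (Fin n))
    (hcycle : ∀ (v : Fin n) (c : G.Walk v v), c.IsCycle → 2 * k < c.length)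
    (u v w : Fin n) (hr : G.Reachable u v) (hw : G.Adj u w)
    (hd : G.dist w v = G.dist u v) (hk : G.dist u v < k) : False := by
  obtain ⟨p, hp⟩ := hr.exists_walk_length_eq_dist
  obtain ⟨q, hq⟩ := (hw.reachable.symm.trans hr).exists_walk_length_eq_dist
  have hu : u ∉ q.support := by
    intro hu
    have h1 := SimpleGraph.dist_le (q.dropUntil u hu)
    have h2 := congrArg SimpleGraph.Walk.length (q.take_spec hu)
    rw [SimpleGraph.Walk.length_append] at h2
    have h3 : (q.takeUntil u hu).length = 0 := by omega
    exact hw.ne (SimpleGraph.Walk.eq_of_length_eq_zero h3).symm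
  obtain ⟨x, c, hc, hl⟩ := cyc_of_paths _ _ (SimpleGraph.Walk.isPath_of_length_eq_dist _ hp)
    ((SimpleGraph.Walk.isPath_of_length_eq_dist _ hq).cons (h := hw) hu) (by
      intro h
      have := congrArg SimpleGraph.Walk.length h
      rw [SimpleGraph.Walk.length_cons] at this
      omega)
  have := hcycle x c hc
  rw [SimpleGraph.Walk.length_cons] at hl
  omega

theorem entry_bound {n k d : ℕ} (G : SimpleGraph (Fin n)) [DecidableRel G.Adj]
    (hcycle : ∀ (v : Fin n) (c : G.Walk v v), c.IsCycle → 2 * k < c.length)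
    (hdeg : ∀ v, G.degree v ≤ d) (b : ℝ) (hb : 0 < b) (hbd : b * b = d) (v : Fin n) (m : ℕ) :
    ∀ u, G.Reachable u v → m + G.dist u v ≤ 2 * k →
      (G.adjMatrix ℝ ^ m) u v * b ^ G.dist u v ≤ (2 * b) ^ m := by
  induction m with
  | zero =>
    intro u hr _
    by_cases huv : u = v
    · subst huv; simp
    · simp [Matrix.one_apply, huv]
  | succ m ih =>
    intro u hr hm
    by_cases hlt : m + 1 < G.dist u v
    · rw [pow_zero_of_lt _ _ _ _ hlt, zero_mul]; positivity
    have hlk : G.dist u v ≤ k := by omega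
    set l := G.dist u v with hl
    have hC : 0 ≤ (2 * b) ^ m := by positivity
    set C := (2 * b) ^ m with hCdef
    have key : ∀ w ∈ G.neighborFinset u, (G.adjMatrix ℝ ^ m) w v * b ^ l ≤
        C / b + if G.dist w v + 1 = l then b * C else 0 := by
      intro w hw
      have hadj : G.Adj u w := by simpa using hw
      have hrw : G.Reachable w v := hadj.reachable.symm.trans hr
      have hdiff := hadj.symm.diff_dist_adj (u := v)
      rw [G.dist_comm (u := v) (v := w), G.dist_comm (u := v) (v := u), ← hl] at hdiff
      have hCb : 0 ≤ C / b := by positivity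
      by_cases h1 : G.dist w v + 1 = l
      · rw [if_pos h1]
        have := ih w hrw (by omega)
        rw [← h1, pow_succ]
        nlinarith
      rw [if_neg h1, add_zero]
      by_cases h2 : G.dist w v = l
      · by_cases h3 : l < k
        · exact (no_same G hcycle u v w hr hadj (by omega) (by omega)).elim
        · rw [pow_zero_of_lt _ _ _ _ (by omega), zero_mul]; exact hCb
      have h4 : G.dist w v = l + 1 := by omega
      have := ih w hrw (by omega)
      rw [h4, pow_succ] at this
      rw [le_div_iff₀ hb]
      nlinarith
    have hcard : ∑ w ∈ G.neighborFinset u, (if G.dist w v + 1 = l then b * C else 0) ≤ b * C := by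
      rw [← Finset.sum_filter, Finset.sum_const, nsmul_eq_mul]
      have : (Finset.filter (fun w => G.dist w v + 1 = l) (G.neighborFinset u)).card ≤ 1 := by
        rw [Finset.card_le_one]
        intro w hw w' hw'
        simp only [Finset.mem_filter, SimpleGraph.mem_neighborFinset] at hw hw'
        exact closer_unique G hcycle u v w w' hr hw.1 hw'.1 hw.2 hw'.2 hlk
      have h' : ((Finset.filter (fun w => G.dist w v + 1 = l) (G.neighborFinset u)).card : ℝ) ≤ 1 := by
        exact_mod_cast this
      have : 0 ≤ b * C := by positivity
      nlinarith
    rw [pow_succ', SimpleGraph.adjMatrix_mul_apply, Finset.sum_mul]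
    refine (Finset.sum_le_sum key).trans ?_
    rw [Finset.sum_add_distrib, Finset.sum_const, nsmul_eq_mul, SimpleGraph.card_neighborFinset_eq_degree]
    have hd : (G.degree u : ℝ) * (C / b) ≤ b * C := by
      have h5 : (G.degree u : ℝ) ≤ b * b := by rw [hbd]; exact_mod_cast hdeg u
      have h6 : b * C = b * b * (C / b) := by field_simp
      rw [h6]
      exact mul_le_mul_of_nonneg_right h5 (by positivity)
    rw [pow_succ]
    linarith

/-- a graph on `n` vertices with maximum degree at most `d` and no cycles of
length at most `2⌈log₂ n⌉` has adjacency matrix of spectral norm at most `2√2·√d`.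
(Here `Nat.clog 2 n = ⌈log₂ n⌉`.) -/
theorem stmt_4 (n d : ℕ) (G : SimpleGraph (Fin n))
    (hdeg : ∀ v, deg G v ≤ d)
    (hcycle : ∀ (v : Fin n) (c : G.Walk v v), c.IsCycle → 2 * Nat.clog 2 n < c.length) :
    specNorm (adjMat G) ≤ 2 * Real.sqrt 2 * Real.sqrt d := by
  letI := Classical.decRel G.Adj
  have hdeg' : ∀ v, G.degree v ≤ d := hdeg
  change ‖Matrix.toEuclideanCLM (𝕜 := ℝ) (G.adjMatrix ℝ)‖ ≤ _
  have hc0 : 0 ≤ 2 * Real.sqrt 2 * Real.sqrt d := by positivity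
  have hzero : (∀ u v, ¬ G.Adj u v) →
      ‖Matrix.toEuclideanCLM (𝕜 := ℝ) (G.adjMatrix ℝ)‖ ≤ 2 * Real.sqrt 2 * Real.sqrt d := by
    intro h
    have : G.adjMatrix ℝ = 0 := by
      ext i j; simp [SimpleGraph.adjMatrix_apply, h i j]
    rw [this, map_zero, norm_zero]; exact hc0
  rcases Nat.eq_zero_or_pos d with hd0 | hd0
  · apply hzero
    intro u v huv
    have h1 := hdeg' u
    have h2 : 0 < G.degree u := (G.degree_pos_iff_exists_adj u).2 ⟨v, huv⟩
    omega
  rcases Nat.lt_or_ge n 2 with hn | hn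
  · apply hzero
    intro u v huv
    apply huv.ne
    ext
    omega
  have hk : 0 < Nat.clog 2 n := Nat.clog_pos (by norm_num) hn
  have hn2 : n ≤ 2 ^ Nat.clog 2 n := Nat.le_pow_clog (by norm_num) n
  generalize Nat.clog 2 n = k at *
  have hb : 0 < Real.sqrt d := Real.sqrt_pos.2 (by exact_mod_cast hd0)
  refine spec_le _ (G.isSymm_adjMatrix (α := ℝ)) k (by omega) _ hc0 ?_
  have hent : ∀ v, (G.adjMatrix ℝ ^ (2 * k)) v v ≤ (2 * Real.sqrt d) ^ (2 * k) := by
    intro v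
    have := entry_bound G hcycle hdeg' (Real.sqrt d) hb
      (Real.mul_self_sqrt (by positivity)) v (2 * k) v (SimpleGraph.Reachable.refl v) (by simp)
    simpa using this
  calc (G.adjMatrix ℝ ^ (2 * k)).trace ≤ ∑ v : Fin n, (2 * Real.sqrt d) ^ (2 * k) :=
        Finset.sum_le_sum fun v _ => hent v
    _ = n * (2 * Real.sqrt d) ^ (2 * k) := by simp
    _ ≤ 2 ^ k * (2 * Real.sqrt d) ^ (2 * k) := by
        apply mul_le_mul_of_nonneg_right _ (by positivity)
        exact_mod_cast hn2
    _ = (2 * Real.sqrt 2 * Real.sqrt d) ^ (2 * k) := by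
        have : (2 : ℝ) ^ k = Real.sqrt 2 ^ (2 * k) := by
          rw [pow_mul, Real.sq_sqrt (by norm_num)]
        rw [this, ← mul_pow]
        congr 1
        ring
end
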